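/- Fix d ≥ 1, let H be any d×d Hadamard matrix (entries in {−1,+1} with H·Hᵀ = d·I), let D be a random diagonal matrix with i.i.d. Rademacher diagonal entries, and let x = (x_1,…,x_d) be a random vector, independent of D, whose coordinates are i.i.d. real random variables with E[x_j²] = σ² ∈ (0,∞) and E[|x_j|³] = ρ < ∞. Then for every coordinate i, the CDF F_{i,d} of (1/σ)·(R_H x)_i, where R_H x = (1/√d)·H·D·x, satisfies sup_{t ∈ ℝ} |F_{i,d}(t) − Φ(t)| ≤ 0.409·ρ/(σ³·√d), where Φ is the CDF of the standard normal distribution. -/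

import Mathlib

open Matrix MeasureTheory ProbabilityTheory BigOperators
open scoped ENNReal

/-- The Rademacher distribution on `ℝ`: `±1` each with probability `1/2`. -/
noncomputable def radMeasure : Measure ℝ :=
  (2 : ℝ≥0∞)⁻¹ • Measure.dirac 1 + (2 : ℝ≥0∞)⁻¹ • Measure.dirac (-1)

/-- The joint law of `d` i.i.d. pairs `(x_j, D_jj)`, where `x_j ∼ ν` and `D_jj` is
Rademacher, with `x` and `D` independent. -/
noncomputable def pairPi (d : ℕ) (ν : Measure ℝ) : Measure (Fin d → ℝ × ℝ) :=
  Measure.pi fun _ => ν.prod radMeasure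

/-- The `i`-th coordinate of the randomized Hadamard transform
`(R_H x)_i = (1/√d) ∑_j x_j H_{ij} D_{jj}`, as a function of the sample
`w : Fin d → ℝ × ℝ` with `w j = (x_j, D_jj)`. -/
noncomputable def rhCoord {d : ℕ} (H : Matrix (Fin d) (Fin d) ℝ) (i : Fin d)
    (w : Fin d → ℝ × ℝ) : ℝ :=
  (1 / Real.sqrt d) * ∑ j, (w j).1 * H i j * (w j).2

/-- The CDF of the standard normal distribution. -/
noncomputable def stdNormalCDF (t : ℝ) : ℝ :=
  ((gaussianReal 0 1) (Set.Iic t)).toReal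

open Filter Topology

/-- Comparison of two functions on `[0, ∞)` through their derivatives. -/
lemma nonneg_of_deriv_nonneg_of_zero {g g' : ℝ → ℝ} {a : ℝ} (h0 : 0 ≤ g 0)
    (hg : ∀ x, HasDerivAt g (g' x) x) (hg' : ∀ x, 0 ≤ x → x ≤ a → 0 ≤ g' x) {x : ℝ}
    (hx : 0 ≤ x) (hxa : x ≤ a) : 0 ≤ g x := by
  have hmono : MonotoneOn g (Set.Icc 0 a) := by
    apply monotoneOn_of_deriv_nonneg (convex_Icc 0 a)
    · exact fun y _ => (hg y).continuousAt.continuousWithinAt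
    · exact fun y _ => (hg y).differentiableAt.differentiableWithinAt
    · intro y hy
      rw [interior_Icc] at hy
      rw [(hg y).deriv]
      exact hg' y hy.1.le hy.2.le
  have := hmono ⟨le_rfl, hx.trans hxa⟩ ⟨hx, hxa⟩ hx
  linarith

lemma cos_lower_two (x : ℝ) : 1 - x ^ 2 / 2 ≤ Real.cos x := Real.one_sub_sq_div_two_le_cos

lemma sin_lower_three {x : ℝ} (hx : 0 ≤ x) : x - x ^ 3 / 6 ≤ Real.sin x := by
  have := nonneg_of_deriv_nonneg_of_zero (g := fun x => Real.sin x - (x - x ^ 3 / 6))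
    (g' := fun x => Real.cos x - (1 - 3 * x ^ 2 / 6)) (a := x) (by simp)
    (fun y => by
      refine HasDerivAt.congr_deriv ((Real.hasDerivAt_sin y).fun_sub ((hasDerivAt_id' y).fun_sub
        ((hasDerivAt_pow 3 y).div_const 6))) ?_
      norm_num)
    (fun y hy _ => by have := cos_lower_two y; linarith) hx le_rfl
  linarith

lemma cos_upper_four {x : ℝ} (hx : 0 ≤ x) : Real.cos x ≤ 1 - x ^ 2 / 2 + x ^ 4 / 24 := by
  have := nonneg_of_deriv_nonneg_of_zero (g := fun x => 1 - x ^ 2 / 2 + x ^ 4 / 24 - Real.cos x)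
    (g' := fun x => Real.sin x - (x - x ^ 3 / 6)) (a := x) (by simp)
    (fun y => by
      refine HasDerivAt.congr_deriv (((((hasDerivAt_const y (1:ℝ)).fun_sub ((hasDerivAt_pow 2 y).div_const 2)).fun_add
        ((hasDerivAt_pow 4 y).div_const 24)).fun_sub (Real.hasDerivAt_cos y))) ?_
      norm_num; ring)
    (fun y hy _ => by have := sin_lower_three hy; linarith) hx le_rfl
  linarith

lemma sin_upper_five {x : ℝ} (hx : 0 ≤ x) : Real.sin x ≤ x - x ^ 3 / 6 + x ^ 5 / 120 := by
  have := nonneg_of_deriv_nonneg_of_zero (g := fun x => x - x ^ 3 / 6 + x ^ 5 / 120 - Real.sin x)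
    (g' := fun x => 1 - x ^ 2 / 2 + x ^ 4 / 24 - Real.cos x) (a := x) (by simp)
    (fun y => by
      refine HasDerivAt.congr_deriv (((((hasDerivAt_id' y).fun_sub ((hasDerivAt_pow 3 y).div_const 6)).fun_add
        ((hasDerivAt_pow 5 y).div_const 120)).fun_sub (Real.hasDerivAt_sin y))) ?_
      norm_num; ring)
    (fun y hy _ => by have := cos_upper_four hy; linarith) hx le_rfl
  linarith

lemma cos_lower_six {x : ℝ} (hx : 0 ≤ x) :
    1 - x ^ 2 / 2 + x ^ 4 / 24 - x ^ 6 / 720 ≤ Real.cos x := by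
  have := nonneg_of_deriv_nonneg_of_zero
    (g := fun x => Real.cos x - (1 - x ^ 2 / 2 + x ^ 4 / 24 - x ^ 6 / 720))
    (g' := fun x => x - x ^ 3 / 6 + x ^ 5 / 120 - Real.sin x) (a := x) (by simp)
    (fun y => by
      refine HasDerivAt.congr_deriv (((Real.hasDerivAt_cos y).fun_sub
        ((((hasDerivAt_const y (1:ℝ)).fun_sub ((hasDerivAt_pow 2 y).div_const 2)).fun_add
        ((hasDerivAt_pow 4 y).div_const 24)).fun_sub ((hasDerivAt_pow 6 y).div_const 720)))) ?_
      norm_num; ring)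
    (fun y hy _ => by have := sin_upper_five hy; linarith) hx le_rfl
  linarith

lemma sin_lower_seven {x : ℝ} (hx : 0 ≤ x) :
    x - x ^ 3 / 6 + x ^ 5 / 120 - x ^ 7 / 5040 ≤ Real.sin x := by
  have := nonneg_of_deriv_nonneg_of_zero
    (g := fun x => Real.sin x - (x - x ^ 3 / 6 + x ^ 5 / 120 - x ^ 7 / 5040))
    (g' := fun x => Real.cos x - (1 - x ^ 2 / 2 + x ^ 4 / 24 - x ^ 6 / 720)) (a := x) (by simp)
    (fun y => by
      refine HasDerivAt.congr_deriv (((Real.hasDerivAt_sin y).fun_sub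
        ((((hasDerivAt_id' y).fun_sub ((hasDerivAt_pow 3 y).div_const 6)).fun_add
        ((hasDerivAt_pow 5 y).div_const 120)).fun_sub ((hasDerivAt_pow 7 y).div_const 5040)))) ?_
      norm_num; ring)
    (fun y hy _ => by have := cos_lower_six hy; linarith) hx le_rfl
  linarith

lemma cos_upper_eight {x : ℝ} (hx : 0 ≤ x) :
    Real.cos x ≤ 1 - x ^ 2 / 2 + x ^ 4 / 24 - x ^ 6 / 720 + x ^ 8 / 40320 := by
  have := nonneg_of_deriv_nonneg_of_zero
    (g := fun x => 1 - x ^ 2 / 2 + x ^ 4 / 24 - x ^ 6 / 720 + x ^ 8 / 40320 - Real.cos x)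
    (g' := fun x => Real.sin x - (x - x ^ 3 / 6 + x ^ 5 / 120 - x ^ 7 / 5040)) (a := x) (by simp)
    (fun y => by
      refine HasDerivAt.congr_deriv (((((((hasDerivAt_const y (1:ℝ)).fun_sub ((hasDerivAt_pow 2 y).div_const 2)).fun_add
        ((hasDerivAt_pow 4 y).div_const 24)).fun_sub ((hasDerivAt_pow 6 y).div_const 720)).fun_add
        ((hasDerivAt_pow 8 y).div_const 40320)).fun_sub (Real.hasDerivAt_cos y))) ?_
      norm_num; ring)
    (fun y hy _ => by have := sin_lower_seven hy; linarith) hx le_rfl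
  linarith

/-- The Taylor polynomials of `exp (-z)` alternate around it on `[0, ∞)`. -/
lemma exp_neg_taylor_alternating (m : ℕ) {z : ℝ} (hz : 0 ≤ z) :
    0 ≤ (-1) ^ m * (Real.exp (-z) - ∑ j ∈ Finset.range m, (-z) ^ j / (j.factorial : ℝ)) := by
  induction m generalizing z with
  | zero => simpa using (Real.exp_pos _).le
  | succ m ih =>
    refine nonneg_of_deriv_nonneg_of_zero (a := z)
      (g := fun z => (-1) ^ (m + 1) *
        (Real.exp (-z) - ∑ j ∈ Finset.range (m + 1), (-z) ^ j / (j.factorial : ℝ)))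
      (g' := fun z => (-1) ^ m *
        (Real.exp (-z) - ∑ j ∈ Finset.range m, (-z) ^ j / (j.factorial : ℝ)))
      ?_ ?_ (fun y hy _ => ih hy) hz le_rfl
    · simp [Finset.sum_range_succ']
    · intro y
      have h1 : HasDerivAt (fun z : ℝ => Real.exp (-z)) (-Real.exp (-y)) y := by
        simpa using (hasDerivAt_neg y).exp
      have h2 : HasDerivAt (fun z : ℝ => ∑ j ∈ Finset.range (m + 1), (-z) ^ j / (j.factorial : ℝ))
          (-∑ j ∈ Finset.range m, (-y) ^ j / (j.factorial : ℝ)) y := by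
        have : HasDerivAt (fun z : ℝ => ∑ j ∈ Finset.range (m + 1), (-z) ^ j / (j.factorial : ℝ))
            (∑ j ∈ Finset.range (m + 1), ((j : ℝ) * (-y) ^ (j - 1) * (-1)) / (j.factorial : ℝ))
            y := by
          refine HasDerivAt.fun_sum fun j _ => ?_
          exact ((hasDerivAt_neg y).pow j).div_const _
        refine this.congr_deriv ?_
        rw [Finset.sum_range_succ']
        simp only [Nat.cast_zero, zero_mul, zero_div, add_zero, ← Finset.sum_neg_distrib]
        refine Finset.sum_congr rfl fun j _ => ?_
        rw [Nat.factorial_succ]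
        push_cast
        have : (j.factorial : ℝ) ≠ 0 := by positivity
        have : (j : ℝ) + 1 ≠ 0 := by positivity
        field_simp
      refine HasDerivAt.congr_deriv ((h1.fun_sub h2).const_mul ((-1 : ℝ) ^ (m + 1))) ?_
      ring

lemma exp_neg_lower_two {z : ℝ} (hz : 0 ≤ z) : 1 - z + z ^ 2 / 2 - z ^ 3 / 6 ≤ Real.exp (-z) := by
  have := exp_neg_taylor_alternating 4 hz
  simp [Finset.sum_range_succ, Nat.factorial] at this
  nlinarith [this]

lemma exp_neg_upper_four {z : ℝ} (hz : 0 ≤ z) :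
    Real.exp (-z) ≤ 1 - z + z ^ 2 / 2 - z ^ 3 / 6 + z ^ 4 / 24 := by
  have := exp_neg_taylor_alternating 5 hz
  simp [Finset.sum_range_succ, Nat.factorial] at this
  nlinarith [this]

/-- The cosine is dominated by the Gaussian on `[0, 2]`. -/
lemma cos_le_exp_neg_sq_div_two {s : ℝ} (h0 : 0 ≤ s) (h2 : s ≤ 2) :
    Real.cos s ≤ Real.exp (-(s ^ 2 / 2)) := by
  have h1 := cos_upper_four h0
  have h3 := exp_neg_lower_two (z := s ^ 2 / 2) (by positivity)
  have : 0 ≤ s ^ 4 * (4 - s ^ 2) := mul_nonneg (by positivity) (by nlinarith)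
  nlinarith [this]

/-- The function `1/s - cot s`. -/
noncomputable def cotGap (s : ℝ) : ℝ := 1 / s - Real.cos s / Real.sin s

/-- The odd part of Prawitz' smoothing kernel, on the interval `(0, π)`. -/
noncomputable def prawitzG (s : ℝ) : ℝ :=
  1 / Real.pi + (1 - s / Real.pi) * (Real.cos s / Real.sin s)

lemma prawitzG_eq {s : ℝ} (hs : 0 < s) :
    prawitzG s = 1 / s - (1 - s / Real.pi) * cotGap s := by
  have := Real.pi_pos
  unfold prawitzG cotGap
  field_simp
  ring

lemma prawitzG_eq_reflect {s : ℝ} (hs : s < Real.pi) :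
    prawitzG s = (1 - s / Real.pi) * cotGap (Real.pi - s) := by
  have := Real.pi_pos
  have h : Real.pi - s ≠ 0 := by linarith
  unfold prawitzG cotGap
  rw [Real.cos_pi_sub, Real.sin_pi_sub, neg_div, sub_neg_eq_add, mul_add]
  congr 1
  field_simp

lemma sq_mul_sin_div_three_le {s : ℝ} (h0 : 0 ≤ s) (h1 : s ≤ Real.pi) :
    s ^ 2 / 3 * Real.sin s ≤ Real.sin s - s * Real.cos s := by
  have key : ∀ y, 0 ≤ y → y ≤ Real.pi → 0 ≤ Real.sin y - y * Real.cos y := fun y hy hy' =>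
    nonneg_of_deriv_nonneg_of_zero (g := fun y => Real.sin y - y * Real.cos y)
      (g' := fun y => y * Real.sin y) (a := Real.pi) (by simp)
      (fun y => ((Real.hasDerivAt_sin y).fun_sub
        ((hasDerivAt_id' y).fun_mul (Real.hasDerivAt_cos y))).congr_deriv (by ring))
      (fun y hy hy' => mul_nonneg hy (Real.sin_nonneg_of_nonneg_of_le_pi hy hy')) hy hy'
  have := nonneg_of_deriv_nonneg_of_zero
      (g := fun y => Real.sin y - y * Real.cos y - y ^ 2 / 3 * Real.sin y)
      (g' := fun y => y / 3 * (Real.sin y - y * Real.cos y)) (a := Real.pi) (by simp)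
      (fun y => (((Real.hasDerivAt_sin y).fun_sub
        ((hasDerivAt_id' y).fun_mul (Real.hasDerivAt_cos y))).fun_sub
        (((hasDerivAt_pow 2 y).div_const 3).fun_mul (Real.hasDerivAt_sin y))).congr_deriv
          (by norm_num; ring))
      (fun y hy hy' => mul_nonneg (by positivity) (key y hy hy')) h0 h1
  linarith

lemma cotGap_eq {s : ℝ} (h0 : 0 < s) (h1 : s < Real.pi) :
    cotGap s = (Real.sin s - s * Real.cos s) / (s * Real.sin s) := by
  have := (Real.sin_pos_of_pos_of_lt_pi h0 h1).ne'
  unfold cotGap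
  field_simp

lemma third_le_cotGap {s : ℝ} (h0 : 0 < s) (h1 : s < Real.pi) : s / 3 ≤ cotGap s := by
  have hs := Real.sin_pos_of_pos_of_lt_pi h0 h1
  rw [cotGap_eq h0 h1, le_div_iff₀ (by positivity)]
  have := sq_mul_sin_div_three_le h0.le h1.le
  nlinarith

lemma cotGap_nonneg {s : ℝ} (h0 : 0 < s) (h1 : s < Real.pi) : 0 ≤ cotGap s :=
  le_trans (by positivity) (third_le_cotGap h0 h1)

lemma cotGap_le_half {s : ℝ} (h0 : 0 < s) (h1 : s ≤ Real.pi / 2) : cotGap s ≤ s / 2 := by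
  have hpi := Real.pi_pos
  have hs := Real.sin_pos_of_pos_of_lt_pi h0 (by linarith)
  rw [cotGap_eq h0 (by linarith), div_le_iff₀ (by positivity)]
  have := nonneg_of_deriv_nonneg_of_zero
      (g := fun y => y ^ 2 / 2 * Real.sin y - (Real.sin y - y * Real.cos y))
      (g' := fun y => y ^ 2 / 2 * Real.cos y) (a := Real.pi / 2) (by simp)
      (fun y => ((((hasDerivAt_pow 2 y).div_const 2).fun_mul (Real.hasDerivAt_sin y)).fun_sub
        ((Real.hasDerivAt_sin y).fun_sub
        ((hasDerivAt_id' y).fun_mul (Real.hasDerivAt_cos y)))).congr_deriv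
          (by norm_num))
      (fun y hy hy' => mul_nonneg (by positivity)
        (Real.cos_nonneg_of_neg_pi_div_two_le_of_le (by linarith) hy')) h0.le h1
  nlinarith

lemma cotGap_le_quadratic {s : ℝ} (h0 : 0 < s) (h1 : s ≤ 6 / 5) :
    cotGap s ≤ s / 3 + s ^ 2 / 25 := by
  have hpi := Real.pi_gt_three
  have hs := Real.sin_pos_of_pos_of_lt_pi h0 (by linarith)
  rw [cotGap_eq h0 (by linarith), div_le_iff₀ (by positivity)]
  have a1 := sin_upper_five h0.le
  have a2 := cos_lower_six h0.le
  have a3 := sin_lower_three h0.le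
  have b1 : s * (1 - s ^ 2 / 2 + s ^ 4 / 24 - s ^ 6 / 720) ≤ s * Real.cos s := by gcongr
  have b2 : (s / 3 + s ^ 2 / 25) * (s * (s - s ^ 3 / 6)) ≤
      (s / 3 + s ^ 2 / 25) * (s * Real.sin s) := by gcongr
  have b3 : 0 ≤ s ^ 4 * (1 / 25 - s / 45 - s ^ 2 / 150 - s ^ 3 / 720) :=
    mul_nonneg (by positivity) (by
      have e1 : s ^ 2 ≤ (6 / 5) ^ 2 := by gcongr
      have e2 : s ^ 3 ≤ (6 / 5) ^ 3 := by gcongr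
      linarith)
  nlinarith

lemma prawitzG_nonneg {s : ℝ} (h0 : 0 < s) (h1 : s < Real.pi) : 0 ≤ prawitzG s := by
  rw [prawitzG_eq_reflect h1]
  refine mul_nonneg ?_ (cotGap_nonneg (by linarith) (by linarith))
  rw [sub_nonneg, div_le_one Real.pi_pos]
  exact h1.le

lemma one_sub_div_pi_nonneg {s : ℝ} (h1 : s ≤ Real.pi) : 0 ≤ 1 - s / Real.pi := by
  rw [sub_nonneg, div_le_one Real.pi_pos]
  exact h1

lemma prawitzG_le_inv {s : ℝ} (h0 : 0 < s) (h1 : s < Real.pi) : prawitzG s ≤ 1 / s := by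
  rw [prawitzG_eq h0]
  have := mul_nonneg (one_sub_div_pi_nonneg h1.le) (cotGap_nonneg h0 h1)
  linarith

lemma kernel_polynomial_bound {u x : ℝ} (h0 : 0 ≤ u) (h1 : u ≤ 1 / 2)
    (hx : x = Real.pi ^ 2 * u ^ 2 * (1 - u)) : x * (1 / 3 - u) + x ^ 2 / 9 ≤ 0.0816 := by
  have hw0 : 0 ≤ u ^ 2 * (1 - u) := mul_nonneg (by positivity) (by linarith)
  have hx0 : 0 ≤ x := by rw [hx, mul_assoc]; positivity
  have hpi : Real.pi ^ 2 ≤ 9.87 := by nlinarith [Real.pi_lt_d4, Real.pi_pos]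
  have hxw : x ≤ 9.87 * (u ^ 2 * (1 - u)) := by rw [hx, mul_assoc]; gcongr
  have h2 : u ^ 2 * (1 - u) ≤ 1 / 8 := by nlinarith [mul_nonneg h0 (sub_nonneg.2 h1)]
  have key : 9.87 * (u ^ 2 * (1 - u)) * (1 / 3 - u) + (9.87 * (u ^ 2 * (1 - u))) ^ 2 / 9
      ≤ 0.0816 := by
    nlinarith [mul_nonneg h0 (sub_nonneg.2 h1), sq_nonneg (u - 0.28), sq_nonneg (u * (u - 0.28)),
      sq_nonneg (u ^ 2 * (u - 0.28)), sq_nonneg (u - u ^ 2 - 0.2), mul_nonneg hw0 (sub_nonneg.2 h1)]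
  have : 0 ≤ (9.87 * (u ^ 2 * (1 - u)) - x) * ((1 / 3 - u) + (9.87 * (u ^ 2 * (1 - u)) + x) / 9) := by
    refine mul_nonneg (by linarith) ?_
    have hx9 : 9 * (u ^ 2 * (1 - u)) ≤ x := by
      rw [hx, mul_assoc (Real.pi ^ 2)]
      gcongr
      nlinarith [Real.pi_gt_three]
    nlinarith [mul_nonneg (sub_nonneg.2 h1) (sq_nonneg u), sq_nonneg (u - 1 / 2)]
  nlinarith

lemma sq_add_prawitzG_sq_le {s : ℝ} (h0 : 0 < s) (h1 : s < Real.pi) :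
    (1 - s / Real.pi) ^ 2 + prawitzG s ^ 2 ≤ (1.04 / s) ^ 2 := by
  have hpi := Real.pi_pos
  have hq := one_sub_div_pi_nonneg h1.le
  rw [div_pow, le_div_iff₀ (by positivity)]
  rcases le_total s (Real.pi / 2) with h | h
  · set u := s / Real.pi with hu
    have hsu : s = Real.pi * u := by rw [hu]; field_simp
    have hu0 : 0 ≤ u := by positivity
    have hu1 : u ≤ 1 / 2 := by rw [hu, div_le_iff₀ hpi]; linarith
    have hk := kernel_polynomial_bound hu0 hu1 rfl
    have hG := prawitzG_eq h0
    have hc := third_le_cotGap h0 h1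
    have hsG : s * prawitzG s ≤ 1 - Real.pi ^ 2 * u ^ 2 * (1 - u) / 3 := by
      rw [hG, ← hu, mul_sub, mul_one_div_cancel h0.ne']
      have : s * ((1 - u) * (s / 3)) ≤ s * ((1 - u) * cotGap s) := by gcongr
      have e : s * ((1 - u) * (s / 3)) = Real.pi ^ 2 * u ^ 2 * (1 - u) / 3 := by
        rw [hsu]; ring
      linarith
    have hsG0 : 0 ≤ s * prawitzG s := mul_nonneg h0.le (prawitzG_nonneg h0 h1)
    have := pow_le_pow_left₀ hsG0 hsG 2
    have e : ((1 - u) ^ 2 + prawitzG s ^ 2) * s ^ 2 =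
      (1 - u) ^ 2 * (Real.pi * u) ^ 2 + (s * prawitzG s) ^ 2 := by rw [← hsu]; ring
    rw [e]
    nlinarith
  · have hc0 := cotGap_nonneg (s := Real.pi - s) (by linarith) (by linarith)
    have hc := cotGap_le_half (s := Real.pi - s) (by linarith) (by linarith)
    rw [prawitzG_eq_reflect h1]
    have hc2 : cotGap (Real.pi - s) ^ 2 ≤ 0.62 := by
      have : cotGap (Real.pi - s) ≤ 0.7855 := by linarith [Real.pi_lt_d4]
      nlinarith
    have hqs : ((1 - s / Real.pi) * s) ^ 2 ≤ 0.6174 := by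
      have h2 : (1 - s / Real.pi) * s ≤ Real.pi / 4 := by
        have : Real.pi * ((1 - s / Real.pi) * s) ≤ Real.pi * (Real.pi / 4) := by
          have e : Real.pi * ((1 - s / Real.pi) * s) = (Real.pi - s) * s := by field_simp
          rw [e]; nlinarith [sq_nonneg (s - Real.pi / 2)]
        exact le_of_mul_le_mul_left this hpi
      have h3 : 0 ≤ (1 - s / Real.pi) * s := by positivity
      nlinarith [Real.pi_lt_d4]
    have e : ((1 - s / Real.pi) ^ 2 + ((1 - s / Real.pi) * cotGap (Real.pi - s)) ^ 2) * s ^ 2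
      = ((1 - s / Real.pi) * s) ^ 2 * (1 + cotGap (Real.pi - s) ^ 2) := by ring
    rw [e]
    nlinarith [sq_nonneg ((1 - s / Real.pi) * s), sq_nonneg (cotGap (Real.pi - s))]

lemma measurable_prawitzG : Measurable prawitzG := by
  unfold prawitzG
  fun_prop

/-- Riemann–Lebesgue lemma for the real trigonometric system. -/
lemma tendsto_integral_mul_cos_and_sin (h : ℝ → ℝ) (hi : Integrable h) :
    Tendsto (fun a : ℝ => ∫ s, h s * Real.cos (a * s)) atTop (𝓝 0) ∧
    Tendsto (fun a : ℝ => ∫ s, h s * Real.sin (a * s)) atTop (𝓝 0) := by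
  have hRL := Real.tendsto_integral_exp_smul_cocompact (fun s => (h s : ℂ))
  have hlin : Tendsto (fun a : ℝ => a / (2 * Real.pi)) atTop (cocompact ℝ) :=
    (tendsto_id.atTop_div_const Real.two_pi_pos).mono_right atTop_le_cocompact
  have hc := hRL.comp hlin
  have hint : ∀ a : ℝ, Integrable (fun s => Real.fourierChar (-(s * (a / (2 * Real.pi)))) • (h s : ℂ)) := by
    intro a
    have := (Real.fourierIntegral_convergent_iff (μ := volume) (f := fun s => (h s : ℂ))
      (a / (2 * Real.pi))).2 hi.ofReal
    simpa [mul_comm] using this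
  have hpt : ∀ a s : ℝ, Real.fourierChar (-(s * (a / (2 * Real.pi)))) • (h s : ℂ) =
      (h s * Real.cos (a * s) : ℝ) - (h s * Real.sin (a * s) : ℝ) * Complex.I := by
    intro a s
    rw [Circle.smul_def, Real.fourierChar_apply, smul_eq_mul]
    have : ((2 * Real.pi * -(s * (a / (2 * Real.pi))) : ℝ) : ℂ) = ((-(a * s) : ℝ) : ℂ) := by
      congr 1
      field_simp
    rw [this, Complex.exp_mul_I, ← Complex.ofReal_cos, ← Complex.ofReal_sin, Real.cos_neg,
      Real.sin_neg]
    push_cast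
    ring
  constructor
  · have h1 := (Complex.continuous_re.tendsto 0).comp hc
    refine (h1.congr fun a => ?_)
    simp only [Function.comp]
    rw [← RCLike.re_eq_complex_re, ← integral_re (hint a)]
    refine integral_congr_ae (ae_of_all _ fun s => ?_)
    simp only [hpt, RCLike.re_eq_complex_re, Complex.sub_re, Complex.ofReal_re, Complex.re_ofReal_mul,
      Complex.I_re, mul_zero, sub_zero]
  · have h1 := ((Complex.continuous_im.tendsto 0).comp hc).neg
    simp only [Complex.zero_im, neg_zero] at h1
    refine (h1.congr fun a => ?_)
    simp only [Function.comp]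
    rw [← RCLike.im_eq_complex_im, ← integral_im (hint a), ← integral_neg]
    refine integral_congr_ae (ae_of_all _ fun s => ?_)
    simp only [hpt, RCLike.im_eq_complex_im, Complex.sub_im, Complex.ofReal_im, Complex.im_ofReal_mul,
      Complex.I_im, mul_one, zero_sub, neg_neg]

/-- Prawitz' majorant of the indicator function of `[0, ∞)`. -/
noncomputable def prawitzMajorant (a : ℝ) : ℝ :=
  1 / 2 + 1 / Real.pi * ∫ s in Set.Ioo 0 Real.pi,
    ((1 - s / Real.pi) * Real.cos (a * s) + prawitzG s * Real.sin (a * s))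

lemma abs_sin_le_abs_mul (a s : ℝ) (hs : 0 ≤ s) : |Real.sin (a * s)| ≤ |a| * s := by
  calc |Real.sin (a * s)| ≤ |a * s| := Real.abs_sin_le_abs
    _ = |a| * s := by rw [abs_mul, abs_of_nonneg hs]

lemma integrableOn_of_abs_le {f : ℝ → ℝ} (hf : Measurable f) (K : ℝ)
    (hK : ∀ s ∈ Set.Ioo 0 Real.pi, |f s| ≤ K) : IntegrableOn f (Set.Ioo 0 Real.pi) := by
  refine Measure.integrableOn_of_bounded (M := K) (by simp) hf.aestronglyMeasurable ?_
  exact (ae_restrict_iff' measurableSet_Ioo).2 (ae_of_all _ fun s hs => hK s hs)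

lemma abs_one_sub_div_pi_le {s : ℝ} (hs : s ∈ Set.Ioo 0 Real.pi) : |1 - s / Real.pi| ≤ 1 := by
  rw [abs_of_nonneg (one_sub_div_pi_nonneg hs.2.le)]
  have : 0 ≤ s / Real.pi := div_nonneg hs.1.le Real.pi_pos.le
  linarith

lemma abs_prawitzG_mul_sin_le {s : ℝ} (hs : s ∈ Set.Ioo 0 Real.pi) (a : ℝ) :
    |prawitzG s * Real.sin (a * s)| ≤ |a| := by
  rw [abs_mul, abs_of_nonneg (prawitzG_nonneg hs.1 hs.2)]
  calc prawitzG s * |Real.sin (a * s)| ≤ 1 / s * (|a| * s) := by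
        gcongr
        · exact one_div_nonneg.2 hs.1.le
        · exact prawitzG_le_inv hs.1 hs.2
        · exact abs_sin_le_abs_mul a s hs.1.le
    _ = |a| := by have := hs.1.ne'; field_simp

lemma integrableOn_one_sub_mul (g : ℝ → ℝ) (hg : Measurable g) (hb : ∀ x, |g x| ≤ 1) :
    IntegrableOn (fun s => (1 - s / Real.pi) * g s) (Set.Ioo 0 Real.pi) := by
  refine integrableOn_of_abs_le (by fun_prop) 1 fun s hs => ?_
  rw [abs_mul]
  exact mul_le_one₀ (abs_one_sub_div_pi_le hs) (abs_nonneg _) (hb _)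

lemma integrableOn_prawitzG_mul_sin (a : ℝ) :
    IntegrableOn (fun s => prawitzG s * Real.sin (a * s)) (Set.Ioo 0 Real.pi) :=
  integrableOn_of_abs_le (measurable_prawitzG.mul (by fun_prop)) |a|
    fun _ hs => abs_prawitzG_mul_sin_le hs a

lemma integrableOn_prawitzG_mul_cos_sub_one (a : ℝ) :
    IntegrableOn (fun s => prawitzG s * (Real.cos (a * s) - 1)) (Set.Ioo 0 Real.pi) := by
  refine integrableOn_of_abs_le (measurable_prawitzG.mul (by fun_prop)) (a ^ 2 * Real.pi / 2)
    fun s hs => ?_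
  have h1 := cos_lower_two (a * s)
  have h2 := Real.cos_le_one (a * s)
  rw [abs_mul, abs_of_nonneg (prawitzG_nonneg hs.1 hs.2), abs_of_nonpos (by linarith)]
  have hs0 := hs.1
  calc prawitzG s * -(Real.cos (a * s) - 1) ≤ 1 / s * ((a * s) ^ 2 / 2) := by
        gcongr
        · linarith
        · exact prawitzG_le_inv hs.1 hs.2
        · linarith
    _ = a ^ 2 * s / 2 := by field_simp
    _ ≤ a ^ 2 * Real.pi / 2 := by gcongr; exact hs.2.le

lemma integrableOn_majorant (a : ℝ) : IntegrableOn
    (fun s => (1 - s / Real.pi) * Real.cos (a * s) + prawitzG s * Real.sin (a * s))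
    (Set.Ioo 0 Real.pi) :=
  (integrableOn_one_sub_mul _ (by fun_prop) fun _ => Real.abs_cos_le_one _).add
    (integrableOn_prawitzG_mul_sin a)

lemma integral_Ioo_sin_mul (a : ℝ) (ha : a ≠ 0) :
    ∫ s in Set.Ioo 0 Real.pi, Real.sin (a * s) = (1 - Real.cos (a * Real.pi)) / a := by
  rw [← integral_Ioc_eq_integral_Ioo, ← intervalIntegral.integral_of_le Real.pi_pos.le,
    intervalIntegral.integral_eq_sub_of_hasDerivAt (f := fun s => -Real.cos (a * s) / a)]
  · simp; ring
  · intro s _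
    refine ((((hasDerivAt_id' s).const_mul a).cos).fun_neg.div_const a).congr_deriv ?_
    field_simp
  · exact (by fun_prop : Continuous fun s => Real.sin (a * s)).intervalIntegrable _ _

lemma integral_Ioo_one_sub_mul_cos (a : ℝ) (ha : a ≠ 0) :
    ∫ s in Set.Ioo 0 Real.pi, (1 - s / Real.pi) * Real.cos (a * s) =
      (1 - Real.cos (a * Real.pi)) / (Real.pi * a ^ 2) := by
  have hpi := Real.pi_pos.ne'
  rw [← integral_Ioc_eq_integral_Ioo, ← intervalIntegral.integral_of_le Real.pi_pos.le,
    intervalIntegral.integral_eq_sub_of_hasDerivAt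
      (f := fun s => (1 - s / Real.pi) * (Real.sin (a * s) / a)
        - Real.cos (a * s) / (Real.pi * a ^ 2))]
  · simp [hpi]; ring
  · intro s _
    have h1 : HasDerivAt (fun s : ℝ => a * s) (a * 1) s := (hasDerivAt_id' s).const_mul a
    have h2 : HasDerivAt (fun s : ℝ => 1 - s / Real.pi) (0 - 1 / Real.pi) s :=
      (hasDerivAt_const s 1).fun_sub ((hasDerivAt_id' s).div_const _)
    refine ((h2.fun_mul (h1.sin.div_const a)).fun_sub (h1.cos.div_const _)).congr_deriv ?_
    field_simp
    ring
  · exact (by fun_prop : Continuous fun s =>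
      (1 - s / Real.pi) * Real.cos (a * s)).intervalIntegrable _ _

lemma integral_Ioo_one_sub : ∫ s in Set.Ioo 0 Real.pi, (1 - s / Real.pi) = Real.pi / 2 := by
  have hpi := Real.pi_pos.ne'
  rw [← integral_Ioc_eq_integral_Ioo, ← intervalIntegral.integral_of_le Real.pi_pos.le,
    intervalIntegral.integral_eq_sub_of_hasDerivAt (f := fun s => s - s ^ 2 / (2 * Real.pi))]
  · simp; field_simp; ring
  · intro s _
    refine ((hasDerivAt_id' s).fun_sub ((hasDerivAt_pow 2 s).div_const _)).congr_deriv ?_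
    field_simp
    norm_num
    ring
  · exact (by fun_prop : Continuous fun s => (1 - s / Real.pi)).intervalIntegrable _ _

lemma prawitzMajorant_zero : prawitzMajorant 0 = 1 := by
  have hpi := Real.pi_pos.ne'
  simp only [prawitzMajorant, zero_mul, Real.cos_zero, Real.sin_zero, mul_one, mul_zero, add_zero]
  rw [integral_Ioo_one_sub]
  field_simp
  norm_num

lemma prawitzMajorant_add_two (a : ℝ) : prawitzMajorant (a + 2) - prawitzMajorant a =
    1 / Real.pi * (2 * (∫ s in Set.Ioo 0 Real.pi, (1 - s / Real.pi) * Real.cos ((a + 2) * s)) +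
      1 / Real.pi * ((∫ s in Set.Ioo 0 Real.pi, Real.sin ((a + 2) * s)) -
        ∫ s in Set.Ioo 0 Real.pi, Real.sin (a * s))) := by
  have hpi := Real.pi_pos.ne'
  have hsin : ∀ b : ℝ, IntegrableOn (fun s => Real.sin (b * s)) (Set.Ioo 0 Real.pi) := fun b =>
    integrableOn_of_abs_le (by fun_prop) 1 fun _ _ => Real.abs_sin_le_one _
  have hcos : IntegrableOn (fun s => (1 - s / Real.pi) * Real.cos ((a + 2) * s))
    (Set.Ioo 0 Real.pi) := integrableOn_one_sub_mul _ (by fun_prop) fun _ => Real.abs_cos_le_one _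
  unfold prawitzMajorant
  have hR : 2 * (∫ s in Set.Ioo 0 Real.pi, (1 - s / Real.pi) * Real.cos ((a + 2) * s)) +
      1 / Real.pi * ((∫ s in Set.Ioo 0 Real.pi, Real.sin ((a + 2) * s)) -
        ∫ s in Set.Ioo 0 Real.pi, Real.sin (a * s)) =
      ∫ s in Set.Ioo 0 Real.pi, (2 * ((1 - s / Real.pi) * Real.cos ((a + 2) * s)) +
        1 / Real.pi * (Real.sin ((a + 2) * s) - Real.sin (a * s))) := by
    have hd : IntegrableOn (fun s => 1 / Real.pi * (Real.sin ((a + 2) * s) - Real.sin (a * s)))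
      (Set.Ioo 0 Real.pi) := ((hsin _).sub (hsin _)).const_mul (1 / Real.pi)
    rw [integral_add (hcos.const_mul 2) hd,
      integral_const_mul, integral_const_mul, ← integral_sub (hsin _) (hsin _)]
  rw [hR, add_sub_add_left_eq_sub, ← mul_sub, ← integral_sub (integrableOn_majorant _)
    (integrableOn_majorant _)]
  congr 1
  refine setIntegral_congr_fun measurableSet_Ioo fun s hs => ?_
  have hs' := (Real.sin_pos_of_pos_of_lt_pi hs.1 hs.2).ne'
  have e1 : (a + 2) * s = (a * s + s) + s := by ring
  have e2 : a * s = (a * s + s) - s := by ring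
  have e3 : Real.cos (a * s) = Real.cos ((a * s + s) - s) := by rw [← e2]
  have e4 : Real.sin (a * s) = Real.sin ((a * s + s) - s) := by rw [← e2]
  simp only [prawitzG]
  rw [e1, e3, e4, Real.cos_add (a * s + s), Real.cos_sub, Real.sin_add (a * s + s), Real.sin_sub]
  field_simp
  ring

lemma cos_add_two_mul_pi (a : ℝ) : Real.cos ((a + 2) * Real.pi) = Real.cos (a * Real.pi) := by
  rw [add_mul, Real.cos_add_two_pi]

lemma prawitzMajorant_sub_add_two {a : ℝ} (h0 : a ≠ 0) (h2 : a + 2 ≠ 0) :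
    prawitzMajorant (a + 2) - prawitzMajorant a =
      -(4 * (1 - Real.cos (a * Real.pi)) / (Real.pi ^ 2 * (a * (a + 2) ^ 2))) := by
  have hpi := Real.pi_pos.ne'
  rw [prawitzMajorant_add_two, integral_Ioo_one_sub_mul_cos _ h2, integral_Ioo_sin_mul _ h0,
    integral_Ioo_sin_mul _ h2, cos_add_two_mul_pi]
  field_simp
  ring

lemma prawitzMajorant_two_mul_nat (k : ℕ) : prawitzMajorant (2 * k) = 1 := by
  induction k with
  | zero => simpa using prawitzMajorant_zero
  | succ k ih =>
    have e : (2 * ((k + 1 : ℕ) : ℝ)) = 2 * k + 2 := by push_cast; ring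
    rw [e]
    rcases Nat.eq_zero_or_pos k with rfl | hk
    · have h := prawitzMajorant_add_two 0
      rw [integral_Ioo_one_sub_mul_cos _ (by norm_num), integral_Ioo_sin_mul _ (by norm_num)] at h
      have : Real.cos (2 * Real.pi) = 1 := Real.cos_two_pi
      simp [prawitzMajorant_zero] at h
      simp
      linarith
    · have hk' : (0:ℝ) < k := by exact_mod_cast hk
      have h := prawitzMajorant_sub_add_two (a := 2 * k) (by positivity) (by positivity)
      have hc : Real.cos (2 * (k : ℝ) * Real.pi) = 1 := by
        rw [show 2 * (k : ℝ) * Real.pi = k * (2 * Real.pi) by ring]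
        exact Real.cos_nat_mul_two_pi k
      rw [hc, ih] at h
      simp at h
      linarith

lemma prawitzMajorant_neg_two_mul_nat (k : ℕ) : prawitzMajorant (-(2 * (k + 1))) = 0 := by
  have hpi := Real.pi_pos.ne'
  induction k with
  | zero =>
    have h := prawitzMajorant_add_two (-2)
    have hc : Real.cos (-2 * Real.pi) = 1 := by
      rw [neg_mul, Real.cos_neg, Real.cos_two_pi]
    rw [integral_Ioo_sin_mul (-2) (by norm_num), hc] at h
    have e : (-2 : ℝ) + 2 = 0 := by norm_num
    simp only [e, zero_mul, Real.cos_zero, Real.sin_zero, mul_one, integral_Ioo_one_sub,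
      prawitzMajorant_zero, integral_zero, sub_self, zero_div, mul_zero, add_zero] at h
    have e2 : (-(2 * (((0 : ℕ) : ℝ) + 1))) = -2 := by norm_num
    rw [e2]
    field_simp at h
    linarith
  | succ k ih =>
    have h := prawitzMajorant_sub_add_two (a := -(2 * ((k + 1 : ℕ) + 1)))
      (by have : (0:ℝ) < (k + 1 : ℕ) + 1 := by positivity
          linarith) (by
        have : (0:ℝ) < (k : ℝ) + 1 := by positivity
        push_cast
        intro h
        linarith)
    have hc : Real.cos (-(2 * (((k + 1 : ℕ) : ℝ) + 1)) * Real.pi) = 1 := by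
      have := Real.cos_nat_mul_two_pi (k + 1 + 1)
      rw [show -(2 * (((k + 1 : ℕ) : ℝ) + 1)) * Real.pi = -(((k + 1 + 1 : ℕ) : ℝ) * (2 * Real.pi))
        by push_cast; ring, Real.cos_neg, this]
    have e : -(2 * (((k + 1 : ℕ) : ℝ) + 1)) + 2 = -(2 * ((k : ℝ) + 1)) := by push_cast; ring
    rw [hc, e, ih] at h
    simp at h
    push_cast
    linarith

lemma prawitzMajorant_shift (τ a : ℝ) : prawitzMajorant (τ + a) - prawitzMajorant a =
    1 / Real.pi * ((∫ s in Set.Ioo 0 Real.pi, ((1 - s / Real.pi) * (Real.cos (τ * s) - 1) +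
      prawitzG s * Real.sin (τ * s)) * Real.cos (a * s)) +
      ∫ s in Set.Ioo 0 Real.pi, (prawitzG s * (Real.cos (τ * s) - 1) -
        (1 - s / Real.pi) * Real.sin (τ * s)) * Real.sin (a * s)) ∧
    IntegrableOn (fun s => (1 - s / Real.pi) * (Real.cos (τ * s) - 1) +
      prawitzG s * Real.sin (τ * s)) (Set.Ioo 0 Real.pi) ∧
    IntegrableOn (fun s => prawitzG s * (Real.cos (τ * s) - 1) -
        (1 - s / Real.pi) * Real.sin (τ * s)) (Set.Ioo 0 Real.pi) := by
  have hq1 : IntegrableOn (fun s => (1 - s / Real.pi) * (Real.cos (τ * s) - 1))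
      (Set.Ioo 0 Real.pi) := by
    refine integrableOn_of_abs_le (by fun_prop) (1 * 2) fun s hs => ?_
    rw [abs_mul]
    refine mul_le_mul (abs_one_sub_div_pi_le hs) ?_ (abs_nonneg _) (by norm_num)
    rw [abs_le]
    constructor <;> linarith [Real.neg_one_le_cos (τ * s), Real.cos_le_one (τ * s)]
  have hA := hq1.add (integrableOn_prawitzG_mul_sin τ)
  have hB := (integrableOn_prawitzG_mul_cos_sub_one τ).sub (integrableOn_one_sub_mul
    (fun s => Real.sin (τ * s)) (by fun_prop) fun _ => Real.abs_sin_le_one _)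
  refine ⟨?_, hA, hB⟩
  have hAc : IntegrableOn (fun s => ((1 - s / Real.pi) * (Real.cos (τ * s) - 1) +
      prawitzG s * Real.sin (τ * s)) * Real.cos (a * s)) (Set.Ioo 0 Real.pi) :=
    Integrable.mul_bdd (c := 1) hA (by fun_prop) (ae_of_all _ fun s => Real.abs_cos_le_one _)
  have hBs : IntegrableOn (fun s => (prawitzG s * (Real.cos (τ * s) - 1) -
        (1 - s / Real.pi) * Real.sin (τ * s)) * Real.sin (a * s)) (Set.Ioo 0 Real.pi) :=
    Integrable.mul_bdd (c := 1) hB (by fun_prop) (ae_of_all _ fun s => Real.abs_sin_le_one _)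
  unfold prawitzMajorant
  rw [← integral_add hAc hBs, add_sub_add_left_eq_sub, ← mul_sub,
    ← integral_sub (integrableOn_majorant _) (integrableOn_majorant _)]
  congr 1
  refine integral_congr_ae (ae_of_all _ fun s => ?_)
  simp only [add_mul, Real.cos_add, Real.sin_add]
  ring

lemma tendsto_prawitzMajorant_shift (τ : ℝ) :
    Tendsto (fun a => prawitzMajorant (τ + a) - prawitzMajorant a) atTop (𝓝 0) ∧
    Tendsto (fun a => prawitzMajorant (τ + -a) - prawitzMajorant (-a)) atTop (𝓝 0) := by
  obtain ⟨-, hA, hB⟩ := prawitzMajorant_shift τ 0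
  set A : ℝ → ℝ := fun s => (1 - s / Real.pi) * (Real.cos (τ * s) - 1) +
      prawitzG s * Real.sin (τ * s) with hAdef
  set B : ℝ → ℝ := fun s => prawitzG s * (Real.cos (τ * s) - 1) -
        (1 - s / Real.pi) * Real.sin (τ * s) with hBdef
  have h1 := (tendsto_integral_mul_cos_and_sin _ (hA.integrable_indicator measurableSet_Ioo)).1
  have h2 := (tendsto_integral_mul_cos_and_sin _ (hB.integrable_indicator measurableSet_Ioo)).2
  have e1 : ∀ (f g : ℝ → ℝ), ∫ s, (Set.Ioo 0 Real.pi).indicator f s * g s =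
      ∫ s in Set.Ioo 0 Real.pi, f s * g s := by
    intro f g
    rw [← integral_indicator measurableSet_Ioo]
    congr 1
    ext s
    by_cases hs : s ∈ Set.Ioo 0 Real.pi <;> simp [hs]
  simp only [e1] at h1 h2
  constructor
  · have := (h1.add h2).const_mul (1 / Real.pi)
    simp only [add_zero, mul_zero] at this
    exact this.congr fun a => ((prawitzMajorant_shift τ a).1).symm
  · have := (h1.sub h2).const_mul (1 / Real.pi)
    simp only [sub_zero, mul_zero] at this
    refine this.congr fun a => ?_
    rw [(prawitzMajorant_shift τ (-a)).1]
    simp only [neg_mul, Real.cos_neg, Real.sin_neg, mul_neg, integral_neg]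
    ring

lemma one_le_prawitzMajorant {a : ℝ} (ha : 0 ≤ a) : 1 ≤ prawitzMajorant a := by
  rcases ha.eq_or_lt with rfl | ha
  · exact prawitzMajorant_zero.ge
  have htop : Tendsto (fun k : ℕ => 2 * (k : ℝ)) atTop atTop :=
    tendsto_natCast_atTop_atTop.const_mul_atTop two_pos
  have hlim : Tendsto (fun k : ℕ => prawitzMajorant (a + 2 * k)) atTop (𝓝 1) := by
    have := ((tendsto_prawitzMajorant_shift a).1.comp htop).add_const 1
    rw [zero_add] at this
    refine this.congr fun k => ?_
    simp [Function.comp, prawitzMajorant_two_mul_nat]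
  have hanti : Antitone (fun k : ℕ => prawitzMajorant (a + 2 * k)) := by
    refine antitone_nat_of_succ_le fun k => ?_
    have e : a + 2 * ((k + 1 : ℕ) : ℝ) = (a + 2 * k) + 2 := by push_cast; ring
    have hp : 0 < a + 2 * k := by positivity
    have h := prawitzMajorant_sub_add_two (a := a + 2 * k) (by positivity) (by positivity)
    rw [e]
    have : 0 ≤ 4 * (1 - Real.cos ((a + 2 * k) * Real.pi)) /
        (Real.pi ^ 2 * ((a + 2 * k) * ((a + 2 * k) + 2) ^ 2)) := by
      have := Real.cos_le_one ((a + 2 * k) * Real.pi)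
      apply div_nonneg <;> [linarith; positivity]
    linarith
  simpa using hanti.le_of_tendsto hlim 0

lemma prawitzMajorant_nonneg (a : ℝ) : 0 ≤ prawitzMajorant a := by
  rcases le_or_gt 0 a with ha | ha
  · linarith [one_le_prawitzMajorant ha]
  have htop : Tendsto (fun k : ℕ => 2 * ((k : ℝ) + 1)) atTop atTop :=
    (tendsto_natCast_atTop_atTop.atTop_add tendsto_const_nhds).const_mul_atTop two_pos
  have hlim : Tendsto (fun k : ℕ => prawitzMajorant (a - 2 * (k + 1))) atTop (𝓝 0) := by
    refine ((tendsto_prawitzMajorant_shift a).2.comp htop).congr fun k => ?_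
    simp [Function.comp, prawitzMajorant_neg_two_mul_nat, sub_eq_add_neg]
  have hstep : ∀ b : ℝ, b < 0 → prawitzMajorant (b - 2) ≤ prawitzMajorant b := by
    intro b hb
    have h := prawitzMajorant_sub_add_two (a := b - 2) (by linarith) (by linarith)
    rw [sub_add_cancel] at h
    have : 0 ≤ -(4 * (1 - Real.cos ((b - 2) * Real.pi)) /
        (Real.pi ^ 2 * ((b - 2) * b ^ 2))) := by
      have := Real.cos_le_one ((b - 2) * Real.pi)
      rw [neg_nonneg]
      apply div_nonpos_of_nonneg_of_nonpos (by linarith)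
      have : (b - 2) * b ^ 2 ≤ 0 := by nlinarith [sq_nonneg b]
      nlinarith [sq_nonneg Real.pi]
    linarith
  have hanti : Antitone (fun k : ℕ => prawitzMajorant (a - 2 * (k + 1))) := by
    refine antitone_nat_of_succ_le fun k => ?_
    have e : a - 2 * (((k + 1 : ℕ) : ℝ) + 1) = (a - 2 * (k + 1)) - 2 := by push_cast; ring
    rw [e]
    have : (0 : ℝ) < k + 1 := by positivity
    exact hstep _ (by linarith)
  have h0 := hanti.le_of_tendsto hlim 0
  have h1 := hstep a ha
  simp only [Nat.cast_zero, zero_add, mul_one] at h0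
  linarith

lemma integral_Ioi_exp_neg_sq_mul_cos (y : ℝ) :
    ∫ t in Set.Ioi (0 : ℝ), Real.exp (-(t ^ 2 / 2)) * Real.cos (t * y) =
      Real.sqrt (2 * Real.pi) / 2 * Real.exp (-(y ^ 2 / 2)) := by
  have h1 : ∫ t : ℝ, Real.exp (-(t ^ 2 / 2)) * Real.cos (t * y) =
      2 * ∫ t in Set.Ioi (0 : ℝ), Real.exp (-(t ^ 2 / 2)) * Real.cos (t * y) := by
    rw [← integral_comp_abs]
    refine integral_congr_ae (ae_of_all _ fun t => ?_)
    rcases abs_cases t with ⟨h, _⟩ | ⟨h, _⟩ <;> simp [h]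
  have h2 := fourierIntegral_gaussian (b := 1 / 2) (by norm_num) (y : ℂ)
  have hint : Integrable (fun t : ℝ => Complex.exp (Complex.I * y * t) *
      Complex.exp (-(1 / 2) * (t : ℂ) ^ 2)) := by
    refine Integrable.bdd_mul (c := 1) ?_ (by fun_prop) (ae_of_all _ fun t => ?_)
    · have := (integrable_exp_neg_mul_sq (b := 1 / 2) (by norm_num)).ofReal (𝕜 := ℂ)
      refine this.congr (ae_of_all _ fun t => ?_)
      simp [Complex.ofReal_exp]
    · have : Complex.I * y * t = ((y * t : ℝ) : ℂ) * Complex.I := by push_cast; ring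
      rw [this, Complex.norm_exp_ofReal_mul_I]
  have h3 := congrArg Complex.re h2
  rw [← RCLike.re_eq_complex_re, ← integral_re hint] at h3
  have h4 : ∀ t : ℝ, RCLike.re (Complex.exp (Complex.I * y * t) *
      Complex.exp (-(1 / 2) * (t : ℂ) ^ 2)) = Real.exp (-(t ^ 2 / 2)) * Real.cos (t * y) := by
    intro t
    have e1 : Complex.I * y * t = ((t * y : ℝ) : ℂ) * Complex.I := by push_cast; ring
    have e2 : -(1 / 2) * (t : ℂ) ^ 2 = ((-(t ^ 2 / 2) : ℝ) : ℂ) := by push_cast; ring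
    rw [e1, e2, ← Complex.ofReal_exp, RCLike.re_eq_complex_re, mul_comm, Complex.re_ofReal_mul,
      Complex.exp_ofReal_mul_I_re]
  simp only [h4] at h3
  have e3 : ((Real.pi : ℂ) / (1 / 2)) ^ (1 / 2 : ℂ) * Complex.exp (-(y : ℂ) ^ 2 / (4 * (1 / 2))) =
      ((Real.sqrt (2 * Real.pi) * Real.exp (-(y ^ 2 / 2)) : ℝ) : ℂ) := by
    rw [Real.sqrt_eq_rpow]
    have : ((Real.pi : ℂ) / (1 / 2)) = ((2 * Real.pi : ℝ) : ℂ) := by push_cast; ring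
    have e4 : -(y : ℂ) ^ 2 / (4 * (1 / 2)) = ((-(y ^ 2 / 2) : ℝ) : ℂ) := by push_cast; ring
    have e5 : ((1 / 2 : ℝ) : ℂ) = 1 / 2 := by push_cast; ring
    rw [this, e4, Complex.ofReal_mul ((2 * Real.pi) ^ (1 / 2 : ℝ)),
      Complex.ofReal_cpow (by positivity), Complex.ofReal_exp, e5]
  rw [e3, RCLike.re_eq_complex_re, Complex.ofReal_re] at h3
  linarith

lemma integrable_exp_neg_sq_div_two : Integrable fun t : ℝ => Real.exp (-(t ^ 2 / 2)) := by
  refine (integrable_exp_neg_mul_sq (b := 1 / 2) (by norm_num)).congr (ae_of_all _ fun t => ?_)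
  simp only
  congr 1
  ring

lemma integral_Ioi_exp_neg_sq_mul_sin_div (x : ℝ) :
    ∫ t in Set.Ioi (0 : ℝ), Real.exp (-(t ^ 2 / 2)) * Real.sin (t * x) / t =
      Real.sqrt (2 * Real.pi) / 2 * ∫ y in (0 : ℝ)..x, Real.exp (-(y ^ 2 / 2)) := by
  have h1 : ∀ t ∈ Set.Ioi (0 : ℝ), Real.exp (-(t ^ 2 / 2)) * Real.sin (t * x) / t =
      ∫ y in (0 : ℝ)..x, Real.exp (-(t ^ 2 / 2)) * Real.cos (t * y) := by
    intro t ht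
    have ht0 : t ≠ 0 := (ne_of_gt ht)
    rw [intervalIntegral.integral_const_mul, intervalIntegral.integral_comp_mul_left _ ht0,
      integral_cos]
    simp
    field_simp
  rw [setIntegral_congr_fun measurableSet_Ioi h1, ← intervalIntegral.integral_const_mul]
  simp only [intervalIntegral.intervalIntegral_eq_integral_uIoc]
  rw [integral_smul, integral_integral_swap]
  · simp only [integral_Ioi_exp_neg_sq_mul_cos]
  · have hb : Integrable (fun p : ℝ × ℝ => Real.exp (-(p.1 ^ 2 / 2)) * 1)
        ((volume.restrict (Set.Ioi 0)).prod (volume.restrict (Set.uIoc 0 x))) := by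
      have hfin : IsFiniteMeasure (volume.restrict (Set.uIoc 0 x)) := by
        rw [Set.uIoc]
        infer_instance
      exact Integrable.mul_prod integrable_exp_neg_sq_div_two.integrableOn (integrable_const _)
    refine hb.mono (by fun_prop) (ae_of_all _ fun p => ?_)
    simp only [Function.uncurry, norm_mul, norm_one]
    gcongr
    exact Real.abs_cos_le_one _

lemma stdNormalCDF_eq_real (x : ℝ) : stdNormalCDF x = (gaussianReal 0 1).real (Set.Iic x) := rfl

lemma stdNormalCDF_eq_integral (x : ℝ) :
    stdNormalCDF x = ∫ t in Set.Iic x, gaussianPDFReal 0 1 t := by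
  rw [stdNormalCDF, gaussianReal_apply_eq_integral _ one_ne_zero, ENNReal.toReal_ofReal]
  exact integral_nonneg fun t => gaussianPDFReal_nonneg 0 1 t

lemma stdNormalCDF_neg (x : ℝ) : stdNormalCDF (-x) = 1 - stdNormalCDF x := by
  have h : (gaussianReal 0 1).map (fun x => -x) = gaussianReal 0 1 := by
    simpa using gaussianReal_map_neg (μ := 0) (v := 1)
  have : NullSingletonClass (gaussianReal 0 1) := nullSingletonClass_gaussianReal one_ne_zero
  rw [stdNormalCDF_eq_real, stdNormalCDF_eq_real, ← probReal_compl_eq_one_sub measurableSet_Iic,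
    Set.compl_Iic]
  conv_lhs => rw [← h]
  rw [map_measureReal_apply (by fun_prop) measurableSet_Iic]
  have : (fun x : ℝ => -x) ⁻¹' Set.Iic (-x) = Set.Ici x := by ext; simp
  rw [this, measureReal_def, measureReal_def, measure_congr Ioi_ae_eq_Ici]

lemma stdNormalCDF_sub_half (x : ℝ) : stdNormalCDF x - 1 / 2 =
    1 / Real.sqrt (2 * Real.pi) * ∫ y in (0 : ℝ)..x, Real.exp (-(y ^ 2 / 2)) := by
  have h0 : stdNormalCDF 0 = 1 / 2 := by
    have := stdNormalCDF_neg 0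
    rw [neg_zero] at this
    linarith
  rw [← h0, stdNormalCDF_eq_integral, stdNormalCDF_eq_integral, intervalIntegral.integral_Iic_sub_Iic
    (integrable_gaussianPDFReal 0 1).integrableOn (integrable_gaussianPDFReal 0 1).integrableOn,
    ← intervalIntegral.integral_const_mul]
  refine intervalIntegral.integral_congr fun y _ => ?_
  simp only [gaussianPDFReal_def]
  simp [neg_div]

lemma stdNormalCDF_inversion (x : ℝ) : stdNormalCDF x - 1 / 2 =
    1 / Real.pi * ∫ t in Set.Ioi (0 : ℝ), Real.exp (-(t ^ 2 / 2)) * Real.sin (t * x) / t := by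
  rw [stdNormalCDF_sub_half, integral_Ioi_exp_neg_sq_mul_sin_div]
  have hp := Real.pi_pos
  have hs : 0 < Real.sqrt (2 * Real.pi) := by positivity
  have h := Real.sq_sqrt (show 0 ≤ 2 * Real.pi by positivity)
  rw [← mul_assoc]
  congr 1
  field_simp
  linarith

lemma stdNormalCDF_inversion_scaled {c : ℝ} (hc : 0 < c) (x : ℝ) : stdNormalCDF x - 1 / 2 =
    1 / Real.pi * ∫ s in Set.Ioi (0 : ℝ),
      Real.exp (-(c ^ 2 * s ^ 2 / 2)) * Real.sin (c * s * x) / s := by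
  rw [stdNormalCDF_inversion]
  have h := integral_comp_mul_left_Ioi
    (fun t => Real.exp (-(t ^ 2 / 2)) * Real.sin (t * x) / t) 0 hc
  rw [mul_zero, smul_eq_mul] at h
  have h2 : ∫ t in Set.Ioi (0 : ℝ), Real.exp (-(t ^ 2 / 2)) * Real.sin (t * x) / t =
      c * ∫ s in Set.Ioi (0 : ℝ), Real.exp (-((c * s) ^ 2 / 2)) * Real.sin (c * s * x) / (c * s) := by
    rw [h, ← mul_assoc, mul_inv_cancel₀ hc.ne', one_mul]
  rw [h2, ← integral_const_mul]
  congr 1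
  refine setIntegral_congr_fun measurableSet_Ioi fun s hs => ?_
  have : s ≠ 0 := ne_of_gt hs
  simp only [mul_pow]
  field_simp

/-- Prawitz' smoothing inequality for a symmetric law with characteristic function `f`. -/
lemma cdf_le_prawitz (μ : Measure ℝ) [IsProbabilityMeasure μ] (hμ : Integrable (fun y => y) μ)
    (f : ℝ → ℝ) (hcos : ∀ t, ∫ y, Real.cos (t * y) ∂μ = f t)
    (hsin : ∀ t, ∫ y, Real.sin (t * y) ∂μ = 0) (c x : ℝ) (hc : 0 < c) :
    μ.real (Set.Iic x) ≤ 1 / 2 + 1 / Real.pi * ∫ s in Set.Ioo 0 Real.pi,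
      f (c * s) * ((1 - s / Real.pi) * Real.cos (c * s * x) + prawitzG s * Real.sin (c * s * x)) := by
  set g : ℝ → ℝ → ℝ := fun y s => (1 - s / Real.pi) * Real.cos (c * (x - y) * s) +
    prawitzG s * Real.sin (c * (x - y) * s) with hg
  have hG := measurable_prawitzG
  have hprod : Integrable (Function.uncurry g)
      (μ.prod (volume.restrict (Set.Ioo 0 Real.pi))) := by
    have hb : Integrable (fun p : ℝ × ℝ => (1 + |c * (x - p.1)|) * 1)
        (μ.prod (volume.restrict (Set.Ioo 0 Real.pi))) := by
      refine Integrable.mul_prod (f := fun y => 1 + |c * (x - y)|) (g := fun _ => (1:ℝ)) ?_ (by simp)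
      exact (integrable_const 1).add (((integrable_const x).sub hμ).const_mul c).abs
    refine hb.mono' ?_ ?_
    · refine Measurable.aestronglyMeasurable ?_
      simp only [hg, Function.uncurry_def]
      exact Measurable.add (by fun_prop) ((hG.comp measurable_snd).mul (by fun_prop))
    · have hset : ∀ᵐ p ∂(μ.prod (volume.restrict (Set.Ioo 0 Real.pi))),
          p.2 ∈ Set.Ioo 0 Real.pi :=
        Measure.quasiMeasurePreserving_snd.ae (ae_restrict_mem measurableSet_Ioo)
      filter_upwards [hset] with p hp
      simp only [hg, Function.uncurry_def, Real.norm_eq_abs, mul_one]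
      refine (abs_add_le _ _).trans (add_le_add ?_ (abs_prawitzG_mul_sin_le hp _))
      rw [abs_mul]
      exact mul_le_one₀ (abs_one_sub_div_pi_le hp) (abs_nonneg _) (Real.abs_cos_le_one _)
  have hM : Integrable (fun y => prawitzMajorant (c * (x - y))) μ := by
    exact (integrable_const (1 / 2)).add (hprod.integral_prod_left.const_mul _)
  have h1 : μ.real (Set.Iic x) ≤ ∫ y, prawitzMajorant (c * (x - y)) ∂μ := by
    have e : μ.real (Set.Iic x) = ∫ y, (Set.Iic x).indicator (fun _ => (1:ℝ)) y ∂μ := by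
      rw [integral_indicator measurableSet_Iic]
      simp
    rw [e]
    refine integral_mono ((integrable_const 1).indicator measurableSet_Iic) hM fun y => ?_
    by_cases hy : y ≤ x
    · simp only [Set.mem_Iic, hy, Set.indicator_of_mem]
      exact one_le_prawitzMajorant (mul_nonneg hc.le (by linarith))
    · simp only [Set.mem_Iic, hy, not_false_eq_true, Set.indicator_of_notMem]
      exact prawitzMajorant_nonneg _
  refine h1.trans (le_of_eq ?_)
  have h2 : ∫ y, prawitzMajorant (c * (x - y)) ∂μ = 1 / 2 + 1 / Real.pi *
      ∫ y, (∫ s in Set.Ioo 0 Real.pi, g y s) ∂μ := by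
    have hJ : Integrable (fun y => ∫ s in Set.Ioo 0 Real.pi, g y s) μ := hprod.integral_prod_left
    have e : ∀ y, prawitzMajorant (c * (x - y)) =
      1 / 2 + 1 / Real.pi * ∫ s in Set.Ioo 0 Real.pi, g y s := fun y => rfl
    simp only [e]
    rw [integral_add (integrable_const _) (hJ.const_mul _), integral_const_mul]
    simp
  rw [h2, integral_integral_swap hprod]
  congr 2
  refine integral_congr_ae (ae_of_all _ fun s => ?_)
  have ic : Integrable (fun y => Real.cos (c * s * y)) μ :=
    Integrable.of_bound (by fun_prop) 1 (ae_of_all _ fun y => Real.abs_cos_le_one _)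
  have is : Integrable (fun y => Real.sin (c * s * y)) μ :=
    Integrable.of_bound (by fun_prop) 1 (ae_of_all _ fun y => Real.abs_sin_le_one _)
  have hgs : ∀ y, g y s = ((1 - s / Real.pi) * Real.cos (c * s * x) +
      prawitzG s * Real.sin (c * s * x)) * Real.cos (c * s * y) +
      ((1 - s / Real.pi) * Real.sin (c * s * x) -
      prawitzG s * Real.cos (c * s * x)) * Real.sin (c * s * y) := by
    intro y
    have e : c * (x - y) * s = c * s * x - c * s * y := by ring
    simp only [hg, e, Real.cos_sub, Real.sin_sub]
    ring
  simp only [hgs]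
  rw [integral_add (ic.const_mul _) (is.const_mul _), integral_const_mul, integral_const_mul,
    hcos, hsin]
  ring

lemma integrableOn_exp_neg_sq_mul_sin_div {c : ℝ} (hc : 0 < c) (x : ℝ) :
    IntegrableOn (fun s => Real.exp (-(c ^ 2 * s ^ 2 / 2)) * Real.sin (c * s * x) / s)
      (Set.Ioi 0) := by
  have hb : Integrable (fun s : ℝ => |c * x| * Real.exp (-(c ^ 2 / 2) * s ^ 2)) :=
    (integrable_exp_neg_mul_sq (by positivity)).const_mul _
  refine hb.integrableOn.mono' (Measurable.aestronglyMeasurable (by fun_prop)) ?_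
  refine (ae_restrict_iff' measurableSet_Ioi).2 (ae_of_all _ fun s hs => ?_)
  have hs' : 0 < s := hs
  rw [Real.norm_eq_abs, abs_div, abs_mul, abs_of_pos hs', abs_of_pos (Real.exp_pos _), div_le_iff₀ hs']
  have h := abs_sin_le_abs_mul (c * x) s hs'.le
  rw [show c * x * s = c * s * x by ring] at h
  rw [show -(c ^ 2 * s ^ 2 / 2) = -(c ^ 2 / 2) * s ^ 2 by ring]
  nlinarith [Real.exp_pos (-(c ^ 2 / 2) * s ^ 2)]

lemma integrableOn_exp_neg_sq_div {c a : ℝ} (hc : 0 < c) (ha : 0 < a) :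
    IntegrableOn (fun s => Real.exp (-(c ^ 2 * s ^ 2 / 2)) / s) (Set.Ioi a) := by
  have hb : Integrable (fun s : ℝ => 1 / a * Real.exp (-(c ^ 2 / 2) * s ^ 2)) :=
    (integrable_exp_neg_mul_sq (by positivity)).const_mul _
  refine hb.integrableOn.mono' (Measurable.aestronglyMeasurable (by fun_prop)) ?_
  refine (ae_restrict_iff' measurableSet_Ioi).2 (ae_of_all _ fun s hs => ?_)
  have hs' : a < s := hs
  have hs0 : 0 < s := ha.trans hs'
  rw [Real.norm_eq_abs, abs_div, abs_of_pos hs0, abs_of_pos (Real.exp_pos _),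
    show -(c ^ 2 * s ^ 2 / 2) = -(c ^ 2 / 2) * s ^ 2 by ring, div_eq_mul_one_div, mul_comm]
  gcongr

lemma cdf_sub_stdNormalCDF_le (μ : Measure ℝ) [IsProbabilityMeasure μ]
    (hμ : Integrable (fun y => y) μ)
    (f : ℝ → ℝ) (hf : Continuous f) (hcos : ∀ t, ∫ y, Real.cos (t * y) ∂μ = f t)
    (hsin : ∀ t, ∫ y, Real.sin (t * y) ∂μ = 0) (c x : ℝ) (hc : 0 < c) (W : ℝ → ℝ)
    (hWi : IntegrableOn W (Set.Ioo 0 Real.pi))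
    (hW : ∀ s ∈ Set.Ioo 0 Real.pi, ∀ y, f (c * s) * ((1 - s / Real.pi) * Real.cos y +
      prawitzG s * Real.sin y) - Real.exp (-(c ^ 2 * s ^ 2 / 2)) * Real.sin y / s ≤ W s) :
    μ.real (Set.Iic x) - stdNormalCDF x ≤ 1 / Real.pi * ((∫ s in Set.Ioo 0 Real.pi, W s) +
      ∫ s in Set.Ioi Real.pi, Real.exp (-(c ^ 2 * s ^ 2 / 2)) / s) := by
  have h1 := cdf_le_prawitz μ hμ f hcos hsin c x hc
  have h2 := stdNormalCDF_inversion_scaled hc x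
  have hpi := Real.pi_pos
  have hb : ∀ t, |f t| ≤ 1 := by
    intro t
    rw [← hcos t]
    have := norm_integral_le_of_norm_le_const (μ := μ) (f := fun y => Real.cos (t * y)) (C := 1)
      (ae_of_all _ fun y => Real.abs_cos_le_one _)
    simpa using this
  have hsplit : ∫ s in Set.Ioi (0 : ℝ), Real.exp (-(c ^ 2 * s ^ 2 / 2)) * Real.sin (c * s * x) / s =
      (∫ s in Set.Ioo 0 Real.pi, Real.exp (-(c ^ 2 * s ^ 2 / 2)) * Real.sin (c * s * x) / s) +
      ∫ s in Set.Ioi Real.pi, Real.exp (-(c ^ 2 * s ^ 2 / 2)) * Real.sin (c * s * x) / s := by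
    have hi := integrableOn_exp_neg_sq_mul_sin_div hc x
    rw [← integral_Ioc_eq_integral_Ioo, ← setIntegral_union (Set.Ioc_disjoint_Ioi le_rfl)
      measurableSet_Ioi (hi.mono_set Set.Ioc_subset_Ioi_self)
      (hi.mono_set (Set.Ioi_subset_Ioi hpi.le)), Set.Ioc_union_Ioi_eq_Ioi hpi.le]
  have htail : -(∫ s in Set.Ioi Real.pi, Real.exp (-(c ^ 2 * s ^ 2 / 2)) * Real.sin (c * s * x) / s) ≤
      ∫ s in Set.Ioi Real.pi, Real.exp (-(c ^ 2 * s ^ 2 / 2)) / s := by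
    rw [← integral_neg]
    refine setIntegral_mono_on ((integrableOn_exp_neg_sq_mul_sin_div hc x).mono_set
      (Set.Ioi_subset_Ioi hpi.le)).neg (integrableOn_exp_neg_sq_div hc hpi) measurableSet_Ioi ?_
    intro s hs
    have hs0 : 0 < s := hpi.trans hs
    rw [← neg_div]
    gcongr
    nlinarith [Real.exp_pos (-(c ^ 2 * s ^ 2 / 2)), Real.neg_one_le_sin (c * s * x)]
  have hI1 : IntegrableOn (fun s => f (c * s) * ((1 - s / Real.pi) * Real.cos (c * s * x) +
      prawitzG s * Real.sin (c * s * x))) (Set.Ioo 0 Real.pi) := by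
    refine Integrable.bdd_mul (c := 1) ?_ (by fun_prop) (ae_of_all _ fun s => hb _)
    have := integrableOn_majorant (c * x)
    refine this.congr (ae_of_all _ fun s => ?_)
    simp only
    rw [show c * x * s = c * s * x by ring]
  have hI2 : IntegrableOn (fun s => Real.exp (-(c ^ 2 * s ^ 2 / 2)) * Real.sin (c * s * x) / s)
      (Set.Ioo 0 Real.pi) :=
    (integrableOn_exp_neg_sq_mul_sin_div hc x).mono_set Set.Ioo_subset_Ioi_self
  have h3 : (∫ s in Set.Ioo 0 Real.pi, f (c * s) * ((1 - s / Real.pi) * Real.cos (c * s * x) +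
      prawitzG s * Real.sin (c * s * x))) -
      (∫ s in Set.Ioo 0 Real.pi, Real.exp (-(c ^ 2 * s ^ 2 / 2)) * Real.sin (c * s * x) / s) ≤
      ∫ s in Set.Ioo 0 Real.pi, W s := by
    rw [← integral_sub hI1 hI2]
    exact setIntegral_mono_on (hI1.sub hI2) hWi measurableSet_Ioo fun s hs => hW s hs _
  have h4 : stdNormalCDF x = 1 / 2 + 1 / Real.pi * ∫ s in Set.Ioi (0 : ℝ),
      Real.exp (-(c ^ 2 * s ^ 2 / 2)) * Real.sin (c * s * x) / s := by linarith
  rw [h4, hsplit]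
  calc _ ≤ _ := sub_le_sub_right h1 _
    _ = 1 / Real.pi * ((∫ s in Set.Ioo 0 Real.pi, f (c * s) * ((1 - s / Real.pi) *
        Real.cos (c * s * x) + prawitzG s * Real.sin (c * s * x))) -
        (∫ s in Set.Ioo 0 Real.pi, Real.exp (-(c ^ 2 * s ^ 2 / 2)) * Real.sin (c * s * x) / s) -
        ∫ s in Set.Ioi Real.pi, Real.exp (-(c ^ 2 * s ^ 2 / 2)) * Real.sin (c * s * x) / s) := by
      ring
    _ ≤ _ := by
      have : 0 ≤ 1 / Real.pi := by positivity
      gcongr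
      linarith

lemma mul_sin_le_mul_sin {y s : ℝ} (hy : 0 ≤ y) (hys : y ≤ s) (hs : s ≤ Real.pi) :
    y * Real.sin s ≤ s * Real.sin y := by
  rcases (hy.trans hys).eq_or_lt with h | h
  · have : y = 0 := by linarith
    simp [this, ← h]
  have hc := strictConcaveOn_sin_Icc.concaveOn.2 (⟨h.le, hs⟩ : s ∈ Set.Icc 0 Real.pi)
    (⟨le_rfl, Real.pi_pos.le⟩ : (0 : ℝ) ∈ Set.Icc 0 Real.pi)
    (div_nonneg hy h.le) (sub_nonneg.2 ((div_le_one h).2 hys)) (by ring)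
  simp only [smul_eq_mul, Real.sin_zero, mul_zero, add_zero] at hc
  rw [div_mul_cancel₀ _ h.ne'] at hc
  rw [div_mul_eq_mul_div, div_le_iff₀ h] at hc
  linarith

/-- A function on `[0, ∞)` whose derivative changes sign from `-` to `+` at `s` is minimal there. -/
lemma le_of_deriv_sign {g g' : ℝ → ℝ} {s b y : ℝ} (hs : 0 ≤ s) (hsb : s ≤ b)
    (hg : ∀ x, HasDerivAt g (g' x) x) (h1 : ∀ x, 0 < x → x < s → g' x ≤ 0)
    (h2 : ∀ x, s < x → x < b → 0 ≤ g' x) (hy : 0 ≤ y) (hyb : y ≤ b) : g s ≤ g y := by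
  have hcont : Continuous g := continuous_iff_continuousAt.2 fun x => (hg x).continuousAt
  rcases le_total y s with h | h
  · refine antitoneOn_of_deriv_nonpos (convex_Icc 0 s) hcont.continuousOn
      (fun x _ => (hg x).differentiableAt.differentiableWithinAt) (fun x hx => ?_)
      ⟨hy, h⟩ ⟨hs, le_rfl⟩ h
    rw [interior_Icc] at hx
    rw [(hg x).deriv]
    exact h1 x hx.1 hx.2
  · refine monotoneOn_of_deriv_nonneg (convex_Icc s b) hcont.continuousOn
      (fun x _ => (hg x).differentiableAt.differentiableWithinAt) (fun x hx => ?_)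
      ⟨le_rfl, hsb⟩ ⟨h, hyb⟩ h
    rw [interior_Icc] at hx
    rw [(hg x).deriv]
    exact h2 x hx.1 hx.2

lemma cos_ge_tangent {s y : ℝ} (hs : 0 < s) (hsp : s ≤ Real.pi) (hy : 0 ≤ y) :
    Real.cos s - Real.sin s / (2 * s) * (y ^ 2 - s ^ 2) ≤ Real.cos y := by
  have hsin : 0 ≤ Real.sin s := Real.sin_nonneg_of_nonneg_of_le_pi hs.le hsp
  have key : ∀ z, 0 ≤ z → z ≤ Real.pi →
      Real.cos s - Real.sin s / (2 * s) * (z ^ 2 - s ^ 2) ≤ Real.cos z := by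
    intro z hz hzp
    have := le_of_deriv_sign (g := fun z => Real.cos z + Real.sin s / (2 * s) * (z ^ 2 - s ^ 2))
      (g' := fun z => -Real.sin z + Real.sin s / s * z) hs.le hsp ?_ ?_ ?_ hz hzp
    · simp only [sub_self, mul_zero, add_zero] at this
      linarith
    · intro x
      refine ((Real.hasDerivAt_cos x).fun_add (((hasDerivAt_pow 2 x).sub_const _).const_mul
        _)).congr_deriv ?_
      field_simp
      norm_num
      ring
    · intro x hx hxs
      have := mul_sin_le_mul_sin hx.le hxs.le hsp
      have h2 : Real.sin s / s * x ≤ Real.sin x := by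
        rw [div_mul_eq_mul_div, div_le_iff₀ hs]; linarith
      linarith
    · intro x hx hxs
      have := mul_sin_le_mul_sin hs.le hx.le hxs.le
      have h2 : Real.sin x ≤ Real.sin s / s * x := by
        rw [div_mul_eq_mul_div, le_div_iff₀ hs]; linarith
      linarith
  rcases le_total y Real.pi with h | h
  · exact key y hy h
  · have h1 := key Real.pi Real.pi_pos.le le_rfl
    rw [Real.cos_pi] at h1
    have h2 : Real.sin s / (2 * s) * (Real.pi ^ 2 - s ^ 2) ≤
        Real.sin s / (2 * s) * (y ^ 2 - s ^ 2) := by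
      gcongr
    linarith [Real.neg_one_le_cos y]

lemma neg_sq_div_two_le_mul_cos_sub_sin {v : ℝ} (hv : 0 ≤ v) :
    -(v ^ 2 / 2) ≤ v * Real.cos v - Real.sin v := by
  have := nonneg_of_deriv_nonneg_of_zero (g := fun v => v * Real.cos v - Real.sin v + v ^ 2 / 2)
    (g' := fun v => v * (1 - Real.sin v)) (a := v) (by simp) (fun x => ?_) (fun x hx _ => ?_) hv le_rfl
  · linarith
  · refine ((((hasDerivAt_id' x).fun_mul (Real.hasDerivAt_cos x)).fun_sub
      (Real.hasDerivAt_sin x)).fun_add ((hasDerivAt_pow 2 x).div_const 2)).congr_deriv ?_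
    norm_num
    ring
  · exact mul_nonneg hx (by linarith [Real.sin_le_one x])

lemma sinc_add_half_mono {y s : ℝ} (hy : 0 < y) (hys : y ≤ s) :
    Real.sin y / y + y / 2 ≤ Real.sin s / s + s / 2 := by
  have hd : ∀ x : ℝ, 0 < x → HasDerivAt (fun v => Real.sin v / v + v / 2)
      ((Real.cos x * x - Real.sin x * 1) / x ^ 2 + 1 / 2) x := fun x hx =>
    ((Real.hasDerivAt_sin x).fun_div (hasDerivAt_id' x) hx.ne').fun_add
      ((hasDerivAt_id' x).div_const 2)
  refine monotoneOn_of_deriv_nonneg (convex_Icc y s)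
    (fun x hx => (hd x (hy.trans_le hx.1)).continuousAt.continuousWithinAt)
    (fun x hx => ?_) (fun x hx => ?_) ⟨le_rfl, hys⟩ ⟨hys, le_rfl⟩ hys
  · rw [interior_Icc] at hx
    exact (hd x (hy.trans hx.1)).differentiableAt.differentiableWithinAt
  · rw [interior_Icc] at hx
    have hx0 : 0 < x := hy.trans hx.1
    rw [(hd x hx0).deriv]
    have h := neg_sq_div_two_le_mul_cos_sub_sin hx0.le
    have : -(1 / 2) ≤ (Real.cos x * x - Real.sin x * 1) / x ^ 2 := by
      rw [le_div_iff₀ (by positivity)]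
      linarith
    linarith

lemma cos_le_tangent_add {s y : ℝ} (hs : 0 < s) (hy : 0 ≤ y) :
    Real.cos y ≤ Real.cos s - Real.sin s / (2 * s) * (y ^ 2 - s ^ 2) +
      1 / 6 * (y ^ 3 - 3 / 2 * s * y ^ 2 + s ^ 3 / 2) := by
  have := le_of_deriv_sign (g := fun z => - Real.cos z - Real.sin s / (2 * s) * (z ^ 2 - s ^ 2) +
      1 / 6 * (z ^ 3 - 3 / 2 * s * z ^ 2 + s ^ 3 / 2))
    (g' := fun z => Real.sin z - Real.sin s / s * z + (z ^ 2 - s * z) / 2) (b := max s y)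
    hs.le (le_max_left _ _) ?_ ?_ ?_ hy (le_max_right _ _)
  · ring_nf at this ⊢
    linarith
  · intro x
    refine (((Real.hasDerivAt_cos x).fun_neg.fun_sub (((hasDerivAt_pow 2 x).sub_const _).const_mul
        _)).fun_add ((((hasDerivAt_pow 3 x).fun_sub ((hasDerivAt_pow 2 x).const_mul
        (3 / 2 * s))).add_const (s ^ 3 / 2)).const_mul (1 / 6))).congr_deriv ?_
    norm_num
    ring
  · intro x hx hxs
    have h := mul_le_mul_of_nonneg_left (sinc_add_half_mono hx hxs.le) hx.le
    have e : x * (Real.sin x / x + x / 2) = Real.sin x + x ^ 2 / 2 := by field_simp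
    rw [e] at h
    have e2 : x * (Real.sin s / s + s / 2) = Real.sin s / s * x + s * x / 2 := by ring
    linarith
  · intro x hx hxs
    have hx0 := hs.trans hx
    have h := mul_le_mul_of_nonneg_left (sinc_add_half_mono hs hx.le) hx0.le
    have e : x * (Real.sin x / x + x / 2) = Real.sin x + x ^ 2 / 2 := by field_simp
    rw [e] at h
    have e2 : x * (Real.sin s / s + s / 2) = Real.sin s / s * x + s * x / 2 := by ring
    linarith

lemma cos_le_cubic {y : ℝ} (hy : 0 ≤ y) : Real.cos y ≤ 1 - y ^ 2 / 2 + y ^ 3 / 10 := by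
  rcases le_total y (12 / 5) with h | h
  · have h1 := cos_upper_four hy
    nlinarith [mul_nonneg (pow_nonneg hy 3) (sub_nonneg.2 h)]
  · have h1 := cos_lower_two (y - Real.pi)
    rw [Real.cos_sub_pi] at h1
    have p1 := Real.pi_gt_d4
    have p2 := Real.pi_lt_d4
    have h3 : y ^ 3 / 10 - y ^ 2 + 3.1416 * y + 2 - 3.1416 ^ 2 / 2 ≥ 0.001 := by
      nlinarith [mul_nonneg hy (sq_nonneg (y - 4.13)), sq_nonneg (y - 4.13)]
    nlinarith [mul_nonneg (sub_nonneg.2 p2.le) (sub_nonneg.2 p1.le)]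

section moments

variable {κ : Measure ℝ} [IsProbabilityMeasure κ] {ρ : ℝ}

lemma integrable_sq_of_cube (h3 : Integrable (fun x => |x| ^ 3) κ) :
    Integrable (fun x => x ^ 2) κ := by
  refine ((integrable_const (1 : ℝ)).add h3).mono' (by fun_prop) (ae_of_all _ fun x => ?_)
  rw [Real.norm_eq_abs, abs_pow, Pi.add_apply]
  nlinarith [abs_nonneg x, sq_nonneg (|x| - 1), mul_nonneg (abs_nonneg x) (sq_nonneg (|x| - 1))]

lemma integrable_cos_mul (s : ℝ) : Integrable (fun x => Real.cos (s * x)) κ :=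
  Integrable.of_bound (by fun_prop) 1 (ae_of_all _ fun y => Real.abs_cos_le_one _)

lemma one_le_third_moment (h3 : Integrable (fun x => |x| ^ 3) κ)
    (m2 : ∫ x, x ^ 2 ∂κ = 1) (m3 : ∫ x, |x| ^ 3 ∂κ = ρ) : 1 ≤ ρ := by
  have h : ∫ x, x ^ 2 ∂κ ≤ ∫ x, (2 / 3 * |x| ^ 3 + 1 / 3) ∂κ := by
    refine integral_mono (integrable_sq_of_cube h3)
      ((h3.const_mul _).add (integrable_const _)) fun x => ?_
    simp only
    rw [← sq_abs]
    nlinarith [abs_nonneg x, sq_nonneg (|x| - 1), mul_nonneg (abs_nonneg x) (sq_nonneg (|x| - 1))]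
  rw [integral_add (h3.const_mul _) (integrable_const _), integral_const_mul, m2, m3] at h
  simp at h
  linarith

lemma cos_le_charfn (h3 : Integrable (fun x => |x| ^ 3) κ) (m2 : ∫ x, x ^ 2 ∂κ = 1)
    {s : ℝ} (hs : 0 < s) (hsp : s ≤ Real.pi) : Real.cos s ≤ ∫ x, Real.cos (s * x) ∂κ := by
  have h2 := integrable_sq_of_cube h3
  have hi : Integrable (fun x : ℝ => Real.cos s + Real.sin s / (2 * s) * s ^ 2 -
      Real.sin s / (2 * s) * s ^ 2 * x ^ 2) κ := (integrable_const _).sub (h2.const_mul _)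
  have h := integral_mono hi (integrable_cos_mul (κ := κ) s) fun x => ?_
  · rw [integral_sub (integrable_const _) (h2.const_mul _), integral_const_mul, m2] at h
    simp at h
    linarith
  · have := cos_ge_tangent hs hsp (y := s * |x|) (by positivity)
    have e : Real.cos (s * |x|) = Real.cos (s * x) := by
      rw [← Real.cos_abs (s * x), abs_mul, abs_of_pos hs]
    rw [e, mul_pow, sq_abs] at this
    simp only
    linarith

lemma integral_quadratic_cubic (h3 : Integrable (fun x => |x| ^ 3) κ) (m2 : ∫ x, x ^ 2 ∂κ = 1)
    (m3 : ∫ x, |x| ^ 3 ∂κ = ρ) (a b c : ℝ) :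
    ∫ x, (a - b * x ^ 2 + c * |x| ^ 3) ∂κ = a - b + c * ρ := by
  have h2 := integrable_sq_of_cube h3
  have hi : Integrable (fun x : ℝ => a - b * x ^ 2) κ := (integrable_const _).sub (h2.const_mul _)
  rw [integral_add hi (h3.const_mul _), integral_sub (integrable_const _) (h2.const_mul _),
    integral_const_mul, integral_const_mul, m2, m3]
  simp

lemma charfn_le_cos_add (h3 : Integrable (fun x => |x| ^ 3) κ) (m2 : ∫ x, x ^ 2 ∂κ = 1)
    (m3 : ∫ x, |x| ^ 3 ∂κ = ρ) {s : ℝ} (hs : 0 < s) :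
    ∫ x, Real.cos (s * x) ∂κ ≤ Real.cos s + (ρ - 1) / 6 * s ^ 3 := by
  have h2 := integrable_sq_of_cube h3
  set k := Real.sin s / (2 * s) * s ^ 2 + s ^ 3 / 4 with hk
  have hi : Integrable (fun x : ℝ => Real.cos s + Real.sin s / (2 * s) * s ^ 2 + s ^ 3 / 12 -
      k * x ^ 2 + s ^ 3 / 6 * |x| ^ 3) κ :=
    ((integrable_const _).sub (h2.const_mul _)).add (h3.const_mul _)
  have h := integral_mono (integrable_cos_mul (κ := κ) s) hi fun x => ?_
  · rw [integral_quadratic_cubic h3 m2 m3] at h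
    rw [hk] at h
    linarith
  · have := cos_le_tangent_add hs (y := s * |x|) (by positivity)
    have e : Real.cos (s * |x|) = Real.cos (s * x) := by
      rw [← Real.cos_abs (s * x), abs_mul, abs_of_pos hs]
    rw [e, mul_pow, mul_pow, sq_abs] at this
    simp only
    rw [hk]
    linarith

lemma charfn_le_cubic (h3 : Integrable (fun x => |x| ^ 3) κ) (m2 : ∫ x, x ^ 2 ∂κ = 1)
    (m3 : ∫ x, |x| ^ 3 ∂κ = ρ) {s : ℝ} (hs : 0 < s) :
    ∫ x, Real.cos (s * x) ∂κ ≤ 1 - s ^ 2 / 2 + ρ / 10 * s ^ 3 := by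
  have h2 := integrable_sq_of_cube h3
  have hi : Integrable (fun x : ℝ => 1 - s ^ 2 / 2 * x ^ 2 + s ^ 3 / 10 * |x| ^ 3) κ :=
    ((integrable_const _).sub (h2.const_mul _)).add (h3.const_mul _)
  have h := integral_mono (integrable_cos_mul (κ := κ) s) hi fun x => ?_
  · rw [integral_quadratic_cubic h3 m2 m3] at h
    linarith
  · have := cos_le_cubic (y := s * |x|) (by positivity)
    have e : Real.cos (s * |x|) = Real.cos (s * x) := by
      rw [← Real.cos_abs (s * x), abs_mul, abs_of_pos hs]
    rw [e, mul_pow, mul_pow, sq_abs] at this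
    simp only
    linarith

end moments

/-- `W` is integrable on `S` with integral at most `I`. -/
def IntegralLe (S : Set ℝ) (W : ℝ → ℝ) (I : ℝ) : Prop :=
  IntegrableOn W S ∧ ∫ s in S, W s ≤ I

lemma IntegralLe.add {S : Set ℝ} {V W : ℝ → ℝ} {I J : ℝ} (hV : IntegralLe S V I)
    (hW : IntegralLe S W J) : IntegralLe S (fun s => V s + W s) (I + J) := by
  refine ⟨hV.1.add hW.1, ?_⟩
  rw [integral_add hV.1 hW.1]
  exact add_le_add hV.2 hW.2

lemma IntegralLe.const_mul {S : Set ℝ} {V : ℝ → ℝ} {I : ℝ} (hV : IntegralLe S V I) {k : ℝ}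
    (hk : 0 ≤ k) : IntegralLe S (fun s => k * V s) (k * I) := by
  refine ⟨hV.1.const_mul k, ?_⟩
  rw [integral_const_mul]
  exact mul_le_mul_of_nonneg_left hV.2 hk

lemma IntegralLe.trans {S : Set ℝ} {V : ℝ → ℝ} {I J : ℝ} (hV : IntegralLe S V I) (hIJ : I ≤ J) :
    IntegralLe S V J :=
  ⟨hV.1, hV.2.trans hIJ⟩

lemma IntegralLe.of_Ioi {S : Set ℝ} {V : ℝ → ℝ} {I : ℝ} (hV : IntegrableOn V (Set.Ioi 0))
    (h0 : ∀ s, 0 < s → 0 ≤ V s) (hI : ∫ s in Set.Ioi 0, V s ≤ I) (hS : S ⊆ Set.Ioi 0) :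
    IntegralLe S V I := by
  refine ⟨hV.mono_set hS, le_trans ?_ hI⟩
  refine setIntegral_mono_set hV ?_ hS.eventuallyLE
  exact (ae_restrict_iff' measurableSet_Ioi).2 (ae_of_all _ fun s hs => h0 s hs)

lemma hasDerivAt_exp_neg_mul_sq (b x : ℝ) :
    HasDerivAt (fun s => Real.exp (-b * s ^ 2)) (-(2 * b * x) * Real.exp (-b * x ^ 2)) x := by
  have h := (((hasDerivAt_id' x).pow 2).const_mul (-b)).exp
  refine h.congr_deriv ?_
  norm_num
  ring

lemma integrable_pow_mul_exp_neg_mul_sq {b : ℝ} (hb : 0 < b) (k : ℕ) :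
    Integrable (fun s : ℝ => s ^ k * Real.exp (-b * s ^ 2)) := by
  have h := integrable_rpow_mul_exp_neg_mul_sq hb (s := k)
    (lt_of_lt_of_le (by norm_num) k.cast_nonneg)
  simpa only [Real.rpow_natCast] using h

lemma integral_pow_mul_exp_neg_mul_sq_succ {b : ℝ} (hb : 0 < b) (k : ℕ) :
    ∫ s in Set.Ioi (0 : ℝ), s ^ (k + 2) * Real.exp (-b * s ^ 2) =
      (k + 1) / (2 * b) * ∫ s in Set.Ioi (0 : ℝ), s ^ k * Real.exp (-b * s ^ 2) := by
  have hd : ∀ x : ℝ, HasDerivAt (fun s => s ^ (k + 1) * Real.exp (-b * s ^ 2))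
      ((k + 1) * (x ^ k * Real.exp (-b * x ^ 2)) -
        2 * b * (x ^ (k + 2) * Real.exp (-b * x ^ 2))) x := fun x => by
    refine ((hasDerivAt_pow (k + 1) x).mul (hasDerivAt_exp_neg_mul_sq b x)).congr_deriv ?_
    push_cast
    ring_nf
  have hi := fun j => (integrable_pow_mul_exp_neg_mul_sq hb j).integrableOn (s := Set.Ioi 0)
  have hi' := ((hi k).const_mul ((k : ℝ) + 1)).sub ((hi (k + 2)).const_mul (2 * b))
  have h := integral_Ioi_of_hasDerivAt_of_tendsto' (fun x _ => hd x) hi'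
    (tendsto_zero_of_hasDerivAt_of_integrableOn_Ioi (fun x _ => hd x) hi' (hi (k + 1)))
  rw [integral_sub ((hi k).const_mul _) ((hi (k + 2)).const_mul _), integral_const_mul,
    integral_const_mul] at h
  simp only [ne_eq, Nat.add_eq_zero_iff, one_ne_zero, and_false, not_false_eq_true, zero_pow,
    zero_mul, sub_zero] at h
  rw [div_mul_eq_mul_div, eq_div_iff (by positivity)]
  linarith

lemma integral_sq_mul_exp_neg_mul_sq {b : ℝ} (hb : 0 < b) :
    ∫ s in Set.Ioi (0 : ℝ), s ^ 2 * Real.exp (-b * s ^ 2) = √(Real.pi / b) / (4 * b) := by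
  have h := integral_pow_mul_exp_neg_mul_sq_succ hb 0
  simp only [zero_add, pow_zero, one_mul, integral_gaussian_Ioi] at h
  rw [h]
  push_cast
  field_simp
  norm_num

lemma integral_pow_six_mul_exp_neg_mul_sq {b : ℝ} (hb : 0 < b) :
    ∫ s in Set.Ioi (0 : ℝ), s ^ 6 * Real.exp (-b * s ^ 2) =
      15 * √(Real.pi / b) / (16 * b ^ 3) := by
  rw [integral_pow_mul_exp_neg_mul_sq_succ hb 4, integral_pow_mul_exp_neg_mul_sq_succ hb 2,
    integral_sq_mul_exp_neg_mul_sq hb]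
  push_cast
  field_simp
  norm_num

lemma integral_cube_mul_exp_neg_mul_sq {b : ℝ} (hb : 0 < b) :
    ∫ s in Set.Ioi (0 : ℝ), s ^ 3 * Real.exp (-b * s ^ 2) = 1 / (2 * b ^ 2) := by
  have hd : ∀ x ∈ Set.Ici (0 : ℝ), HasDerivAt
      (fun s => -(1 / (2 * b)) * Real.exp (-b * s ^ 2)) (x ^ 1 * Real.exp (-b * x ^ 2)) x := by
    intro x _
    refine ((hasDerivAt_exp_neg_mul_sq b x).const_mul _).congr_deriv ?_
    field_simp
  have hi := fun j => (integrable_pow_mul_exp_neg_mul_sq hb j).integrableOn (s := Set.Ioi 0)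
  have h0 : IntegrableOn (fun s => -(1 / (2 * b)) * Real.exp (-b * s ^ 2)) (Set.Ioi 0) := by
    have := (hi 0).const_mul (-(1 / (2 * b)))
    simp only [pow_zero, one_mul] at this
    exact this
  have h := integral_Ioi_of_hasDerivAt_of_tendsto' hd (hi 1)
    (tendsto_zero_of_hasDerivAt_of_integrableOn_Ioi
      (fun x hx => hd x (Set.Ioi_subset_Ici_self hx)) (hi 1) h0)
  rw [integral_pow_mul_exp_neg_mul_sq_succ hb 1, h]
  simp only [ne_eq, OfNat.ofNat_ne_zero, not_false_eq_true, zero_pow, mul_zero, Real.exp_zero]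
  push_cast
  field_simp
  norm_num

/-- Upper bound for the integral defining the exponential integral function. -/
lemma integral_Ioi_exp_neg_sq_div_le {c a : ℝ} (hc : 0 < c) (ha : 0 < a) :
    ∫ s in Set.Ioi a, Real.exp (-(c ^ 2 * s ^ 2 / 2)) / s ≤
      Real.exp (-(c ^ 2 * a ^ 2 / 2)) * (c ^ 2 * a ^ 2 / 2 + 1) /
        (2 * (c ^ 2 * a ^ 2 / 2) * (c ^ 2 * a ^ 2 / 2 + 2)) := by
  set F : ℝ → ℝ := fun s => -(Real.exp (-(c ^ 2 * s ^ 2 / 2)) * (c ^ 2 * s ^ 2 / 2 + 1) /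
        (2 * (c ^ 2 * s ^ 2 / 2) * (c ^ 2 * s ^ 2 / 2 + 2))) with hF
  set F' : ℝ → ℝ := fun s => Real.exp (-(c ^ 2 * s ^ 2 / 2)) / s *
    (1 + 2 / ((c ^ 2 * s ^ 2 / 2) * (c ^ 2 * s ^ 2 / 2 + 2) ^ 2)) with hF'
  have hd : ∀ x ∈ Set.Ici a, HasDerivAt F (F' x) x := by
    intro x hx
    have hx0 : 0 < x := ha.trans_le hx
    have hu : HasDerivAt (fun s : ℝ => c ^ 2 * s ^ 2 / 2) (c ^ 2 * x) x := by
      refine (((hasDerivAt_pow 2 x).const_mul (c ^ 2)).div_const 2).congr_deriv ?_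
      norm_num
      ring
    have hne : 2 * (c ^ 2 * x ^ 2 / 2) * (c ^ 2 * x ^ 2 / 2 + 2) ≠ 0 := by positivity
    refine ((((hu.fun_neg.exp).fun_mul (hu.add_const 1)).fun_div
      ((hu.const_mul 2).fun_mul (hu.add_const 2)) hne).fun_neg).congr_deriv ?_
    simp only [hF']
    field_simp
    ring
  have hpos : ∀ x ∈ Set.Ioi a, 0 ≤ F' x := fun x hx => by
    have hx0 : 0 < x := ha.trans hx
    simp only [hF']
    positivity
  have ht : Tendsto F atTop (𝓝 0) := by
    have h1 : Tendsto (fun s : ℝ => Real.exp (-(c ^ 2 * s ^ 2 / 2))) atTop (𝓝 0) := by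
      refine Real.tendsto_exp_neg_atTop_nhds_zero.comp ?_
      refine Tendsto.atTop_div_const (by norm_num) ?_
      exact (tendsto_pow_atTop (by norm_num)).const_mul_atTop (by positivity)
    have h2 := h1.mul_const (1 / (c ^ 2 * a ^ 2))
    rw [zero_mul] at h2
    rw [← neg_zero]
    refine Tendsto.neg (squeeze_zero' ?_ ?_ h2)
    · filter_upwards [eventually_gt_atTop a] with s hs
      positivity
    · filter_upwards [eventually_gt_atTop a] with s hs
      rw [mul_div_assoc]
      refine mul_le_mul_of_nonneg_left ?_ (Real.exp_pos _).le
      have hs0 : 0 < s := ha.trans hs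
      have hsa : c ^ 2 * a ^ 2 ≤ c ^ 2 * s ^ 2 := by gcongr
      have hca : 0 < c ^ 2 * a ^ 2 := by positivity
      rw [div_le_div_iff₀ (by positivity) hca]
      generalize c ^ 2 * a ^ 2 = p at *
      generalize c ^ 2 * s ^ 2 = u at *
      nlinarith
  have hint := integrableOn_Ioi_deriv_of_nonneg' hd hpos ht
  have heq := integral_Ioi_of_hasDerivAt_of_nonneg' hd hpos ht
  calc _ ≤ ∫ s in Set.Ioi a, F' s := by
        refine setIntegral_mono_on (integrableOn_exp_neg_sq_div hc ha) hint measurableSet_Ioi ?_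
        intro s hs
        have hs0 : 0 < s := ha.trans hs
        simp only [hF']
        refine le_mul_of_one_le_right (by positivity) ?_
        have : 0 ≤ 2 / ((c ^ 2 * s ^ 2 / 2) * (c ^ 2 * s ^ 2 / 2 + 2) ^ 2) := by positivity
        linarith
    _ = _ := by
        rw [heq, zero_sub, hF, neg_neg]

/-- `∏_{i<m} (2i+1)/(2i+2)`, the normalized integral of `cos^(2m)`. -/
noncomputable def cosPowMean (m : ℕ) : ℝ :=
  ∏ i ∈ Finset.range m, (2 * (i : ℝ) + 1) / (2 * i + 2)

lemma cosPowMean_succ (m : ℕ) :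
    cosPowMean (m + 1) = cosPowMean m * ((2 * (m : ℝ) + 1) / (2 * m + 2)) :=
  Finset.prod_range_succ _ _

lemma cosPowMean_pos (m : ℕ) : 0 < cosPowMean m :=
  Finset.prod_pos fun i _ => by positivity

lemma integral_cos_pow_even_pi_div_two (m : ℕ) :
    ∫ s in (0 : ℝ)..(Real.pi / 2), Real.cos s ^ (2 * m) = Real.pi / 2 * cosPowMean m := by
  induction m with
  | zero => simp [cosPowMean]
  | succ m ih =>
    rw [show 2 * (m + 1) = 2 * m + 2 by ring, integral_cos_pow, ih, cosPowMean_succ]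
    simp only [Real.cos_pi_div_two, Real.sin_zero, ne_eq, Nat.add_eq_zero_iff, one_ne_zero,
      and_false, not_false_eq_true, zero_pow, zero_mul, mul_zero, sub_zero, zero_div, zero_add]
    push_cast
    ring

lemma integral_cos_pow_even_pi (m : ℕ) :
    ∫ s in (0 : ℝ)..Real.pi, Real.cos s ^ (2 * m) = Real.pi * cosPowMean m := by
  induction m with
  | zero => simp [cosPowMean]
  | succ m ih =>
    rw [show 2 * (m + 1) = 2 * m + 2 by ring, integral_cos_pow, ih, cosPowMean_succ]
    simp only [Real.sin_pi, Real.sin_zero, mul_zero, sub_zero, zero_div, zero_add]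
    push_cast
    ring

lemma integral_one_sub_mul_cos_pow_even (m : ℕ) :
    ∫ s in (0 : ℝ)..Real.pi, (1 - s / Real.pi) * Real.cos s ^ (2 * m) =
      Real.pi / 2 * cosPowMean m := by
  have hpi := Real.pi_pos
  have h1 : ∫ s in (0 : ℝ)..Real.pi, (1 - s / Real.pi) * Real.cos s ^ (2 * m) =
      ∫ s in (0 : ℝ)..Real.pi, s / Real.pi * Real.cos s ^ (2 * m) := by
    have h := intervalIntegral.integral_comp_sub_left (a := 0) (b := Real.pi)
      (fun s => s / Real.pi * Real.cos s ^ (2 * m)) Real.pi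
    rw [sub_self, sub_zero] at h
    rw [← h]
    refine intervalIntegral.integral_congr fun s _ => ?_
    simp only [Real.cos_pi_sub, (even_two_mul m).neg_pow]
    field_simp
  have h2 : (∫ s in (0 : ℝ)..Real.pi, (1 - s / Real.pi) * Real.cos s ^ (2 * m)) +
      (∫ s in (0 : ℝ)..Real.pi, s / Real.pi * Real.cos s ^ (2 * m)) =
      ∫ s in (0 : ℝ)..Real.pi, Real.cos s ^ (2 * m) := by
    rw [← intervalIntegral.integral_add (Continuous.intervalIntegrable (by fun_prop) _ _)
      (Continuous.intervalIntegrable (by fun_prop) _ _)]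
    refine intervalIntegral.integral_congr fun s _ => ?_
    ring
  rw [integral_cos_pow_even_pi] at h2
  linarith

lemma cosPowMean_sq_mul (m : ℕ) :
    cosPowMean m ^ 2 * ((2 * m + 1) * Real.Wallis.W m) = 1 := by
  induction m with
  | zero => simp [cosPowMean, Real.Wallis.W]
  | succ m ih =>
    rw [cosPowMean_succ, Real.Wallis.W_succ]
    refine Eq.trans ?_ ih
    push_cast
    field_simp
    ring

/-- `cosPowMean m ≤ 1 / √(π (m + 1/4))`. -/
lemma cosPowMean_sq_le (m : ℕ) : cosPowMean m ^ 2 * (m + 1 / 4) ≤ 1 / Real.pi := by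
  have hmono : Monotone fun m : ℕ => cosPowMean m ^ 2 * ((m : ℝ) + 1 / 4) := by
    refine monotone_nat_of_le_succ fun k => ?_
    rw [cosPowMean_succ, mul_pow, mul_assoc]
    refine mul_le_mul_of_nonneg_left ?_ (sq_nonneg _)
    push_cast
    rw [div_pow, div_mul_eq_mul_div, le_div_iff₀ (by positivity)]
    nlinarith [(k.cast_nonneg : (0 : ℝ) ≤ k)]
  refine hmono.ge_of_tendsto ?_ m
  have heq : (fun m : ℕ => cosPowMean m ^ 2 * ((m : ℝ) + 1 / 4)) =
      fun m : ℕ => (1 / 2 - 1 / 4 * (1 / (2 * (m : ℝ) + 1))) * (Real.Wallis.W m)⁻¹ := by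
    funext k
    have h := cosPowMean_sq_mul k
    have hW := Real.Wallis.W_pos k
    have : cosPowMean k ^ 2 = 1 / ((2 * k + 1) * Real.Wallis.W k) := by
      rw [eq_div_iff (by positivity), h]
    rw [this]
    field_simp
    ring
  rw [heq]
  have hW := Real.Wallis.tendsto_W_nhds_pi_div_two.inv₀ (by positivity)
  have h1 : Tendsto (fun m : ℕ => 1 / (2 * (m : ℝ) + 1)) atTop (𝓝 0) := by
    refine tendsto_const_nhds.div_atTop ?_
    exact tendsto_atTop_add_const_right _ _
      (tendsto_natCast_atTop_atTop.const_mul_atTop (by norm_num))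
  have h2 := (tendsto_const_nhds (x := (1 / 2 : ℝ))).sub (h1.const_mul (1 / 4))
  convert h2.mul hW using 2
  field_simp
  norm_num

lemma IntegralLe.reflect {V : ℝ → ℝ} {I : ℝ} (hV : IntegralLe (Set.Ioo 0 Real.pi) V I) :
    IntegralLe (Set.Ioo 0 Real.pi) (fun s => V (Real.pi - s)) I := by
  obtain ⟨h1, h2⟩ := hV
  have hpi := Real.pi_pos.le
  constructor
  · rw [← intervalIntegrable_iff_integrableOn_Ioo_of_le hpi] at h1 ⊢
    have := h1.comp_sub_left Real.pi
    rw [sub_zero, sub_self] at this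
    exact this.symm
  · rw [← integral_Ioc_eq_integral_Ioo, ← intervalIntegral.integral_of_le hpi] at h2 ⊢
    rw [intervalIntegral.integral_comp_sub_left, sub_self, sub_zero]
    exact h2

lemma lin_trig_le {a b r : ℝ} (y : ℝ) (h : a ^ 2 + b ^ 2 ≤ r ^ 2) (hr : 0 ≤ r) :
    a * Real.cos y + b * Real.sin y ≤ r := by
  refine le_of_sq_le_sq ?_ hr
  nlinarith [sq_nonneg (a * Real.sin y - b * Real.cos y), Real.sin_sq_add_cos_sq y]

lemma cos_add_cubic_le_exp {δ s : ℝ} (hδ : δ ≤ 0.38) (h0 : 0 ≤ s) (h2 : s ≤ 2) :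
    Real.cos s + δ / 6 * s ^ 3 ≤ Real.exp (-(s ^ 2 / 3)) := by
  have hc := cos_upper_eight h0
  have he := exp_neg_lower_two (z := s ^ 2 / 3) (by positivity)
  have h3 : δ / 6 * s ^ 3 ≤ 0.38 / 6 * s ^ 3 := by gcongr
  have key : 0 ≤ s ^ 2 * (1 / 6 - 0.38 / 6 * s + s ^ 2 / 72 - s ^ 4 / 162 + s ^ 4 / 720
      - s ^ 6 / 40320) := by
    refine mul_nonneg (sq_nonneg s) ?_
    have e1 : s ^ 2 ≤ 4 := by nlinarith
    have e2 : s ^ 4 ≤ 4 * s ^ 2 := by nlinarith [sq_nonneg s]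
    have e3 : s ^ 6 ≤ 4 * s ^ 4 := by nlinarith [sq_nonneg (s ^ 2)]
    nlinarith
  nlinarith

lemma cubic_le_neg_two_cos {δ s : ℝ} (hδ : δ ≤ 0.38) (h2 : 2 ≤ s) (hs : s ≤ Real.pi) :
    δ / 6 * s ^ 3 ≤ -2 * Real.cos s := by
  have hc := cos_lower_two (Real.pi - s)
  rw [Real.cos_pi_sub] at hc
  have h3 : δ / 6 * s ^ 3 ≤ 0.38 / 6 * s ^ 3 := by gcongr
  have p1 := Real.pi_lt_d4
  have p2 := Real.pi_gt_d4
  have hcube : s ^ 3 ≤ 8 + 20.2 * (s - 2) := by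
    have : s ^ 2 + 2 * s + 4 ≤ 20.2 := by nlinarith
    nlinarith
  have hq : (Real.pi - s) ^ 2 ≤ 1.1416 * (3.1416 - s) := by nlinarith
  nlinarith

/-- A power of the characteristic function exceeds that of the cosine by a controlled amount. -/
lemma pow_charfn_le {g : ℝ} {δ s : ℝ} {n : ℕ} (hn : Even n) (hn1 : 1 ≤ n) (hδ0 : 0 ≤ δ)
    (hδ : δ ≤ 0.38) (h0 : 0 < s) (hs : s ≤ Real.pi) (hlo : Real.cos s ≤ g)
    (hup : g ≤ Real.cos s + δ / 6 * s ^ 3) :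
    g ^ n ≤ Real.cos s ^ n + n * (δ / 6 * s ^ 3) * Real.exp (-((n - 1) * s ^ 2 / 3)) := by
  have hE : 0 ≤ n * (δ / 6 * s ^ 3) * Real.exp (-((n - 1) * s ^ 2 / 3)) := by positivity
  rcases le_or_gt |g| |Real.cos s| with h | h
  · have := pow_le_pow_left₀ (abs_nonneg g) h n
    rw [hn.pow_abs, hn.pow_abs] at this
    linarith
  have hg0 : 0 ≤ g := by
    by_contra hg
    push Not at hg
    rw [abs_of_neg hg, abs_of_neg (hlo.trans_lt hg)] at h
    linarith
  rw [abs_of_nonneg hg0] at h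
  rcases le_total 2 s with h2 | h2
  · have := cubic_le_neg_two_cos hδ h2 hs
    have := neg_le_abs (Real.cos s)
    linarith
  have hge : g ≤ Real.exp (-(s ^ 2 / 3)) := hup.trans (cos_add_cubic_le_exp hδ h0.le h2)
  have hpow : g ^ (n - 1) ≤ Real.exp (-((n - 1) * s ^ 2 / 3)) := by
    refine (pow_le_pow_left₀ hg0 hge _).trans_eq ?_
    rw [← Real.exp_nat_mul, Nat.cast_sub hn1]
    congr 1
    push_cast
    ring
  have hgn : g ^ n = g ^ (n - 1) * g := by
    rw [← pow_succ, Nat.sub_add_cancel hn1]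
  have hd : 0 ≤ δ / 6 * s ^ 3 := by positivity
  have hn1' : (1 : ℝ) ≤ n := by exact_mod_cast hn1
  rcases le_total 0 (Real.cos s) with hc | hc
  · have hmv : g ^ n - Real.cos s ^ n ≤ n * g ^ (n - 1) * (g - Real.cos s) := by
      have hb := one_add_mul_le_pow (a := Real.cos s / g - 1) ?_ n
      · rcases hg0.eq_or_lt with h' | hgp
        · rw [← h'] at h
          exact absurd h (not_lt.2 (abs_nonneg _))
        have hb' := mul_le_mul_of_nonneg_left hb (pow_nonneg hg0 n)
        rw [add_sub_cancel, ← mul_pow, mul_div_cancel₀ _ hgp.ne'] at hb'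
        have : g ^ n * (1 + n * (Real.cos s / g - 1)) =
            g ^ n - n * g ^ (n - 1) * (g - Real.cos s) := by
          rw [hgn]
          field_simp
          ring
        linarith
      · have : 0 ≤ Real.cos s / g := div_nonneg hc hg0
        linarith
    have : n * g ^ (n - 1) * (g - Real.cos s) ≤
        n * Real.exp (-((n - 1) * s ^ 2 / 3)) * (δ / 6 * s ^ 3) := by
      gcongr
      linarith
    linarith
  · have h1 : g ≤ δ / 6 * s ^ 3 := by linarith
    have h2 : g ^ n ≤ Real.exp (-((n - 1) * s ^ 2 / 3)) * (δ / 6 * s ^ 3) := by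
      rw [hgn]
      gcongr
    have h3 : 0 ≤ Real.cos s ^ n := hn.pow_nonneg _
    have h4 : 0 ≤ Real.exp (-((n - 1) * s ^ 2 / 3)) * (δ / 6 * s ^ 3) := by positivity
    nlinarith

lemma prawitzG_le_of_pi_div_two_lt {s : ℝ} (h1 : Real.pi / 2 ≤ s) (h2 : s < Real.pi) :
    prawitzG s ≤ (1 - s / Real.pi) * ((Real.pi - s) / 2) := by
  rw [prawitzG_eq_reflect h2]
  refine mul_le_mul_of_nonneg_left ?_ ?_
  · exact cotGap_le_half (by linarith) (by linarith)
  · have := (div_le_one Real.pi_pos).2 h2.le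
    linarith

lemma cos_pow_le_exp {n : ℕ} {s : ℝ} (h0 : 0 ≤ s) (hs : s ≤ Real.pi / 2) :
    Real.cos s ^ n ≤ Real.exp (-(n * s ^ 2 / 2)) := by
  have hc : 0 ≤ Real.cos s := Real.cos_nonneg_of_neg_pi_div_two_le_of_le (by linarith) hs
  refine (pow_le_pow_left₀ hc (cos_le_exp_neg_sq_div_two h0 ?_) n).trans_eq ?_
  · linarith [Real.pi_lt_d2]
  · rw [← Real.exp_nat_mul]
    congr 1
    ring

lemma cos_pow_even_le_exp {n : ℕ} (hn : Even n) {s : ℝ} (h1 : Real.pi / 2 ≤ s)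
    (h2 : s ≤ Real.pi) : Real.cos s ^ n ≤ Real.exp (-(n * (Real.pi - s) ^ 2 / 2)) := by
  have h := cos_pow_le_exp (n := n) (s := Real.pi - s) (by linarith) (by linarith)
  rwa [Real.cos_pi_sub, hn.neg_pow] at h

set_option maxHeartbeats 1000000 in
/-- Pointwise bound for the smoothing integrand when the characteristic function is close to
that of a Rademacher variable. -/
lemma smoothing_integrand_le {g δ s s₁ R : ℝ} {n : ℕ} (hn : Even n) (hn1 : 1 ≤ n)
    (hδ0 : 0 ≤ δ) (hδ : δ ≤ 0.38) (h0 : 0 < s) (hs : s < Real.pi) (hlo : Real.cos s ≤ g)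
    (hup : g ≤ Real.cos s + δ / 6 * s ^ 3) (hs₁ : s₁ ≤ Real.pi / 2)
    (hR : s ≤ s₁ → 0 ≤ R ∧ ((Real.exp (-(n * s ^ 2 / 2)) - Real.cos s ^ n) / s +
        (1 - s / Real.pi) * cotGap s * Real.cos s ^ n) ^ 2 ≤
          2 * ((1 - s / Real.pi) * Real.cos s ^ n) * R) (y : ℝ) :
    g ^ n * ((1 - s / Real.pi) * Real.cos y + prawitzG s * Real.sin y) -
        Real.exp (-(n * s ^ 2 / 2)) * Real.sin y / s ≤
      (1 - s / Real.pi) * Real.cos s ^ n + (if s ≤ s₁ then R else 0) +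
        (if s ≤ s₁ then 0 else Real.exp (-(n * s ^ 2 / 2)) / s) +
        1 / (8 * Real.pi) * ((Real.pi - s) ^ 3 * Real.exp (-(n / 2) * (Real.pi - s) ^ 2)) +
        1.04 * (n * (δ / 6)) * (s ^ 2 * Real.exp (-((n - 1) / 3) * s ^ 2)) := by
  have hq := one_sub_div_pi_nonneg hs.le
  have hf := pow_charfn_le hn hn1 hδ0 hδ h0 hs.le hlo hup
  have hG0 := prawitzG_nonneg h0 hs
  have hhyp := sq_add_prawitzG_sq_le h0 hs
  have hf00 : 0 ≤ Real.cos s ^ n := hn.pow_nonneg _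
  have hEeq : n * (δ / 6 * s ^ 3) * Real.exp (-((n - 1) * s ^ 2 / 3)) * (1.04 / s) =
      1.04 * (n * (δ / 6)) * (s ^ 2 * Real.exp (-((n - 1) / 3) * s ^ 2)) := by
    rw [show -((n - 1 : ℝ) / 3) * s ^ 2 = -((n - 1) * s ^ 2 / 3) by ring]
    field_simp
  rw [← hEeq]
  set E := n * (δ / 6 * s ^ 3) * Real.exp (-((n - 1) * s ^ 2 / 3)) with hE
  have hE0 : 0 ≤ E := by positivity
  set f₀ := Real.cos s ^ n with hf₀
  set φ := Real.exp (-(n * s ^ 2 / 2)) with hφ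
  have hφ0 : 0 < φ := Real.exp_pos _
  set q := 1 - s / Real.pi with hqd
  set G := prawitzG s with hG
  have htrig := lin_trig_le y hhyp (by positivity)
  have hX : 0 ≤ 1 / (8 * Real.pi) *
      ((Real.pi - s) ^ 3 * Real.exp (-(n / 2) * (Real.pi - s) ^ 2)) := by
    have : 0 ≤ Real.pi - s := by linarith
    positivity
  rcases le_or_gt s (Real.pi / 2) with hsp | hsp
  · have hc : 0 ≤ Real.cos s := Real.cos_nonneg_of_neg_pi_div_two_le_of_le (by linarith) hsp
    have he0 : 0 ≤ g ^ n - f₀ := sub_nonneg.2 (pow_le_pow_left₀ hc hlo n)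
    have hfφ : f₀ ≤ φ := cos_pow_le_exp h0.le hsp
    have he : (g ^ n - f₀) * (q * Real.cos y + G * Real.sin y) ≤ E * (1.04 / s) := by
      refine (mul_le_mul_of_nonneg_left htrig he0).trans ?_
      gcongr
      linarith
    have hsplit : g ^ n * (q * Real.cos y + G * Real.sin y) - φ * Real.sin y / s =
        (g ^ n - f₀) * (q * Real.cos y + G * Real.sin y) +
          (q * f₀ * Real.cos y + -(φ / s - f₀ * G) * Real.sin y) := by ring
    have hmain : q * f₀ * Real.cos y + -(φ / s - f₀ * G) * Real.sin y ≤
        q * f₀ + (if s ≤ s₁ then R else 0) + (if s ≤ s₁ then 0 else φ / s) := by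
      split_ifs with hss
      · obtain ⟨hR0, hRb⟩ := hR hss
        rw [add_zero]
        refine lin_trig_le y ?_ (by positivity)
        have hbe : φ / s - f₀ * G = (φ - f₀) / s + q * cotGap s * f₀ := by
          rw [hG, prawitzG_eq h0]
          ring
        rw [neg_sq, hbe]
        nlinarith [sq_nonneg R]
      · rw [add_zero]
        have hGi := prawitzG_le_inv h0 hs
        have hb0 : 0 ≤ φ / s - f₀ * G := by
          have : f₀ * G ≤ φ * (1 / s) := by gcongr
          rw [mul_one_div] at this
          linarith
        have hfG : 0 ≤ f₀ * G := mul_nonneg hf00 hG0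
        have h1 := mul_le_mul_of_nonneg_left (Real.cos_le_one y) (mul_nonneg hq hf00)
        have h2 := mul_le_mul_of_nonneg_left (Real.neg_one_le_sin y) hb0
        linarith
    rw [hsplit]
    linarith
  · have hGl : G ≤ q * ((Real.pi - s) / 2) := prawitzG_le_of_pi_div_two_lt hsp.le hs
    have hx0 : 0 ≤ Real.pi - s := by linarith
    have hhyp2 : q ^ 2 + G ^ 2 ≤ (q * (1 + (Real.pi - s) ^ 2 / 8)) ^ 2 := by
      have := pow_le_pow_left₀ hG0 hGl 2
      have h4 : 0 ≤ q ^ 2 * ((Real.pi - s) ^ 2 / 8) ^ 2 := by positivity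
      linarith
    set r := min (1.04 / s) (q * (1 + (Real.pi - s) ^ 2 / 8)) with hr
    have hr0 : 0 ≤ r := le_min (by positivity) (by positivity)
    have ht2 := lin_trig_le y hhyp2 (by positivity)
    have hfr : g ^ n * (q * Real.cos y + G * Real.sin y) ≤ (f₀ + E) * r := by
      refine (mul_le_mul_of_nonneg_left (le_min htrig ht2) (hn.pow_nonneg g)).trans ?_
      gcongr
    have hr1 : f₀ * r ≤ f₀ * (q * (1 + (Real.pi - s) ^ 2 / 8)) := by
      gcongr
      exact min_le_right _ _
    have hr2 : E * r ≤ E * (1.04 / s) := by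
      gcongr
      exact min_le_left _ _
    have hfe : f₀ * (q * ((Real.pi - s) ^ 2 / 8)) ≤ 1 / (8 * Real.pi) *
        ((Real.pi - s) ^ 3 * Real.exp (-(n / 2) * (Real.pi - s) ^ 2)) := by
      have hle := cos_pow_even_le_exp hn hsp.le hs.le
      rw [show -((n : ℝ) / 2) * (Real.pi - s) ^ 2 = -(n * (Real.pi - s) ^ 2 / 2) by ring]
      have hqe : q * ((Real.pi - s) ^ 2 / 8) = 1 / (8 * Real.pi) * (Real.pi - s) ^ 3 := by
        rw [hqd]
        field_simp
      rw [hqe]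
      refine (mul_le_mul_of_nonneg_right hle (by positivity)).trans_eq ?_
      ring
    have hsin : -(φ * Real.sin y / s) ≤ φ / s := by
      rw [← neg_div]
      refine div_le_div_of_nonneg_right ?_ h0.le
      have := mul_le_mul_of_nonneg_left (Real.neg_one_le_sin y) hφ0.le
      linarith
    have hns : ¬ s ≤ s₁ := by linarith
    rw [if_neg hns, if_neg hns]
    linarith

lemma integralLe_cos_pow {n m : ℕ} (hnm : n = 2 * m) :
    IntegralLe (Set.Ioo 0 Real.pi) (fun s => (1 - s / Real.pi) * Real.cos s ^ n)
      (Real.pi / 2 * cosPowMean m) := by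
  subst hnm
  have hc : Continuous fun s => (1 - s / Real.pi) * Real.cos s ^ (2 * m) := by fun_prop
  refine ⟨(hc.integrableOn_Icc (a := 0) (b := Real.pi)).mono_set Set.Ioo_subset_Icc_self, ?_⟩
  rw [← integral_one_sub_mul_cos_pow_even, intervalIntegral.integral_of_le Real.pi_pos.le,
    integral_Ioc_eq_integral_Ioo]

lemma integralLe_ite {R : ℝ → ℝ} {s₁ I : ℝ} (hs1 : s₁ < Real.pi)
    (hR : IntegralLe (Set.Ioc 0 s₁) R I) :
    IntegralLe (Set.Ioo 0 Real.pi) (fun s => if s ≤ s₁ then R s else 0) I := by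
  have hset : Set.Ioo 0 Real.pi ∩ Set.Iic s₁ = Set.Ioc 0 s₁ := by
    ext s
    simp only [Set.mem_inter_iff, Set.mem_Ioo, Set.mem_Iic, Set.mem_Ioc]
    constructor
    · rintro ⟨⟨h1, h2⟩, h3⟩
      exact ⟨h1, h3⟩
    · rintro ⟨h1, h2⟩
      exact ⟨⟨h1, by linarith⟩, h2⟩
  have heq : (fun s => if s ≤ s₁ then R s else 0) = (Set.Iic s₁).indicator R := by
    funext s
    simp [Set.indicator]
  rw [heq]
  constructor
  · rw [IntegrableOn, integrable_indicator_iff measurableSet_Iic, IntegrableOn,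
      Measure.restrict_restrict measurableSet_Iic, Set.inter_comm, hset]
    exact hR.1
  · rw [setIntegral_indicator measurableSet_Iic, hset]
    exact hR.2

lemma integral_gaussian_tail_split {c s₁ : ℝ} (hc : 0 < c) (h0 : 0 < s₁) (hs1 : s₁ < Real.pi) :
    IntegralLe (Set.Ioo 0 Real.pi)
      (fun s => if s ≤ s₁ then 0 else Real.exp (-(c ^ 2 * s ^ 2 / 2)) / s)
      ((∫ s in Set.Ioi s₁, Real.exp (-(c ^ 2 * s ^ 2 / 2)) / s) -
        ∫ s in Set.Ioi Real.pi, Real.exp (-(c ^ 2 * s ^ 2 / 2)) / s) := by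
  have hi := integrableOn_exp_neg_sq_div hc h0
  have hset : Set.Ioo 0 Real.pi ∩ Set.Ioi s₁ = Set.Ioo s₁ Real.pi := by
    ext s
    simp only [Set.mem_inter_iff, Set.mem_Ioo, Set.mem_Ioi]
    constructor
    · rintro ⟨⟨h1, h2⟩, h3⟩
      exact ⟨h3, h2⟩
    · rintro ⟨h1, h2⟩
      exact ⟨⟨by linarith, h2⟩, h1⟩
  have heq : (fun s => if s ≤ s₁ then 0 else Real.exp (-(c ^ 2 * s ^ 2 / 2)) / s) =
      (Set.Ioi s₁).indicator fun s => Real.exp (-(c ^ 2 * s ^ 2 / 2)) / s := by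
    funext s
    by_cases h : s ≤ s₁ <;> simp [Set.indicator, h]
  rw [heq]
  constructor
  · rw [IntegrableOn, integrable_indicator_iff measurableSet_Ioi, IntegrableOn,
      Measure.restrict_restrict measurableSet_Ioi, Set.inter_comm, hset]
    exact hi.mono_set Set.Ioo_subset_Ioi_self
  · rw [setIntegral_indicator measurableSet_Ioi, hset]
    have hu : Set.Ioi s₁ = Set.Ioc s₁ Real.pi ∪ Set.Ioi Real.pi :=
      (Set.Ioc_union_Ioi_eq_Ioi hs1.le).symm
    conv_rhs => rw [hu]
    rw [setIntegral_union (Set.Ioc_disjoint_Ioi le_rfl) measurableSet_Ioi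
      (hi.mono_set Set.Ioc_subset_Ioi_self) (hi.mono_set (Set.Ioi_subset_Ioi hs1.le)),
      integral_Ioc_eq_integral_Ioo]
    linarith

/-- One-sided Berry–Esseen bound when the third absolute moment is close to its minimal value,
in terms of an auxiliary integral over `(0, s₁]`. -/
lemma cdf_sub_le_of_near_rademacher (μ : Measure ℝ) [IsProbabilityMeasure μ]
    (hμ : Integrable (fun y => y) μ) (g : ℝ → ℝ) (hg : Continuous g) {n m : ℕ}
    (hnm : n = 2 * m) (hn2 : 2 ≤ n)
    (hcos : ∀ t, ∫ y, Real.cos (t * y) ∂μ = g (t / √n) ^ n)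
    (hsin : ∀ t, ∫ y, Real.sin (t * y) ∂μ = 0) {δ : ℝ} (hδ0 : 0 ≤ δ) (hδ : δ ≤ 0.38)
    (hlo : ∀ s, 0 < s → s ≤ Real.pi → Real.cos s ≤ g s)
    (hup : ∀ s, 0 < s → g s ≤ Real.cos s + δ / 6 * s ^ 3)
    {s₁ I : ℝ} (hs₁0 : 0 < s₁) (hs₁ : s₁ ≤ Real.pi / 2) (R : ℝ → ℝ)
    (hR : ∀ s, 0 < s → s ≤ s₁ → 0 ≤ R s ∧
      ((Real.exp (-(n * s ^ 2 / 2)) - Real.cos s ^ n) / s +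
        (1 - s / Real.pi) * cotGap s * Real.cos s ^ n) ^ 2 ≤
          2 * ((1 - s / Real.pi) * Real.cos s ^ n) * R s)
    (hRI : IntegralLe (Set.Ioc 0 s₁) R I) (x : ℝ) :
    μ.real (Set.Iic x) - stdNormalCDF x ≤ cosPowMean m / 2 + 1 / Real.pi * I +
      1 / Real.pi * (Real.exp (-(n * s₁ ^ 2 / 2)) * (n * s₁ ^ 2 / 2 + 1) /
        (2 * (n * s₁ ^ 2 / 2) * (n * s₁ ^ 2 / 2 + 2))) +
      1 / (4 * Real.pi ^ 2 * n ^ 2) + 0.409 * δ / √n := by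
  have hpi := Real.pi_pos
  have hn0 : (2 : ℝ) ≤ n := by exact_mod_cast hn2
  have hsq : √(n : ℝ) ^ 2 = n := Real.sq_sqrt (by positivity)
  have hsn : 0 < √(n : ℝ) := Real.sqrt_pos.2 (by linarith)
  have hs₁π : s₁ < Real.pi := by linarith
  have hev : Even n := hnm ▸ even_two_mul m
  have htail := integral_gaussian_tail_split hsn hs₁0 hs₁π
  have hI4 : IntegralLe (Set.Ioo 0 Real.pi)
      (fun s => s ^ 3 * Real.exp (-((n : ℝ) / 2) * s ^ 2)) (2 / (n : ℝ) ^ 2) := by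
    refine IntegralLe.of_Ioi (integrable_pow_mul_exp_neg_mul_sq (by positivity) 3).integrableOn
      (fun s hs => by positivity) ?_ Set.Ioo_subset_Ioi_self
    rw [integral_cube_mul_exp_neg_mul_sq (by positivity)]
    refine le_of_eq ?_
    field_simp
  have hb : 0 < ((n : ℝ) - 1) / 3 := by linarith
  have hI5 : IntegralLe (Set.Ioo 0 Real.pi) (fun s => s ^ 2 * Real.exp (-(((n : ℝ) - 1) / 3) * s ^ 2))
      (√(Real.pi / (((n : ℝ) - 1) / 3)) / (4 * (((n : ℝ) - 1) / 3))) := by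
    refine IntegralLe.of_Ioi (integrable_pow_mul_exp_neg_mul_sq hb 2).integrableOn
      (fun s hs => by positivity) ?_ Set.Ioo_subset_Ioi_self
    rw [integral_sq_mul_exp_neg_mul_sq hb]
  have hW := ((((integralLe_cos_pow hnm).add (integralLe_ite hs₁π hRI)).add htail).add
    (hI4.reflect.const_mul (k := 1 / (8 * Real.pi)) (by positivity))).add
    (hI5.const_mul (k := 1.04 * (n * (δ / 6))) (by positivity))
  have hmain := cdf_sub_stdNormalCDF_le μ hμ (fun t => g (t / √n) ^ n)
    (by fun_prop) hcos hsin (√n) x hsn _ hW.1 ?_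
  · have htl := integral_Ioi_exp_neg_sq_div_le hsn hs₁0
    have h2 := hW.2
    rw [hsq] at htl
    have hE : 1 / Real.pi * (1.04 * (n * (δ / 6)) *
        (√(Real.pi / (((n : ℝ) - 1) / 3)) / (4 * (((n : ℝ) - 1) / 3)))) ≤ 0.409 * δ / √n := by
      have hr : √(Real.pi / (((n : ℝ) - 1) / 3)) ≤ 4.342 / √n := by
        rw [← Real.sqrt_sq (by norm_num : (0 : ℝ) ≤ 4.342), ← Real.sqrt_div (by positivity)]
        refine Real.sqrt_le_sqrt ?_
        rw [div_le_div_iff₀ hb (by positivity)]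
        nlinarith [Real.pi_lt_d4]
      have hn' : n / (4 * (((n : ℝ) - 1) / 3)) ≤ 1.5 := by
        rw [div_le_iff₀ (by positivity)]
        linarith
      have hπ : 1 / Real.pi ≤ 0.3184 := by
        rw [div_le_iff₀ hpi]
        nlinarith [Real.pi_gt_d4]
      calc _ = (1 / Real.pi) * (n / (4 * (((n : ℝ) - 1) / 3))) *
            √(Real.pi / (((n : ℝ) - 1) / 3)) * (1.04 / 6) * δ := by ring
        _ ≤ 0.3184 * 1.5 * (4.342 / √n) * (1.04 / 6) * δ := by
            gcongr
        _ = (0.3184 * 1.5 * 4.342 * (1.04 / 6)) * δ / √n := by ring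
        _ ≤ 0.409 * δ / √n := by
            gcongr
            norm_num
    refine hmain.trans ?_
    have h3 := mul_le_mul_of_nonneg_left (add_le_add_left h2
      (∫ s in Set.Ioi Real.pi, Real.exp (-(√(n : ℝ) ^ 2 * s ^ 2 / 2)) / s))
      (by positivity : 0 ≤ 1 / Real.pi)
    refine h3.trans ?_
    rw [hsq]
    have h4 := mul_le_mul_of_nonneg_left htl (by positivity : 0 ≤ 1 / Real.pi)
    have h5 : 1 / Real.pi * (Real.pi / 2 * cosPowMean m) = cosPowMean m / 2 := by field_simp
    have h6 : 1 / Real.pi * (1 / (8 * Real.pi) * (2 / (n : ℝ) ^ 2)) =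
        1 / (4 * Real.pi ^ 2 * n ^ 2) := by
      field_simp
      norm_num
    linarith
  · intro s hs y
    have hgs : g (√n * s / √n) = g s := by
      rw [mul_div_cancel_left₀ _ hsn.ne']
    simp only [hgs, hsq]
    exact smoothing_integrand_le hev (by omega) hδ0 hδ hs.1 hs.2 (hlo s hs.1 hs.2.le)
      (hup s hs.1) hs₁ (hR s hs.1) y

lemma one_sub_mul_cotGap_sq_le {s : ℝ} (h0 : 0 < s) (h1 : s ≤ 6 / 5) :
    (1 - s / Real.pi) * cotGap s ^ 2 ≤ s ^ 2 / 9 := by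
  have hpi := Real.pi_gt_three
  have hc := cotGap_le_quadratic h0 h1
  have hc0 := cotGap_nonneg h0 (by linarith)
  have hq : 1 - s / Real.pi ≤ 1 - 0.3183 * s := by
    have : 0.3183 * s ≤ s / Real.pi := by
      rw [le_div_iff₀ (by positivity)]
      nlinarith [Real.pi_lt_d4]
    linarith
  have hsq : cotGap s ^ 2 ≤ (s / 3 + s ^ 2 / 25) ^ 2 := pow_le_pow_left₀ hc0 hc 2
  have h3 : (1 - 0.3183 * s) * (1 + 0.12 * s) ^ 2 ≤ 1 := by nlinarith [mul_pos h0 h0]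
  calc (1 - s / Real.pi) * cotGap s ^ 2 ≤ (1 - 0.3183 * s) * (s / 3 + s ^ 2 / 25) ^ 2 := by
        gcongr
        linarith
    _ = s ^ 2 / 9 * ((1 - 0.3183 * s) * (1 + 0.12 * s) ^ 2) := by ring
    _ ≤ s ^ 2 / 9 * 1 := by gcongr
    _ = s ^ 2 / 9 := mul_one _

/-- Splitting of the quadratic correction term into its three parts. -/
lemma correction_sq_le {s φ f f' k T : ℝ} (h0 : 0 < s) (h1 : s ≤ 6 / 5) (hf : 0 ≤ f)
    (hfφ : f ≤ φ) (hff' : f ≤ f') (hk : cotGap s ≤ k * s)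
    (hT : (φ - f) ^ 2 ≤ 2 * (1 - s / Real.pi) * f * (s ^ 2 * T)) :
    ((φ - f) / s + (1 - s / Real.pi) * cotGap s * f) ^ 2 ≤
      2 * ((1 - s / Real.pi) * f) * (k * (φ - f) + s ^ 2 / 18 * f' + T) := by
  have hpi := Real.pi_gt_three
  have hq := one_sub_div_pi_nonneg (s := s) (by linarith)
  have hqc := one_sub_mul_cotGap_sq_le h0 h1
  set q := 1 - s / Real.pi
  have e1 : ((φ - f) / s) ^ 2 ≤ 2 * q * f * T := by
    rw [div_pow, div_le_iff₀ (by positivity)]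
    linarith
  have e2 : 2 * ((φ - f) / s * (q * cotGap s * f)) ≤ 2 * q * f * (k * (φ - f)) := by
    have : (φ - f) / s * (q * cotGap s * f) = (φ - f) * q * f * (cotGap s / s) := by ring
    rw [this]
    have hcs : cotGap s / s ≤ k := by rwa [div_le_iff₀ h0]
    have : (φ - f) * q * f * (cotGap s / s) ≤ (φ - f) * q * f * k :=
      mul_le_mul_of_nonneg_left hcs (mul_nonneg (mul_nonneg (by linarith) hq) hf)
    linarith
  have e3 : (q * cotGap s * f) ^ 2 ≤ 2 * q * f * (s ^ 2 / 18 * f') := by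
    calc (q * cotGap s * f) ^ 2 = q * f * (q * cotGap s ^ 2 * f) := by ring
      _ ≤ q * f * (s ^ 2 / 9 * f') := by gcongr
      _ = _ := by ring
  calc _ = ((φ - f) / s) ^ 2 + 2 * ((φ - f) / s * (q * cotGap s * f)) +
        (q * cotGap s * f) ^ 2 := by ring
    _ ≤ _ := by linarith

lemma integralLe_exp_sub_cos_pow {n m : ℕ} (hnm : n = 2 * m) (hn : 0 < n) {s₁ : ℝ}
    (hs₁ : s₁ ≤ Real.pi / 2) :
    IntegralLe (Set.Ioc 0 s₁) (fun s => Real.exp (-(n * s ^ 2 / 2)) - Real.cos s ^ n)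
      (√(2 * Real.pi / n) / 2 - Real.pi / 2 * cosPowMean m) := by
  have hn' : (0 : ℝ) < n := by exact_mod_cast hn
  have hc1 : Continuous fun s : ℝ => Real.exp (-(n * s ^ 2 / 2)) := by fun_prop
  have hc2 : Continuous fun s : ℝ => Real.cos s ^ n := by fun_prop
  have hI : ∀ {f : ℝ → ℝ}, Continuous f → IntegrableOn f (Set.Ioc 0 (Real.pi / 2)) :=
    fun hf => (hf.integrableOn_Icc).mono_set Set.Ioc_subset_Icc_self
  refine ⟨(hI (hc1.sub hc2)).mono_set (Set.Ioc_subset_Ioc_right hs₁), ?_⟩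
  calc _ ≤ ∫ s in Set.Ioc 0 (Real.pi / 2), (Real.exp (-(n * s ^ 2 / 2)) - Real.cos s ^ n) := by
        refine setIntegral_mono_set (hI (hc1.sub hc2)) ?_
          (Set.Ioc_subset_Ioc_right hs₁).eventuallyLE
        refine (ae_restrict_iff' measurableSet_Ioc).2 (ae_of_all _ fun s hs => ?_)
        exact sub_nonneg.2 (cos_pow_le_exp hs.1.le hs.2)
    _ = (∫ s in Set.Ioc 0 (Real.pi / 2), Real.exp (-(n * s ^ 2 / 2))) -
          Real.pi / 2 * cosPowMean m := by
        rw [integral_sub (hI hc1) (hI hc2), ← integral_cos_pow_even_pi_div_two,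
          intervalIntegral.integral_of_le Real.pi_div_two_pos.le, hnm]
    _ ≤ _ := by
        refine sub_le_sub_right ?_ _
        have h := (integrable_pow_mul_exp_neg_mul_sq (by positivity : (0 : ℝ) < n / 2) 0)
        have h := (IntegralLe.of_Ioi h.integrableOn (fun s _ => by positivity) le_rfl
          (Set.Ioc_subset_Ioi_self : Set.Ioc 0 (Real.pi / 2) ⊆ Set.Ioi 0)).2
        have e1 : ∀ s : ℝ, -((n : ℝ) / 2) * s ^ 2 = -(n * s ^ 2 / 2) := fun s => by ring
        have e2 : Real.pi / ((n : ℝ) / 2) = 2 * Real.pi / n := by field_simp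
        simp only [pow_zero, one_mul, integral_gaussian_Ioi, e2] at h
        simp only [e1] at h
        exact h

lemma two_mul_cosh_sub_two_le {v : ℝ} (hv : 0 ≤ v) :
    Real.exp v + Real.exp (-v) - 2 ≤ v ^ 2 * (5 / 6 + Real.exp v / 6) := by
  have hE : ∀ x : ℝ, HasDerivAt Real.exp (Real.exp x) x := Real.hasDerivAt_exp
  have hN : ∀ x : ℝ, HasDerivAt (fun y => Real.exp (-y)) (-Real.exp (-x)) x := fun x =>
    ((hasDerivAt_neg x).exp).congr_deriv (by ring)
  have h3 : ∀ x : ℝ, HasDerivAt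
      (fun v => 5 / 3 + (v ^ 2 / 6 + 2 * v / 3 + 1 / 3) * Real.exp v - Real.exp v - Real.exp (-v))
      ((x ^ 2 / 6 + x) * Real.exp x + Real.exp (-x)) x := fun x =>
    ((((((((hasDerivAt_pow 2 x).div_const 6).fun_add
      (((hasDerivAt_id' x).const_mul 2).div_const 3)).add_const (1 / 3)).fun_mul
      (hE x)).const_add (5 / 3)).fun_sub (hE x)).fun_sub (hN x)).congr_deriv (by norm_num; ring)
  have h2 : ∀ x : ℝ, HasDerivAt
      (fun v => 5 / 3 * v + (v ^ 2 / 6 + v / 3) * Real.exp v - Real.exp v + Real.exp (-v))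
      (5 / 3 + (x ^ 2 / 6 + 2 * x / 3 + 1 / 3) * Real.exp x - Real.exp x - Real.exp (-x)) x :=
    fun x => ((((((hasDerivAt_id' x).const_mul (5 / 3)).fun_add
      ((((hasDerivAt_pow 2 x).div_const 6).fun_add ((hasDerivAt_id' x).div_const 3)).fun_mul
      (hE x))).fun_sub (hE x)).fun_add (hN x))).congr_deriv (by norm_num; ring)
  have h1 : ∀ x : ℝ, HasDerivAt
      (fun v => v ^ 2 * (5 / 6 + Real.exp v / 6) - (Real.exp v + Real.exp (-v) - 2))
      (5 / 3 * x + (x ^ 2 / 6 + x / 3) * Real.exp x - Real.exp x + Real.exp (-x)) x :=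
    fun x => (((hasDerivAt_pow 2 x).fun_mul (((hE x).div_const 6).const_add (5 / 6))).fun_sub
      (((hE x).fun_add (hN x)).sub_const 2)).congr_deriv (by norm_num; ring)
  have p3 : ∀ x, 0 ≤ x → x ≤ v → 0 ≤ (x ^ 2 / 6 + x) * Real.exp x + Real.exp (-x) :=
    fun x hx _ => by positivity
  have p2 : ∀ x, 0 ≤ x → x ≤ v → 0 ≤ 5 / 3 + (x ^ 2 / 6 + 2 * x / 3 + 1 / 3) * Real.exp x -
      Real.exp x - Real.exp (-x) := fun x hx hxv =>
    nonneg_of_deriv_nonneg_of_zero (by norm_num) h3 p3 hx hxv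
  have p1 : ∀ x, 0 ≤ x → x ≤ v → 0 ≤ 5 / 3 * x + (x ^ 2 / 6 + x / 3) * Real.exp x - Real.exp x +
      Real.exp (-x) := fun x hx hxv =>
    nonneg_of_deriv_nonneg_of_zero (by norm_num) h2 p2 hx hxv
  have := nonneg_of_deriv_nonneg_of_zero (by norm_num) h1 p1 hv le_rfl
  linarith

/-- `(φ - f)² / (φ f)` is at most `2 cosh v - 2` when `1 ≤ φ / f ≤ exp v`. -/
lemma sub_sq_le_of_le_mul_exp {φ f v : ℝ} (hf : 0 < f) (hfφ : f ≤ φ) (hφ : φ ≤ f * Real.exp v) :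
    (φ - f) ^ 2 ≤ f * φ * (Real.exp v + Real.exp (-v) - 2) := by
  rw [Real.exp_neg]
  set K := Real.exp v
  have hK : 0 < K := Real.exp_pos v
  have key : 0 ≤ (f * K - φ) * (φ * K - f) := by
    refine mul_nonneg (by linarith) ?_
    have h1 : 1 ≤ K := by
      by_contra h
      push Not at h
      nlinarith
    nlinarith
  have : f * φ * (K + K⁻¹ - 2) - (φ - f) ^ 2 = (f * K - φ) * (φ * K - f) / K := by
    field_simp
    ring
  have := div_nonneg key hK.le
  linarith

lemma exp_neg_le_cos {s : ℝ} (h0 : 0 ≤ s) (h1 : s ≤ 1) :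
    Real.exp (-(s ^ 2 / 2 + 0.12 * s ^ 4)) ≤ Real.cos s := by
  have hc := cos_lower_six h0
  have he := exp_neg_upper_four (z := s ^ 2 / 2 + 0.12 * s ^ 4) (by positivity)
  refine he.trans (le_trans ?_ hc)
  have hw1 : s ^ 2 ≤ 1 := pow_le_one₀ h0 h1
  have hw0 := sq_nonneg s
  have e4 : s ^ 4 = (s ^ 2) ^ 2 := by ring
  have e6 : s ^ 6 = (s ^ 2) ^ 3 := by ring
  rw [e4, e6]
  generalize s ^ 2 = w at *
  have key : 0 ≤ w ^ 2 * (1 / 24 + 0.12 - (1 / 2 + 0.12 * w) ^ 2 / 2 +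
      w * (1 / 2 + 0.12 * w) ^ 3 / 6 - w ^ 2 * (1 / 2 + 0.12 * w) ^ 4 / 24 - w / 720) := by
    refine mul_nonneg (sq_nonneg w) ?_
    have b1 : (1 / 2 + 0.12 * w) ^ 2 ≤ 1 / 4 + 0.12 * w + 0.0144 * w := by nlinarith
    have b3 : 1 / 8 + 0.09 * w ≤ (1 / 2 + 0.12 * w) ^ 3 := by
      nlinarith [pow_nonneg hw0 3]
    have b4 : (1 / 2 + 0.12 * w) ^ 4 ≤ 0.0625 + 0.0853 * w := by
      have := pow_le_pow_left₀ (by positivity) b1 2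
      nlinarith
    nlinarith [mul_le_mul_of_nonneg_left b3 hw0, mul_le_mul_of_nonneg_left b4 (sq_nonneg w)]
  nlinarith

lemma one_div_pi_le : 1 / Real.pi ≤ 0.31832 := by
  rw [div_le_iff₀ Real.pi_pos]
  nlinarith [Real.pi_gt_d6]

lemma sqrt_const_div_le {a b : ℝ} (n : ℝ) (hb : 0 ≤ b) (h : a ≤ b ^ 2) (hn : 0 ≤ n) :
    √(a / n) ≤ b / √n := by
  rw [Real.sqrt_div' _ hn]
  gcongr
  exact (Real.sqrt_le_sqrt h).trans_eq (Real.sqrt_sq hb)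

lemma sub_sq_le_sextic {s : ℝ} {n : ℕ} (h0 : 0 < s) (h1 : s ≤ 1) :
    (Real.exp (-(n * s ^ 2 / 2)) - Real.cos s ^ n) ^ 2 ≤
      2 * (1 - s / Real.pi) * Real.cos s ^ n * (s ^ 2 * (0.01057 * n ^ 2 *
        (5 / 6 * (s ^ 6 * Real.exp (-(n / 2) * s ^ 2)) +
          1 / 6 * (s ^ 6 * Real.exp (-(0.38 * n) * s ^ 2))))) := by
  have hpi := Real.pi_gt_d4
  have hc : 0 < Real.cos s := Real.cos_pos_of_mem_Ioo ⟨by linarith, by linarith⟩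
  have hf : 0 < Real.cos s ^ n := pow_pos hc n
  have hfφ : Real.cos s ^ n ≤ Real.exp (-(n * s ^ 2 / 2)) := cos_pow_le_exp h0.le (by linarith)
  set v := 0.12 * n * s ^ 4 with hv
  have hv0 : 0 ≤ v := by positivity
  have hφ : Real.exp (-(n * s ^ 2 / 2)) ≤ Real.cos s ^ n * Real.exp v := by
    have h := pow_le_pow_left₀ (Real.exp_pos _).le (exp_neg_le_cos h0.le h1) n
    rw [← Real.exp_nat_mul] at h
    have h' := mul_le_mul_of_nonneg_right h (Real.exp_pos v).le
    rw [← Real.exp_add] at h'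
    refine le_trans (le_of_eq ?_) h'
    congr 1
    rw [hv]
    ring
  have hs := sub_sq_le_of_le_mul_exp hf hfφ hφ
  have hcosh := two_mul_cosh_sub_two_le hv0
  have hev : Real.exp (-(n * s ^ 2 / 2)) * Real.exp v ≤ Real.exp (-(0.38 * n) * s ^ 2) := by
    rw [← Real.exp_add]
    refine Real.exp_le_exp.2 ?_
    rw [hv]
    have : s ^ 4 ≤ s ^ 2 := by nlinarith [sq_nonneg s, pow_le_one₀ h0.le h1 (n := 2)]
    nlinarith [(n.cast_nonneg : (0 : ℝ) ≤ n)]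
  rw [show -((n : ℝ) / 2) * s ^ 2 = -(n * s ^ 2 / 2) by ring]
  set φ := Real.exp (-(n * s ^ 2 / 2))
  set ψ := Real.exp (-(0.38 * n) * s ^ 2)
  set f := Real.cos s ^ n
  have hφ0 : 0 < φ := Real.exp_pos _
  have hq : 0.6816 ≤ 1 - s / Real.pi := by
    have : s / Real.pi ≤ 0.3184 := by
      rw [div_le_iff₀ (by positivity)]
      linarith
    linarith
  calc (φ - f) ^ 2 ≤ f * φ * (Real.exp v + Real.exp (-v) - 2) := hs
    _ ≤ f * φ * (v ^ 2 * (5 / 6 + Real.exp v / 6)) := by gcongr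
    _ = f * v ^ 2 * (5 / 6 * φ + 1 / 6 * (φ * Real.exp v)) := by ring
    _ ≤ f * v ^ 2 * (5 / 6 * φ + 1 / 6 * ψ) := by gcongr
    _ = 0.0144 * (f * (n ^ 2 * s ^ 8) * (5 / 6 * φ + 1 / 6 * ψ)) := by rw [hv]; ring
    _ ≤ (2 * 0.6816 * 0.01057) * (f * (n ^ 2 * s ^ 8) * (5 / 6 * φ + 1 / 6 * ψ)) := by
        have : 0 ≤ f * (n ^ 2 * s ^ 8) * (5 / 6 * φ + 1 / 6 * ψ) := by positivity
        refine mul_le_mul_of_nonneg_right (by norm_num) this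
    _ ≤ (2 * (1 - s / Real.pi) * 0.01057) * (f * (n ^ 2 * s ^ 8) * (5 / 6 * φ + 1 / 6 * ψ)) := by
        have : 0 ≤ f * (n ^ 2 * s ^ 8) * (5 / 6 * φ + 1 / 6 * ψ) := by positivity
        refine mul_le_mul_of_nonneg_right ?_ this
        linarith
    _ = _ := by ring

lemma cosPowMean_div_two_le {n m : ℕ} (hnm : n = 2 * m) (hn : 8 ≤ n) :
    cosPowMean m / 2 ≤ (0.39895 - 0.0938 / n) / √n := by
  have hn' : (8 : ℝ) ≤ n := by exact_mod_cast hn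
  have h := cosPowMean_sq_le m
  have hm : (m : ℝ) = n / 2 := by
    rw [hnm]
    push_cast
    ring
  have hpi := one_div_pi_le
  have hu : 0.0938 / (n : ℝ) ≤ 0.0118 := by
    rw [div_le_iff₀ (by linarith)]
    linarith
  have ha := cosPowMean_pos m
  refine le_of_sq_le_sq ?_ (div_nonneg (by linarith) (Real.sqrt_nonneg _))
  rw [hm] at h
  rw [div_pow, div_pow, Real.sq_sqrt (by positivity)]
  have h1 : cosPowMean m ^ 2 ≤ 0.31832 / (n / 2 + 1 / 4) := by
    rw [le_div_iff₀ (by positivity)]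
    linarith
  have h2 : 0.31832 / ((n : ℝ) / 2 + 1 / 4) / 2 ^ 2 ≤ (0.39895 - 0.0938 / (n : ℝ)) ^ 2 / n := by
    rw [show (0.31832 / ((n : ℝ) / 2 + 1 / 4) / 2 ^ 2) = 0.15916 / (n + 1 / 2) by
      field_simp; ring, div_le_div_iff₀ (by positivity) (by positivity)]
    have : (0.39895 - 0.0938 / (n : ℝ)) ^ 2 = (0.39895 * n - 0.0938) ^ 2 / n ^ 2 := by
      field_simp
    rw [this, div_mul_eq_mul_div, le_div_iff₀ (by positivity)]
    nlinarith [mul_nonneg (by linarith : (0:ℝ) ≤ n - 8) (by linarith : (0:ℝ) ≤ n)]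
  refine le_trans ?_ h2
  gcongr

lemma exp_neg_four_le : Real.exp (-4) ≤ 0.01832 := by
  rw [show (-4 : ℝ) = -((4 : ℕ) * 1 : ℝ) by norm_num, Real.exp_neg, Real.exp_nat_mul,
    inv_le_comm₀ (by positivity) (by norm_num)]
  have h := Real.exp_one_gt_d9
  have := pow_le_pow_left₀ (by norm_num) h.le 4
  refine le_trans ?_ this
  norm_num

lemma gaussian_tail_at_one_le {n : ℝ} (hn : 8 ≤ n) :
    1 / Real.pi * (Real.exp (-(n * 1 ^ 2 / 2)) * (n * 1 ^ 2 / 2 + 1) /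
      (2 * (n * 1 ^ 2 / 2) * (n * 1 ^ 2 / 2 + 2))) ≤ 0.0021 / √n := by
  have hp := one_div_pi_le
  have hnpos : 0 < n := by linarith
  have hr2 : √n ^ 2 = n := Real.sq_sqrt hnpos.le
  have hr0 : 0 < √n := Real.sqrt_pos.2 hnpos
  have he : Real.exp (-(n * 1 ^ 2 / 2)) ≤ 0.01832 :=
    (Real.exp_le_exp.2 (by linarith)).trans exp_neg_four_le
  have h1 : (n * 1 ^ 2 / 2 + 1) / (2 * (n * 1 ^ 2 / 2) * (n * 1 ^ 2 / 2 + 2)) ≤ 1 / n := by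
    rw [div_le_div_iff₀ (by positivity) hnpos]
    nlinarith
  have hr28 : 2.82 ≤ √n := Real.le_sqrt_of_sq_le (by linarith)
  have h2 : 1 / n ≤ 0.3547 / √n := by
    rw [div_le_div_iff₀ hnpos hr0]
    nlinarith
  have h3 := h1.trans h2
  rw [mul_div_assoc]
  calc _ ≤ 0.31832 * (0.01832 * (0.3547 / √n)) :=
        mul_le_mul hp (mul_le_mul he h3 (by positivity) (by norm_num)) (by positivity) (by norm_num)
    _ = (0.31832 * 0.01832 * 0.3547) / √n := by ring
    _ ≤ 0.0021 / √n := by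
        gcongr
        norm_num

lemma reflected_error_le {n : ℝ} (hn : 8 ≤ n) :
    1 / (4 * Real.pi ^ 2 * n ^ 2) ≤ 0.00114 / √n := by
  have hpi := Real.pi_gt_d4
  have hr2 : √n ^ 2 = n := Real.sq_sqrt (by linarith)
  have hr28 : 2.828 ≤ √n := Real.le_sqrt_of_sq_le (by linarith)
  have h1 : 39.4 ≤ 4 * Real.pi ^ 2 := by nlinarith
  have h22 : 22.6 * √n ≤ n ^ 2 := by
    have h3 : 22.6 ≤ √n ^ 3 := by
      have := pow_le_pow_left₀ (by norm_num) hr28 3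
      norm_num at this ⊢
      linarith
    have h4 : n ^ 2 = √n ^ 3 * √n := by
      rw [← hr2]
      simp only [Real.sqrt_sq (Real.sqrt_nonneg n)]
      ring
    rw [h4]
    exact mul_le_mul_of_nonneg_right h3 (Real.sqrt_nonneg n)
  rw [div_le_div_iff₀ (by positivity) (by linarith)]
  have := mul_le_mul h1 h22 (by positivity) (by positivity)
  linarith

set_option maxHeartbeats 1000000 in
/-- The bound for `n ≥ 8` summands with third absolute moment close to `1`. -/
lemma cdf_sub_le_of_eight_le (μ : Measure ℝ) [IsProbabilityMeasure μ]
    (hμ : Integrable (fun y => y) μ) (g : ℝ → ℝ) (hg : Continuous g) {n m : ℕ}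
    (hnm : n = 2 * m) (hn8 : 8 ≤ n)
    (hcos : ∀ t, ∫ y, Real.cos (t * y) ∂μ = g (t / √n) ^ n)
    (hsin : ∀ t, ∫ y, Real.sin (t * y) ∂μ = 0) {δ : ℝ} (hδ0 : 0 ≤ δ) (hδ : δ ≤ 0.38)
    (hlo : ∀ s, 0 < s → s ≤ Real.pi → Real.cos s ≤ g s)
    (hup : ∀ s, 0 < s → g s ≤ Real.cos s + δ / 6 * s ^ 3) (x : ℝ) :
    μ.real (Set.Iic x) - stdNormalCDF x ≤ 0.409 * (1 + δ) / √n := by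
  have hpi := Real.pi_gt_d4
  have hpi' := Real.pi_lt_d4
  have hn0 : (8 : ℝ) ≤ n := by exact_mod_cast hn8
  have hnpos : (0 : ℝ) < n := by linarith
  set R₁ : ℝ → ℝ := fun s => Real.exp (-(n * s ^ 2 / 2)) - Real.cos s ^ n with hR₁
  set R₂ : ℝ → ℝ := fun s => s ^ 2 * Real.exp (-((n : ℝ) / 2) * s ^ 2) with hR₂
  set R₃ : ℝ → ℝ := fun s => s ^ 6 * Real.exp (-((n : ℝ) / 2) * s ^ 2) with hR₃
  set R₄ : ℝ → ℝ := fun s => s ^ 6 * Real.exp (-(0.38 * (n : ℝ)) * s ^ 2) with hR₄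
  have b1 : IntegralLe (Set.Ioc 0 1) R₁ _ :=
    integralLe_exp_sub_cos_pow hnm (by omega) (by linarith)
  have b2 : IntegralLe (Set.Ioc 0 1) R₂ _ := IntegralLe.of_Ioi
    (integrable_pow_mul_exp_neg_mul_sq (by positivity : (0 : ℝ) < n / 2) 2).integrableOn
    (fun s _ => by positivity) le_rfl Set.Ioc_subset_Ioi_self
  have b3 : IntegralLe (Set.Ioc 0 1) R₃ _ := IntegralLe.of_Ioi
    (integrable_pow_mul_exp_neg_mul_sq (by positivity : (0 : ℝ) < n / 2) 6).integrableOn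
    (fun s _ => by positivity) le_rfl Set.Ioc_subset_Ioi_self
  have b4 : IntegralLe (Set.Ioc 0 1) R₄ _ := IntegralLe.of_Ioi
    (integrable_pow_mul_exp_neg_mul_sq (by positivity : (0 : ℝ) < 0.38 * n) 6).integrableOn
    (fun s _ => by positivity) le_rfl Set.Ioc_subset_Ioi_self
  rw [integral_sq_mul_exp_neg_mul_sq (by positivity)] at b2
  rw [integral_pow_six_mul_exp_neg_mul_sq (by positivity)] at b3 b4
  set r := √(n : ℝ) with hr
  have hr2 : r ^ 2 = n := Real.sq_sqrt hnpos.le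
  have hr0 : 0 < r := Real.sqrt_pos.2 hnpos
  have q1 : √(2 * Real.pi / n) ≤ 2.50665 / r :=
    sqrt_const_div_le _ (by norm_num) (by nlinarith [Real.pi_lt_d6]) hnpos.le
  have q2 : √(Real.pi / ((n : ℝ) / 2)) ≤ 2.50665 / r := by
    rw [show Real.pi / ((n : ℝ) / 2) = 2 * Real.pi / n by field_simp]
    exact q1
  have q3 : √(Real.pi / (0.38 * (n : ℝ))) ≤ 2.876 / r := by
    rw [show Real.pi / (0.38 * (n : ℝ)) = Real.pi / 0.38 / n by field_simp]
    refine sqrt_const_div_le _ (by norm_num) ?_ hnpos.le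
    rw [div_le_iff₀ (by norm_num)]
    linarith
  set IR := 0.375 * (√(2 * Real.pi / n) / 2 - Real.pi / 2 * cosPowMean m) +
    1 / 18 * (1.2534 / (n * r)) + 0.01057 * (23.87 / (n * r)) with hIR
  have hmain := cdf_sub_le_of_near_rademacher μ hμ g hg hnm (by omega) hcos hsin hδ0 hδ hlo hup
    (s₁ := 1) (I := IR) one_pos (by linarith)
    (fun s => 0.375 * R₁ s + (1 / 18 * R₂ s + 0.01057 * n ^ 2 * (5 / 6 * R₃ s + 1 / 6 * R₄ s)))
    ?_ ?_ x
  · refine hmain.trans ?_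
    have hA := cosPowMean_div_two_le hnm hn8
    have hp := one_div_pi_le
    have htail := gaussian_tail_at_one_le hn0
    have hend := reflected_error_le hn0
    have hIRle : cosPowMean m / 2 + 1 / Real.pi * IR ≤
        0.625 * ((0.39895 - 0.0938 / n) / r) + 0.375 * (0.39897 / r) + 0.1026 / (n * r) := by
      have e1 : 1 / Real.pi * IR = 0.375 * (1 / Real.pi * (√(2 * Real.pi / n) / 2)) -
          0.375 * (cosPowMean m / 2) + 1 / Real.pi * ((1.2534 / 18 + 0.01057 * 23.87) / (n * r)) := by
        rw [hIR]
        field_simp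
        ring
      have e2 : 1 / Real.pi * (√(2 * Real.pi / n) / 2) ≤ 0.39897 / r := by
        calc _ ≤ 0.31832 * (2.50665 / r / 2) := by gcongr
          _ = (0.31832 * 2.50665 / 2) / r := by ring
          _ ≤ _ := by
            gcongr
            norm_num
      have e3 : 1 / Real.pi * ((1.2534 / 18 + 0.01057 * 23.87) / (n * r)) ≤ 0.1026 / (n * r) := by
        calc _ ≤ 0.31832 * ((1.2534 / 18 + 0.01057 * 23.87) / (n * r)) := by gcongr
          _ = (0.31832 * (1.2534 / 18 + 0.01057 * 23.87)) / (n * r) := by ring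
          _ ≤ _ := by
            gcongr
            norm_num
      rw [e1]
      linarith
    have hfin : 0.625 * ((0.39895 - 0.0938 / (n : ℝ)) / r) + 0.375 * (0.39897 / r) +
        0.1026 / (n * r) ≤ 0.40576 / r := by
      have : 0.625 * ((0.39895 - 0.0938 / (n : ℝ)) / r) + 0.375 * (0.39897 / r) +
        0.1026 / (n * r) = (0.625 * 0.39895 + 0.375 * 0.39897 + (0.1026 - 0.625 * 0.0938) / n) / r := by
        field_simp
        ring
      rw [this]
      gcongr
      have : (0.1026 - 0.625 * 0.0938) / (n : ℝ) ≤ (0.1026 - 0.625 * 0.0938) / 8 := by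
        gcongr
      norm_num at this ⊢
      linarith
    have hδe : 0.409 * (1 + δ) / r = 0.409 / r + 0.409 * δ / r := by ring
    have hs : 0.40576 / r + 0.0021 / r + 0.00114 / r = 0.409 / r := by ring
    rw [hδe]
    linarith
  · intro s h0 h1
    have hc0 : 0 ≤ Real.cos s := (Real.cos_pos_of_mem_Ioo ⟨by linarith, by linarith⟩).le
    have hfφ : Real.cos s ^ n ≤ Real.exp (-(n * s ^ 2 / 2)) := cos_pow_le_exp h0.le (by linarith)
    have hk : cotGap s ≤ 0.375 * s := by
      have := cotGap_le_quadratic h0 (by linarith)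
      nlinarith
    refine ⟨?_, ?_⟩
    · have : 0 ≤ R₁ s := sub_nonneg.2 hfφ
      positivity
    · have hsq := correction_sq_le h0 (by linarith) (pow_nonneg hc0 n) hfφ hfφ hk
        (sub_sq_le_sextic h0 h1)
      refine hsq.trans_eq ?_
      simp only [hR₁, hR₂, hR₃, hR₄]
      rw [show -((n : ℝ) / 2) * s ^ 2 = -(n * s ^ 2 / 2) by ring]
      ring
  · refine ((b1.const_mul (by norm_num)).add ((b2.const_mul (by norm_num)).add
      (((b3.const_mul (by norm_num)).add (b4.const_mul (by norm_num))).const_mul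
        (by positivity)))).trans ?_
    have c2 : √(Real.pi / ((n : ℝ) / 2)) / (4 * ((n : ℝ) / 2)) ≤ 1.2534 / (n * r) := by
      calc _ ≤ 2.50665 / r / (4 * ((n : ℝ) / 2)) := by gcongr
        _ = (2.50665 / 2) / (n * r) := by
          field_simp
          norm_num
        _ ≤ _ := by
          gcongr
          norm_num
    have c34 : (n : ℝ) ^ 2 * (5 / 6 * (15 * √(Real.pi / ((n : ℝ) / 2)) / (16 * ((n : ℝ) / 2) ^ 3)) +
        1 / 6 * (15 * √(Real.pi / (0.38 * (n : ℝ))) / (16 * (0.38 * n) ^ 3))) ≤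
          23.87 / (n * r) := by
      calc _ ≤ (n : ℝ) ^ 2 * (5 / 6 * (15 * (2.50665 / r) / (16 * ((n : ℝ) / 2) ^ 3)) +
            1 / 6 * (15 * (2.876 / r) / (16 * (0.38 * n) ^ 3))) := by gcongr
        _ = (5 / 6 * (15 * 2.50665 * 8 / 16) + 1 / 6 * (15 * 2.876 / (16 * 0.38 ^ 3))) /
            (n * r) := by
            field_simp
            norm_num
        _ ≤ _ := by
          gcongr
          norm_num
    rw [hIR]
    linarith

lemma exp_neg_upper_six {z : ℝ} (hz : 0 ≤ z) :
    Real.exp (-z) ≤ 1 - z + z ^ 2 / 2 - z ^ 3 / 6 + z ^ 4 / 24 - z ^ 5 / 120 + z ^ 6 / 720 := by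
  have h := exp_neg_taylor_alternating 7 hz
  simp [Finset.sum_range_succ, Nat.factorial] at h
  norm_num at h
  nlinarith

lemma exp_neg_sq_sub_cos_sq_le {s : ℝ} (h0 : 0 ≤ s) (h1 : s ≤ 6 / 5) :
    Real.exp (-s ^ 2) - Real.cos s ^ 2 ≤ s ^ 4 * Real.cos s * (1 / 6 - 0.01 * s ^ 2) := by
  have hL := cos_lower_six h0
  have he := exp_neg_upper_six (sq_nonneg s)
  set C := Real.cos s
  obtain ⟨w, hw⟩ : ∃ w, w = s ^ 2 := ⟨_, rfl⟩
  have hw0 : 0 ≤ w := by rw [hw]; positivity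
  have hw1 : w ≤ 1.44 := by rw [hw]; nlinarith
  have e4 : s ^ 4 = w ^ 2 := by rw [hw]; ring
  have e6 : s ^ 6 = w ^ 3 := by rw [hw]; ring
  rw [e4, e6, ← hw] at hL
  rw [← hw] at he
  rw [e4, ← hw]
  set L := 1 - w / 2 + w ^ 2 / 24 - w ^ 3 / 720 with hLdef
  have hL0 : 0 ≤ L := by
    rw [hLdef]
    nlinarith [mul_nonneg hw0 (sub_nonneg.2 hw1), mul_nonneg (sq_nonneg w) (sub_nonneg.2 hw1)]
  have hmono : L ^ 2 + w ^ 2 * L * (1 / 6 - 0.01 * w) ≤ C ^ 2 + w ^ 2 * C * (1 / 6 - 0.01 * w) := by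
    have : 0 ≤ 1 / 6 - 0.01 * w := by linarith
    gcongr
  have hpoly : 1 - w + w ^ 2 / 2 - w ^ 3 / 6 + w ^ 4 / 24 - w ^ 5 / 120 + w ^ 6 / 720 ≤
      L ^ 2 + w ^ 2 * L * (1 / 6 - 0.01 * w) := by
    have key : 0 ≤ 13 / 450 - 383 / 14400 * w + 109 / 14400 * w ^ 2 - 3559 / 2592000 * w ^ 3 := by
      nlinarith [mul_nonneg hw0 (sub_nonneg.2 hw1), mul_nonneg (sq_nonneg w) (sub_nonneg.2 hw1)]
    have := mul_nonneg (pow_nonneg hw0 3) key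
    rw [hLdef]
    linarith
  linarith

lemma exp_neg_sq_sub_cos_sq_le_poly {s : ℝ} (h0 : 0 ≤ s) (h1 : s ≤ 6 / 5) :
    Real.exp (-s ^ 2) - Real.cos s ^ 2 ≤ s ^ 4 * (1 / 6 - 0.077 * s ^ 2) := by
  have hL := cos_lower_six h0
  have he := exp_neg_upper_six (sq_nonneg s)
  set C := Real.cos s
  obtain ⟨w, hw⟩ : ∃ w, w = s ^ 2 := ⟨_, rfl⟩
  have hw0 : 0 ≤ w := by rw [hw]; positivity
  have hw1 : w ≤ 1.44 := by rw [hw]; nlinarith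
  have e4 : s ^ 4 = w ^ 2 := by rw [hw]; ring
  have e6 : s ^ 6 = w ^ 3 := by rw [hw]; ring
  rw [e4, e6, ← hw] at hL
  rw [← hw] at he
  rw [e4, ← hw]
  set L := 1 - w / 2 + w ^ 2 / 24 - w ^ 3 / 720 with hLdef
  have hL0 : 0 ≤ L := by
    rw [hLdef]
    nlinarith [mul_nonneg hw0 (sub_nonneg.2 hw1), mul_nonneg (sq_nonneg w) (sub_nonneg.2 hw1)]
  have hmono : L ^ 2 ≤ C ^ 2 := by gcongr
  have key : 0 ≤ 407 / 9000 - 37 / 960 * w + 71 / 8640 * w ^ 2 - 719 / 518400 * w ^ 3 := by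
    nlinarith [mul_nonneg hw0 (sub_nonneg.2 hw1), mul_nonneg (sq_nonneg w) (sub_nonneg.2 hw1)]
  have := mul_nonneg (pow_nonneg hw0 3) key
  rw [hLdef] at hmono
  linarith

lemma exp_neg_sq_add_cos_sq_le {s : ℝ} (h0 : 0 ≤ s) (h1 : s ≤ 6 / 5) :
    Real.exp (-s ^ 2) + Real.cos s ^ 2 ≤ Real.cos s * (2 - 0.66 * s ^ 2) := by
  have hL := cos_lower_six h0
  have hU := cos_upper_four h0
  have he := exp_neg_upper_six (sq_nonneg s)
  set C := Real.cos s
  obtain ⟨w, hw⟩ : ∃ w, w = s ^ 2 := ⟨_, rfl⟩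
  have hw0 : 0 ≤ w := by rw [hw]; positivity
  have hw1 : w ≤ 1.44 := by rw [hw]; nlinarith
  have e4 : s ^ 4 = w ^ 2 := by rw [hw]; ring
  have e6 : s ^ 6 = w ^ 3 := by rw [hw]; ring
  rw [e4, e6, ← hw] at hL
  rw [e4, ← hw] at hU
  rw [← hw] at he
  rw [← hw]
  set L := 1 - w / 2 + w ^ 2 / 24 - w ^ 3 / 720 with hLdef
  have hQ : 0 ≤ 2 - 0.66 * w - C - L := by
    nlinarith [mul_nonneg hw0 (sub_nonneg.2 hw1), pow_nonneg hw0 3]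
  have hmono := mul_nonneg (sub_nonneg.2 hL) hQ
  have key : 0 ≤ 17 / 50 - 21 / 50 * w + 217 / 1200 * w ^ 2 - 351 / 8000 * w ^ 3 +
      73 / 8640 * w ^ 4 - 721 / 518400 * w ^ 5 := by
    have h5 : 0 ≤ w ^ 4 * (1.44 - w) := mul_nonneg (by positivity) (by linarith)
    have h4 : 0 ≤ w ^ 2 * (1.44 - w) := mul_nonneg (by positivity) (by linarith)
    have h3 : 0 ≤ w ^ 2 * (1.44 - w) ^ 2 := mul_nonneg (by positivity) (by positivity)
    nlinarith [mul_nonneg hw0 (sub_nonneg.2 hw1), sq_nonneg (1.44 - w), mul_nonneg (mul_nonneg hw0 (sub_nonneg.2 hw1)) (sub_nonneg.2 hw1)]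
  have := mul_nonneg hw0 key
  rw [hLdef] at hmono
  nlinarith

lemma integralLe_const_mul_pow (c : ℝ) (k : ℕ) {a : ℝ} (ha : 0 ≤ a) :
    IntegralLe (Set.Ioc 0 a) (fun s => c * s ^ k) (c * (a ^ (k + 1) / (k + 1))) := by
  refine ⟨(Continuous.integrableOn_Icc (by fun_prop)).mono_set Set.Ioc_subset_Icc_self, ?_⟩
  rw [← intervalIntegral.integral_of_le ha]
  simp

lemma one_div_one_sub_div_pi_le {s : ℝ} (h0 : 0 ≤ s) (h1 : s ≤ 6 / 5) :
    1 ≤ (1 - s / Real.pi) * (1 + 0.5152 * s) := by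
  have hpi := Real.pi_gt_d4
  have : s / Real.pi ≤ 0.31832 * s := by
    have := mul_le_mul_of_nonneg_left one_div_pi_le h0
    rw [mul_one_div] at this
    linarith
  nlinarith

lemma exp_neg_one_point_four_four_le : Real.exp (-1.44) ≤ 0.237 := by
  have h := exp_neg_upper_six (z := 0.72) (by norm_num)
  have h2 := pow_le_pow_left₀ (Real.exp_pos _).le h 2
  rw [← Real.exp_nat_mul] at h2
  norm_num at h2 ⊢
  linarith

lemma exp_neg_two_point_eight_eight_le : Real.exp (-2.88) ≤ 0.0562 := by
  have h2 := pow_le_pow_left₀ (Real.exp_pos _).le exp_neg_one_point_four_four_le 2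
  rw [← Real.exp_nat_mul] at h2
  norm_num at h2 ⊢
  linarith

set_option maxHeartbeats 1000000 in
/-- The bound for two summands with third absolute moment close to `1`. -/
lemma cdf_sub_le_of_eq_two (μ : Measure ℝ) [IsProbabilityMeasure μ]
    (hμ : Integrable (fun y => y) μ) (g : ℝ → ℝ) (hg : Continuous g) {n : ℕ} (hn : n = 2)
    (hcos : ∀ t, ∫ y, Real.cos (t * y) ∂μ = g (t / √n) ^ n)
    (hsin : ∀ t, ∫ y, Real.sin (t * y) ∂μ = 0) {δ : ℝ} (hδ0 : 0 ≤ δ) (hδ : δ ≤ 0.38)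
    (hlo : ∀ s, 0 < s → s ≤ Real.pi → Real.cos s ≤ g s)
    (hup : ∀ s, 0 < s → g s ≤ Real.cos s + δ / 6 * s ^ 3) (x : ℝ) :
    μ.real (Set.Iic x) - stdNormalCDF x ≤ 0.409 * (1 + δ) / √n := by
  have hpi := Real.pi_gt_d4
  have hn2 : (n : ℝ) = 2 := by exact_mod_cast hn
  have hmain := cdf_sub_le_of_near_rademacher μ hμ g hg (m := 1) (by omega) (by omega) hcos hsin
    hδ0 hδ hlo hup (s₁ := 6 / 5) (I := 0.0396) (by norm_num) (by linarith)
    (fun s => 1 / 18 * s ^ 2 + (1 / 150 * s ^ 5 +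
      ((-0.077 / 3 + 1 / 54 + 1 / 72) * s ^ 6 + ((-0.077 / 25 + 0.5152 / 72) * s ^ 7 +
      (-0.00159 * s ^ 8 + -0.00159 * 0.5152 * s ^ 9)))))
    ?_ ?_ x
  · refine hmain.trans ?_
    have hA : cosPowMean 1 = 1 / 2 := by
      rw [cosPowMean_succ]
      norm_num [cosPowMean]
    have hp := one_div_pi_le
    have hp0 : 0 < 1 / Real.pi := by positivity
    have hp2 : (1 / Real.pi) ^ 2 ≤ 0.31832 ^ 2 := by gcongr
    have he := exp_neg_one_point_four_four_le
    have hr : 0.2892 ≤ 0.409 / √(n : ℝ) := by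
      rw [hn2, le_div_iff₀ (by positivity)]
      nlinarith [Real.sqrt_nonneg 2, Real.sq_sqrt (zero_le_two (α := ℝ))]
    have hend : 1 / (4 * Real.pi ^ 2 * (n : ℝ) ^ 2) = (1 / Real.pi) ^ 2 / 16 := by
      rw [hn2]
      field_simp
      norm_num
    have htail : Real.exp (-((n : ℝ) * (6 / 5) ^ 2 / 2)) * ((n : ℝ) * (6 / 5) ^ 2 / 2 + 1) /
        (2 * ((n : ℝ) * (6 / 5) ^ 2 / 2) * ((n : ℝ) * (6 / 5) ^ 2 / 2 + 2)) ≤ 0.0585 := by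
      rw [hn2, show -((2 : ℝ) * (6 / 5) ^ 2 / 2) = -1.44 by norm_num, div_le_iff₀ (by norm_num)]
      norm_num at he ⊢
      linarith
    have htail' := mul_le_mul_of_nonneg_left htail hp0.le
    rw [hA, hend]
    have : 0.409 * (1 + δ) / √(n : ℝ) = 0.409 / √n + 0.409 * δ / √n := by ring
    rw [this]
    nlinarith
  · intro s h0 h1
    have hc0 : 0 ≤ Real.cos s := (Real.cos_pos_of_mem_Ioo ⟨by linarith, by linarith⟩).le
    have hfφ : Real.cos s ^ n ≤ Real.exp (-(n * s ^ 2 / 2)) := cos_pow_le_exp h0.le (by linarith)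
    have hk : cotGap s ≤ (1 / 3 + s / 25) * s := by
      have := cotGap_le_quadratic h0 h1
      nlinarith
    have hD := exp_neg_sq_sub_cos_sq_le h0.le h1
    have hD' := exp_neg_sq_sub_cos_sq_le_poly h0.le h1
    rw [show -((n : ℝ) * s ^ 2 / 2) = -s ^ 2 by rw [hn2]; ring, hn] at hfφ ⊢
    have hq := one_div_one_sub_div_pi_le h0.le h1
    have hU : Real.cos s ^ 2 ≤ 1 - s ^ 2 + s ^ 4 / 3 := by
      have h4 := cos_upper_four (x := 2 * s) (by linarith)
      rw [Real.cos_two_mul] at h4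
      nlinarith
    have hsq := correction_sq_le (T := s ^ 6 * (1 / 6 - 0.01 * s ^ 2) ^ 2 * (1 + 0.5152 * s) / 2)
      h0 h1 (sq_nonneg (Real.cos s)) hfφ hU hk (by
        have h0' : 0 ≤ Real.exp (-s ^ 2) - Real.cos s ^ 2 := sub_nonneg.2 hfφ
        have := pow_le_pow_left₀ h0' hD 2
        refine this.trans ?_
        have hnn : 0 ≤ (s ^ 4 * Real.cos s * (1 / 6 - 0.01 * s ^ 2)) ^ 2 := sq_nonneg _
        have := mul_le_mul_of_nonneg_left hq hnn
        refine le_of_eq_of_le (mul_one _).symm (this.trans_eq ?_)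
        ring)
    have hle : (1 / 3 + s / 25) * (Real.exp (-s ^ 2) - Real.cos s ^ 2) +
        s ^ 2 / 18 * (1 - s ^ 2 + s ^ 4 / 3) +
        s ^ 6 * (1 / 6 - 0.01 * s ^ 2) ^ 2 * (1 + 0.5152 * s) / 2 ≤
        1 / 18 * s ^ 2 + (1 / 150 * s ^ 5 +
      ((-0.077 / 3 + 1 / 54 + 1 / 72) * s ^ 6 + ((-0.077 / 25 + 0.5152 / 72) * s ^ 7 +
      (-0.00159 * s ^ 8 + -0.00159 * 0.5152 * s ^ 9)))) := by
      have h1' := mul_le_mul_of_nonneg_left hD' (by positivity : 0 ≤ 1 / 3 + s / 25)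
      have hP : (1 / 6 - 0.01 * s ^ 2) ^ 2 ≤ 1 / 36 - 0.00318 * s ^ 2 := by
        nlinarith [mul_nonneg (sq_nonneg s) (by nlinarith : 0 ≤ 1.44 - s ^ 2)]
      have h2' := mul_le_mul_of_nonneg_left hP
        (by positivity : 0 ≤ s ^ 6 * (1 + 0.5152 * s) / 2)
      nlinarith
    have hR0 : 0 ≤ (1 / 3 + s / 25) * (Real.exp (-s ^ 2) - Real.cos s ^ 2) +
        s ^ 2 / 18 * (1 - s ^ 2 + s ^ 4 / 3) +
        s ^ 6 * (1 / 6 - 0.01 * s ^ 2) ^ 2 * (1 + 0.5152 * s) / 2 := by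
      have := sub_nonneg.2 hfφ
      have := (sq_nonneg (Real.cos s)).trans hU
      positivity
    refine ⟨hR0.trans hle, hsq.trans ?_⟩
    have hqn := one_sub_div_pi_nonneg (s := s) (by linarith)
    exact mul_le_mul_of_nonneg_left hle (by positivity)
  · have p (c : ℝ) (k : ℕ) := integralLe_const_mul_pow c k (by norm_num : (0 : ℝ) ≤ 6 / 5)
    refine ((p _ 2).add ((p _ 5).add ((p _ 6).add ((p _ 7).add
      ((p _ 8).add (p _ 9)))))).trans ?_
    norm_num

set_option maxHeartbeats 1000000 in
/-- The bound for four summands with third absolute moment close to `1`. -/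
lemma cdf_sub_le_of_eq_four (μ : Measure ℝ) [IsProbabilityMeasure μ]
    (hμ : Integrable (fun y => y) μ) (g : ℝ → ℝ) (hg : Continuous g) {n : ℕ} (hn : n = 4)
    (hcos : ∀ t, ∫ y, Real.cos (t * y) ∂μ = g (t / √n) ^ n)
    (hsin : ∀ t, ∫ y, Real.sin (t * y) ∂μ = 0) {δ : ℝ} (hδ0 : 0 ≤ δ) (hδ : δ ≤ 0.38)
    (hlo : ∀ s, 0 < s → s ≤ Real.pi → Real.cos s ≤ g s)
    (hup : ∀ s, 0 < s → g s ≤ Real.cos s + δ / 6 * s ^ 3) (x : ℝ) :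
    μ.real (Set.Iic x) - stdNormalCDF x ≤ 0.409 * (1 + δ) / √n := by
  have hpi := Real.pi_gt_d4
  have hpi' := Real.pi_lt_d4
  have hn2 : (n : ℝ) = 4 := by exact_mod_cast hn
  have hA : cosPowMean 2 = 3 / 8 := by
    rw [cosPowMean_succ, cosPowMean_succ]
    norm_num [cosPowMean]
  have b1 := integralLe_exp_sub_cos_pow (n := n) (m := 2) (by omega) (by omega)
    (by linarith : (6 / 5 : ℝ) ≤ Real.pi / 2)
  have b2 : IntegralLe (Set.Ioc 0 (6 / 5)) (fun s : ℝ => s ^ 2 * Real.exp (-2 * s ^ 2)) _ :=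
    IntegralLe.of_Ioi (integrable_pow_mul_exp_neg_mul_sq two_pos 2).integrableOn
    (fun s _ => by positivity) le_rfl Set.Ioc_subset_Ioi_self
  rw [integral_sq_mul_exp_neg_mul_sq two_pos] at b2
  have hsq : √(Real.pi / 2) ≤ 1.2534 := Real.sqrt_le_iff.2 ⟨by norm_num, by linarith⟩
  have hmain := cdf_sub_le_of_near_rademacher μ hμ g hg (m := 2) (by omega) (by omega) hcos hsin
    hδ0 hδ hlo hup (s₁ := 6 / 5) (I := 0.0396) (by norm_num) (by linarith)
    (fun s => 0.382 * (Real.exp (-(n * s ^ 2 / 2)) - Real.cos s ^ n) +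
      (1 / 18 * (s ^ 2 * Real.exp (-2 * s ^ 2)) + (1 / 18 * s ^ 6 + (0.5152 / 18 * s ^ 7 +
      (-0.0433 * s ^ 8 + (-0.0433 * 0.5152 * s ^ 9 + (0.01065 * s ^ 10 +
        0.01065 * 0.5152 * s ^ 11)))))))
    ?_ ?_ x
  · refine hmain.trans ?_
    have hp := one_div_pi_le
    have hp0 : 0 < 1 / Real.pi := by positivity
    have hp2 : (1 / Real.pi) ^ 2 ≤ 0.31832 ^ 2 := by gcongr
    have he := exp_neg_two_point_eight_eight_le
    have hr : √(n : ℝ) = 2 := by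
      rw [hn2, show (4 : ℝ) = 2 ^ 2 by norm_num]
      exact Real.sqrt_sq two_pos.le
    have hend : 1 / (4 * Real.pi ^ 2 * (n : ℝ) ^ 2) = (1 / Real.pi) ^ 2 / 64 := by
      rw [hn2]
      field_simp
      norm_num
    have htail : Real.exp (-((n : ℝ) * (6 / 5) ^ 2 / 2)) * ((n : ℝ) * (6 / 5) ^ 2 / 2 + 1) /
        (2 * ((n : ℝ) * (6 / 5) ^ 2 / 2) * ((n : ℝ) * (6 / 5) ^ 2 / 2 + 2)) ≤ 0.00778 := by
      rw [hn2, show -((4 : ℝ) * (6 / 5) ^ 2 / 2) = -2.88 by norm_num, div_le_iff₀ (by norm_num)]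
      norm_num at he ⊢
      linarith
    have htail' := mul_le_mul_of_nonneg_left htail hp0.le
    rw [hA, hend, hr]
    nlinarith
  · intro s h0 h1
    have hc0 : 0 ≤ Real.cos s := (Real.cos_pos_of_mem_Ioo ⟨by linarith, by linarith⟩).le
    have hfφ : Real.cos s ^ n ≤ Real.exp (-(n * s ^ 2 / 2)) := cos_pow_le_exp h0.le (by linarith)
    have hfφ2 : Real.cos s ^ 2 ≤ Real.exp (-s ^ 2) := by
      have := cos_pow_le_exp (n := 2) h0.le (by linarith)
      rwa [show -(((2 : ℕ) : ℝ) * s ^ 2 / 2) = -s ^ 2 by push_cast; ring] at this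
    have hk : cotGap s ≤ 0.382 * s := by
      have := cotGap_le_quadratic h0 h1
      nlinarith
    have hD := exp_neg_sq_sub_cos_sq_le h0.le h1
    have hS := exp_neg_sq_add_cos_sq_le h0.le h1
    have hq := one_div_one_sub_div_pi_le h0.le h1
    rw [show -((n : ℝ) * s ^ 2 / 2) = -2 * s ^ 2 by rw [hn2]; ring, hn] at hfφ ⊢
    have hw : s ^ 2 ≤ 1.44 := by nlinarith
    have hsplit : Real.exp (-2 * s ^ 2) - Real.cos s ^ 4 =
        (Real.exp (-s ^ 2) - Real.cos s ^ 2) * (Real.exp (-s ^ 2) + Real.cos s ^ 2) := by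
      rw [show -2 * s ^ 2 = -s ^ 2 + -s ^ 2 by ring, Real.exp_add]
      ring
    have hPQ : ((1 / 6 - 0.01 * s ^ 2) * (2 - 0.66 * s ^ 2)) ^ 2 ≤
        1 / 9 - 0.0866 * s ^ 2 + 0.0213 * s ^ 4 := by
      have : 0 ≤ s ^ 4 * (1.44 - s ^ 2) := mul_nonneg (by positivity) (by linarith)
      have h6 : 0 ≤ s ^ 6 * (1.44 - s ^ 2) := mul_nonneg (by positivity) (by linarith)
      have h6' : 0 ≤ s ^ 6 := by positivity
      nlinarith [sq_nonneg s]
    have hT : (Real.exp (-2 * s ^ 2) - Real.cos s ^ 4) ^ 2 ≤ 2 * (1 - s / Real.pi) *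
        Real.cos s ^ 4 * (s ^ 2 * (s ^ 6 * (1 / 9 - 0.0866 * s ^ 2 + 0.0213 * s ^ 4) *
          (1 + 0.5152 * s) / 2)) := by
      rw [hsplit]
      have h1' : (Real.exp (-s ^ 2) - Real.cos s ^ 2) * (Real.exp (-s ^ 2) + Real.cos s ^ 2) ≤
          (s ^ 4 * Real.cos s * (1 / 6 - 0.01 * s ^ 2)) * (Real.cos s * (2 - 0.66 * s ^ 2)) :=
        mul_le_mul hD hS (by positivity) (mul_nonneg (by positivity) (by linarith))
      have h2' : 0 ≤ (Real.exp (-s ^ 2) - Real.cos s ^ 2) * (Real.exp (-s ^ 2) + Real.cos s ^ 2) :=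
        mul_nonneg (sub_nonneg.2 hfφ2) (by positivity)
      refine (pow_le_pow_left₀ h2' h1' 2).trans ?_
      have hnn : 0 ≤ s ^ 8 * Real.cos s ^ 4 := by positivity
      calc _ = s ^ 8 * Real.cos s ^ 4 * ((1 / 6 - 0.01 * s ^ 2) * (2 - 0.66 * s ^ 2)) ^ 2 := by ring
        _ ≤ s ^ 8 * Real.cos s ^ 4 * (1 / 9 - 0.0866 * s ^ 2 + 0.0213 * s ^ 4) :=
          mul_le_mul_of_nonneg_left hPQ hnn
        _ ≤ s ^ 8 * Real.cos s ^ 4 * (1 / 9 - 0.0866 * s ^ 2 + 0.0213 * s ^ 4) *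
            ((1 - s / Real.pi) * (1 + 0.5152 * s)) :=
          le_mul_of_one_le_right (mul_nonneg hnn ((sq_nonneg _).trans hPQ)) hq
        _ = _ := by ring
    have hsq := correction_sq_le h0 h1 (pow_nonneg hc0 4) hfφ hfφ hk hT
    refine ⟨?_, hsq.trans_eq (by ring)⟩
    have h3 := sub_nonneg.2 hfφ
    have h4 := (sq_nonneg _).trans hPQ
    have h5 : 0 ≤ s ^ 6 * (1 / 9 - 0.0866 * s ^ 2 + 0.0213 * s ^ 4) * (1 + 0.5152 * s) / 2 := by
      positivity
    have h6 : 0 ≤ s ^ 2 * Real.exp (-2 * s ^ 2) := by positivity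
    linarith
  · have p (c : ℝ) (k : ℕ) := integralLe_const_mul_pow c k (by norm_num : (0 : ℝ) ≤ 6 / 5)
    refine ((b1.const_mul (by norm_num)).add ((b2.const_mul (by norm_num)).add
      ((p _ 6).add ((p _ 7).add ((p _ 8).add ((p _ 9).add ((p _ 10).add (p _ 11)))))))).trans ?_
    rw [hA, show 2 * Real.pi / (n : ℝ) = Real.pi / 2 by rw [hn2]; ring]
    generalize √(Real.pi / 2) = q at hsq
    norm_num at hsq ⊢
    linarith

/-- A lower bound `b ≥ a (2 - y)` passes to powers, by convexity of `y ↦ y ^ k`. -/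
lemma mul_two_sub_pow_le_pow {a b y : ℝ} (ha : 0 ≤ a) (hb : 0 ≤ b) (hy : 1 ≤ y)
    (h : a * (2 - y) ≤ b) {k : ℕ} (hk : 1 ≤ k) : a ^ k * (2 - y ^ k) ≤ b ^ k := by
  rcases le_or_gt 2 y with h2 | h2
  · have : 2 ≤ y ^ k := h2.trans (le_self_pow₀ hy (by omega))
    have h3 : a ^ k * (2 - y ^ k) ≤ 0 := mul_nonpos_of_nonneg_of_nonpos (by positivity) (by linarith)
    exact h3.trans (by positivity)
  · have h1 := one_add_mul_le_pow (a := y - 1) (by linarith) k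
    have h3 := one_add_mul_le_pow (a := 1 - y) (by linarith) k
    rw [show 1 + (y - 1) = y by ring] at h1
    rw [show 1 + (1 - y) = 2 - y by ring] at h3
    have h4 : 2 - y ^ k ≤ (2 - y) ^ k := by nlinarith
    calc a ^ k * (2 - y ^ k) ≤ a ^ k * (2 - y) ^ k := by gcongr
      _ = (a * (2 - y)) ^ k := (mul_pow _ _ _).symm
      _ ≤ b ^ k := pow_le_pow_left₀ (mul_nonneg ha (by linarith)) h k

lemma exp_neg_one_point_two_ge : 0.3 ≤ Real.exp (-1.2) := by
  have h := exp_neg_lower_two (z := 0.3) (by norm_num)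
  have h2 := pow_le_pow_left₀ (by norm_num) h 4
  rw [← Real.exp_nat_mul] at h2
  norm_num at h2 ⊢
  linarith

lemma exp_neg_mul_two_sub_le_cos_sq {u : ℝ} (h0 : 0 ≤ u) (h1 : u ≤ 1.37) :
    Real.exp (-u ^ 2) * (2 - Real.exp (0.276 * u ^ 3)) ≤ Real.cos u ^ 2 := by
  have hz : 1 + 0.276 * u ^ 3 + (0.276 * u ^ 3) ^ 2 / 2 ≤ Real.exp (0.276 * u ^ 3) :=
    Real.quadratic_le_exp_of_nonneg (by positivity)
  have he0 := Real.exp_pos (-u ^ 2)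
  have hstep : Real.exp (-u ^ 2) * (2 - Real.exp (0.276 * u ^ 3)) ≤
      Real.exp (-u ^ 2) * (1 - 0.276 * u ^ 3 - 0.038 * u ^ 6) := by
    refine mul_le_mul_of_nonneg_left ?_ he0.le
    have : 0 ≤ u ^ 6 := by positivity
    nlinarith
  refine hstep.trans ?_
  rcases le_or_gt u 1.2 with h | h
  · have hD := exp_neg_sq_sub_cos_sq_le_poly h0 (by linarith)
    have he : 0.3 * (2.2 - u ^ 2) ≤ Real.exp (-u ^ 2) := by
      have h3 := Real.add_one_le_exp (1.2 - u ^ 2)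
      have h4 := exp_neg_one_point_two_ge
      have h5 : Real.exp (-u ^ 2) = Real.exp (-1.2) * Real.exp (1.2 - u ^ 2) := by
        rw [← Real.exp_add]
        congr 1
        ring
      rw [h5]
      have h6 : (0 : ℝ) ≤ 2.2 - u ^ 2 := by nlinarith
      exact mul_le_mul h4 (by linarith) h6 (Real.exp_pos _).le
    have hu3 : 3 * u - 2 ≤ u ^ 3 := by nlinarith [mul_nonneg (by linarith : 0 ≤ u + 2) (sq_nonneg (u - 1))]
    have key : u * (1 / 6 - 0.077 * u ^ 2) ≤ 0.3 * (2.2 - u ^ 2) * (0.276 + 0.038 * u ^ 3) := by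
      have h6 : (0 : ℝ) ≤ 0.3 * (2.2 - u ^ 2) := by nlinarith
      have h7 := mul_le_mul_of_nonneg_left hu3 h6
      nlinarith [mul_nonneg h0 (sub_nonneg.2 h), mul_nonneg (sq_nonneg u) (sub_nonneg.2 h),
        mul_nonneg h0 (sq_nonneg (u - 1)), sq_nonneg (u - 1)]
    have h8 : u * (1 / 6 - 0.077 * u ^ 2) ≤ Real.exp (-u ^ 2) * (0.276 + 0.038 * u ^ 3) :=
      key.trans (mul_le_mul_of_nonneg_right he (by positivity))
    have h9 := mul_le_mul_of_nonneg_left h8 (by positivity : 0 ≤ u ^ 3)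
    nlinarith
  · have hpi := Real.pi_gt_d4
    have hpi' := Real.pi_lt_d4
    have hs := sin_lower_three (x := Real.pi / 2 - u) (by linarith)
    rw [Real.sin_pi_div_two_sub] at hs
    have hc : 0.976 * (1.5707 - u) ≤ Real.cos u := by
      refine le_trans ?_ hs
      have h4 : (Real.pi / 2 - u) ^ 2 ≤ 0.1376 := by nlinarith
      nlinarith
    have hc2 : (0.976 * (1.5707 - u)) ^ 2 ≤ Real.cos u ^ 2 :=
      pow_le_pow_left₀ (by nlinarith) hc 2
    have he : Real.exp (-u ^ 2) ≤ 0.237 :=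
      (Real.exp_le_exp.2 (by nlinarith)).trans exp_neg_one_point_four_four_le
    refine le_trans ?_ hc2
    have h3 : 1.728 + 4.32 * (u - 1.2) ≤ u ^ 3 := by nlinarith [sq_nonneg (u - 1.2)]
    have h6 : 2.98 + 14.9 * (u - 1.2) ≤ u ^ 6 := by
      have : (1.728 + 4.32 * (u - 1.2)) ^ 2 ≤ (u ^ 3) ^ 2 := pow_le_pow_left₀ (by nlinarith) h3 2
      nlinarith [sq_nonneg (u - 1.2)]
    have h7 : 1 - 0.276 * u ^ 3 - 0.038 * u ^ 6 ≤ 0.4099 - 1.758 * (u - 1.2) := by nlinarith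
    rcases le_or_gt (1 - 0.276 * u ^ 3 - 0.038 * u ^ 6) 0 with hn | hn
    · exact (mul_nonpos_of_nonneg_of_nonpos he0.le hn).trans (sq_nonneg _)
    · calc _ ≤ 0.237 * (0.4099 - 1.758 * (u - 1.2)) := mul_le_mul he h7 hn.le (by norm_num)
        _ ≤ _ := by nlinarith [sq_nonneg (u - 1.35)]

lemma two_le_exp_of_ge {u : ℝ} (h : 1.37 ≤ u) : 2 ≤ Real.exp (0.276 * u ^ 3) := by
  have h3 : 1.37 ^ 3 ≤ u ^ 3 := pow_le_pow_left₀ (by norm_num) h 3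
  have h7 : 0.7 ≤ 0.276 * u ^ 3 := by linarith
  have := Real.exp_le_exp.2 h7
  refine le_trans ?_ this
  have h4 := Real.log_two_lt_d9
  rw [← Real.exp_log two_pos]
  exact Real.exp_le_exp.2 (by linarith)

lemma exp_sub_pow_charfn_le {g u r : ℝ} {n k : ℕ} (hnk : n = 2 * k) (hk : 1 ≤ k) (h0 : 0 ≤ u)
    (hr : 1 ≤ r) (hlo : Real.cos u ≤ g) :
    Real.exp (-(n * u ^ 2 / 2)) - g ^ n ≤
      Real.exp (-(n * u ^ 2 / 2)) * (Real.exp (0.138 * n * r * u ^ 3) - 1) := by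
  have hbase : Real.exp (-u ^ 2) * (2 - Real.exp (0.276 * u ^ 3)) ≤ g ^ 2 := by
    rcases le_or_gt u 1.37 with h | h
    · refine (exp_neg_mul_two_sub_le_cos_sq h0 h).trans ?_
      have : 0 ≤ Real.cos u := (Real.cos_pos_of_mem_Ioo
        ⟨by linarith [Real.pi_pos], by linarith [Real.pi_gt_d4]⟩).le
      gcongr
    · refine (mul_nonpos_of_nonneg_of_nonpos (Real.exp_pos _).le ?_).trans (sq_nonneg _)
      linarith [two_le_exp_of_ge h.le]
  have hy : 1 ≤ Real.exp (0.276 * u ^ 3) := Real.one_le_exp (by positivity)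
  have h := mul_two_sub_pow_le_pow (Real.exp_pos _).le (sq_nonneg g) hy hbase hk
  rw [← pow_mul, ← hnk, ← Real.exp_nat_mul, ← Real.exp_nat_mul] at h
  have e1 : (k : ℝ) * -u ^ 2 = -(n * u ^ 2 / 2) := by rw [hnk]; push_cast; ring
  have e2 : (k : ℝ) * (0.276 * u ^ 3) ≤ 0.138 * n * r * u ^ 3 := by
    have : (k : ℝ) = n / 2 := by rw [hnk]; push_cast; ring
    rw [this]
    have : 0 ≤ 0.138 * n * u ^ 3 := by positivity
    nlinarith
  rw [e1] at h
  have h2 := mul_le_mul_of_nonneg_left (Real.exp_le_exp.2 e2) (Real.exp_pos (-(n * u ^ 2 / 2))).le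
  linarith

lemma neg_cos_le_exp {u : ℝ} (h1 : u ≤ 1.885) (h0 : 0 ≤ u) :
    -Real.cos u ≤ Real.exp (-(u ^ 2 / 2) + 0.138 * u ^ 3) := by
  have hpi := Real.pi_gt_d4
  rcases le_or_gt u (Real.pi / 2) with h | h
  · have := Real.cos_nonneg_of_neg_pi_div_two_le_of_le (by linarith) h
    exact (by linarith : -Real.cos u ≤ 0).trans (Real.exp_pos _).le
  · have hs : -Real.cos u ≤ u - Real.pi / 2 := by
      have := Real.sin_le (x := u - Real.pi / 2) (by linarith)
      rwa [Real.sin_sub_pi_div_two] at this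
    have he : -0.86 ≤ -(u ^ 2 / 2) + 0.138 * u ^ 3 := by
      have h3 : 0 ≤ (u + 1.885) / 2 - 0.138 * (u ^ 2 + 1.885 * u + 1.885 ^ 2) := by nlinarith
      have h4 := mul_nonneg (sub_nonneg.2 h1) h3
      nlinarith
    have h4 := Real.exp_le_exp.2 he
    have h5 : 0.32 ≤ Real.exp (-0.86) := by
      have h := exp_neg_lower_two (z := 0.43) (by norm_num)
      have h2 := pow_le_pow_left₀ (by norm_num) h 2
      rw [← Real.exp_nat_mul] at h2
      norm_num at h2 ⊢
      linarith
    linarith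

lemma pow_charfn_sub_exp_le {g u r : ℝ} {n : ℕ} (hn : Even n) (h0 : 0 ≤ u)
    (h1 : u ≤ 1.885) (hr : 1 ≤ r) (hlo : Real.cos u ≤ g)
    (hup : g ≤ 1 - u ^ 2 / 2 + 0.138 * r * u ^ 3) :
    g ^ n - Real.exp (-(n * u ^ 2 / 2)) ≤
      Real.exp (-(n * u ^ 2 / 2)) * (Real.exp (0.138 * n * r * u ^ 3) - 1) := by
  have hu3 : 0 ≤ u ^ 3 := by positivity
  have hab : |g| ≤ Real.exp (-(u ^ 2 / 2) + 0.138 * r * u ^ 3) := by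
    rw [abs_le']
    constructor
    · have := Real.add_one_le_exp (-(u ^ 2 / 2) + 0.138 * r * u ^ 3)
      linarith
    · have := neg_cos_le_exp h1 h0
      have h3 : Real.exp (-(u ^ 2 / 2) + 0.138 * u ^ 3) ≤
          Real.exp (-(u ^ 2 / 2) + 0.138 * r * u ^ 3) := Real.exp_le_exp.2 (by nlinarith)
      linarith
  have h := pow_le_pow_left₀ (abs_nonneg g) hab n
  rw [hn.pow_abs, ← Real.exp_nat_mul, mul_add, Real.exp_add] at h
  rw [show (n : ℝ) * (0.138 * r * u ^ 3) = 0.138 * n * r * u ^ 3 by ring,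
    show (n : ℝ) * -(u ^ 2 / 2) = -(n * u ^ 2 / 2) by ring] at h
  linarith

lemma exp_mul_sub_one_le_chord {θ z : ℝ} (h0 : 0 ≤ θ) (h1 : θ ≤ 1) :
    Real.exp (θ * z) - 1 ≤ θ * (Real.exp z - 1) := by
  have h := convexOn_exp.2 (Set.mem_univ z) (Set.mem_univ 0) h0 (sub_nonneg.2 h1) (by ring)
  simp only [smul_eq_mul, mul_zero, add_zero, Real.exp_zero] at h
  linarith

lemma abs_pow_charfn_sub_exp_le_near {g s r N : ℝ} {n k : ℕ} (hnk : n = 2 * k) (hk : 1 ≤ k)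
    (h0 : 0 < s) (h1 : s ≤ 1.885) (hr : 1 ≤ r) (hN : N = n / r ^ 2)
    (hlo : Real.cos (s / r) ≤ g)
    (hup : g ≤ 1 - (s / r) ^ 2 / 2 + 0.138 * r * (s / r) ^ 3) :
    |g ^ n - Real.exp (-(N * s ^ 2 / 2))| ≤
      s / 1.885 * (Real.exp (-(0.23987 * N) * s ^ 2) - Real.exp (-(N * s ^ 2 / 2))) := by
  have hr0 : 0 < r := by linarith
  have hu0 : 0 ≤ s / r := by positivity
  have hu1 : s / r ≤ 1.885 := (div_le_self h0.le hr).trans h1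
  have e1 : (n : ℝ) * (s / r) ^ 2 / 2 = N * s ^ 2 / 2 := by
    rw [hN]
    field_simp
  have e2 : 0.138 * (n : ℝ) * r * (s / r) ^ 3 = s / 1.885 * (0.138 * 1.885 * N * s ^ 2) := by
    rw [hN]
    field_simp
  have ha := exp_sub_pow_charfn_le hnk hk hu0 hr hlo
  have hb := pow_charfn_sub_exp_le (hnk ▸ even_two_mul k) hu0 hu1 hr hlo hup
  rw [e1, e2] at ha hb
  have hc := exp_mul_sub_one_le_chord (θ := s / 1.885) (z := 0.138 * 1.885 * N * s ^ 2)
    (by positivity) ((div_le_one (by norm_num)).2 h1)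
  have hd := mul_le_mul_of_nonneg_left hc (Real.exp_pos (-(N * s ^ 2 / 2))).le
  have he : Real.exp (-(N * s ^ 2 / 2)) * (s / 1.885 * (Real.exp (0.138 * 1.885 * N * s ^ 2) - 1)) =
      s / 1.885 * (Real.exp (-(0.23987 * N) * s ^ 2) - Real.exp (-(N * s ^ 2 / 2))) := by
    rw [show -(0.23987 * N) * s ^ 2 = -(N * s ^ 2 / 2) + 0.138 * 1.885 * N * s ^ 2 by ring,
      Real.exp_add]
    ring
  rw [abs_le]
  constructor <;> linarith

lemma abs_pow_charfn_sub_exp_le_far {g s r N : ℝ} {n : ℕ} (hn : Even n)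
    (h1 : 1.885 ≤ s) (h2 : s < Real.pi) (hr : 1 ≤ r) (hN : N = n / r ^ 2)
    (hlo : Real.cos (s / r) ≤ g)
    (hup : g ≤ 1 - (s / r) ^ 2 / 2 + 0.138 * r * (s / r) ^ 3) :
    |g ^ n - Real.exp (-(N * s ^ 2 / 2))| ≤ Real.exp (-(N / 2) * (Real.pi - s) ^ 2) := by
  have hpi := Real.pi_gt_d4
  have hpi' := Real.pi_lt_d4
  have hr0 : 0 < r := by linarith
  have hN0 : 0 ≤ N := by rw [hN]; positivity
  have hab : |g| ≤ Real.exp (-((Real.pi - s) ^ 2 / r ^ 2 / 2)) := by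
    rw [abs_le']
    constructor
    · have h3 : (Real.pi - s) ^ 2 / 2 ≤ s ^ 2 / 2 - 0.138 * s ^ 3 := by
        have h4 : (Real.pi - s) ^ 2 ≤ (3.1416 - s) ^ 2 :=
          pow_le_pow_left₀ (by linarith) (by linarith) 2
        have : 0 ≤ (s - 1.885) * (3.1416 - s) * s :=
          mul_nonneg (mul_nonneg (by linarith) (by linarith)) (by linarith)
        nlinarith [mul_nonneg (by linarith : 0 ≤ s - 1.885) (by linarith : 0 ≤ 3.1416 - s)]
      have h5 : g ≤ 1 - (s ^ 2 / 2 - 0.138 * s ^ 3) / r ^ 2 := by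
        refine hup.trans_eq ?_
        field_simp
        ring
      have h6 : (Real.pi - s) ^ 2 / r ^ 2 / 2 ≤ (s ^ 2 / 2 - 0.138 * s ^ 3) / r ^ 2 := by
        rw [div_right_comm]
        gcongr
      have h7 := Real.add_one_le_exp (-((Real.pi - s) ^ 2 / r ^ 2 / 2))
      linarith
    · rcases le_or_gt (s / r) (Real.pi / 2) with h | h
      · have h3 : 0 ≤ s / r := by positivity
        have := Real.cos_nonneg_of_neg_pi_div_two_le_of_le (by linarith) h
        exact (by linarith : -g ≤ 0).trans (Real.exp_pos _).le
      · have hu : s / r ≤ s := div_le_self (by linarith) hr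
        have h3 := cos_le_exp_neg_sq_div_two (s := Real.pi - s / r) (by linarith) (by linarith)
        rw [Real.cos_pi_sub] at h3
        have h4 : (Real.pi - s) / r ≤ Real.pi - s / r := by
          rw [sub_div]
          linarith [div_le_self Real.pi_pos.le hr]
        have h5 : ((Real.pi - s) / r) ^ 2 ≤ (Real.pi - s / r) ^ 2 :=
          pow_le_pow_left₀ (div_nonneg (by linarith) hr0.le) h4 2
        rw [div_pow] at h5
        have h6 : Real.exp (-((Real.pi - s / r) ^ 2 / 2)) ≤
            Real.exp (-((Real.pi - s) ^ 2 / r ^ 2 / 2)) := Real.exp_le_exp.2 (by linarith)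
        linarith
  have h := pow_le_pow_left₀ (abs_nonneg g) hab n
  rw [hn.pow_abs, ← Real.exp_nat_mul,
    show (n : ℝ) * -((Real.pi - s) ^ 2 / r ^ 2 / 2) = -(N / 2) * (Real.pi - s) ^ 2 by
      rw [hN]; field_simp] at h
  have hφ : Real.exp (-(N * s ^ 2 / 2)) ≤ Real.exp (-(N / 2) * (Real.pi - s) ^ 2) := by
    refine Real.exp_le_exp.2 ?_
    have : (Real.pi - s) ^ 2 ≤ s ^ 2 := pow_le_pow_left₀ (by linarith) (by linarith) 2
    nlinarith
  have h3 := hn.pow_nonneg g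
  have h4 := Real.exp_pos (-(N * s ^ 2 / 2))
  rw [abs_le]
  constructor <;> linarith

lemma sq_add_prawitzG_sq_le_far {s : ℝ} (h1 : 1.885 ≤ s) (h2 : s < Real.pi) :
    (1 - s / Real.pi) ^ 2 + prawitzG s ^ 2 ≤ (1.182 * (1 - s / Real.pi)) ^ 2 := by
  have hpi' := Real.pi_lt_d4
  have hG := prawitzG_le_of_pi_div_two_lt (by linarith) h2
  have h3 := pow_le_pow_left₀ (prawitzG_nonneg (by linarith) h2) hG 2
  have h4 : ((Real.pi - s) / 2) ^ 2 ≤ 0.397 := by nlinarith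
  have := mul_le_mul_of_nonneg_left h4 (sq_nonneg (1 - s / Real.pi))
  nlinarith [sq_nonneg (1 - s / Real.pi)]

lemma gaussian_smoothing_le {s : ℝ} (h0 : 0 < s) (h2 : s < Real.pi) (y : ℝ) :
    (1 - s / Real.pi) * Real.cos y + (prawitzG s - 1 / s) * Real.sin y ≤
      (1 - s / Real.pi) + 1 / 8 * s ^ 2 + (if s ≤ Real.pi / 2 then 0 else 1 / s) := by
  have hq := one_sub_div_pi_nonneg h2.le
  have hq1 : 1 - s / Real.pi ≤ 1 := by
    have : 0 ≤ s / Real.pi := by positivity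
    linarith
  split_ifs with h
  · have hG := prawitzG_eq h0
    have hc := cotGap_le_half h0 h
    have hc0 := cotGap_nonneg h0 h2
    have hcc : cotGap s ^ 2 ≤ s ^ 2 / 4 := by nlinarith
    refine lin_trig_le y ?_ (by positivity)
    rw [hG]
    have h3 : (1 - s / Real.pi) ^ 2 * cotGap s ^ 2 ≤ (1 - s / Real.pi) * (s ^ 2 / 4) := by
      have : (1 - s / Real.pi) ^ 2 ≤ 1 - s / Real.pi := by nlinarith
      exact mul_le_mul this hcc (sq_nonneg _) hq
    nlinarith [sq_nonneg (s ^ 2)]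
  · have hG := prawitzG_nonneg h0 h2
    have hG' := prawitzG_le_inv h0 h2
    have h3 : (1 - s / Real.pi) * Real.cos y ≤ 1 - s / Real.pi :=
      mul_le_of_le_one_right hq (Real.cos_le_one y)
    have h4 : (prawitzG s - 1 / s) * Real.sin y ≤ 1 / s := by
      nlinarith [Real.neg_one_le_sin y, Real.sin_le_one y]
    nlinarith [sq_nonneg s]

/-- The integrand of the smoothing inequality when the third absolute moment is large. -/
lemma smoothing_integrand_le_of_large {g s r N : ℝ} {n k : ℕ} (hnk : n = 2 * k) (hk : 1 ≤ k)
    (h0 : 0 < s) (h2 : s < Real.pi) (hr : 1 ≤ r) (hN : N = n / r ^ 2)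
    (hlo : Real.cos (s / r) ≤ g)
    (hup : g ≤ 1 - (s / r) ^ 2 / 2 + 0.138 * r * (s / r) ^ 3) (y : ℝ) :
    g ^ n * ((1 - s / Real.pi) * Real.cos y + prawitzG s * Real.sin y) -
        Real.exp (-(N * s ^ 2 / 2)) * Real.sin y / s ≤
      (1 - s / Real.pi) * Real.exp (-(N / 2) * s ^ 2) +
        1 / 8 * (s ^ 2 * Real.exp (-(N / 2) * s ^ 2)) +
        (if s ≤ Real.pi / 2 then 0 else Real.exp (-(N * s ^ 2 / 2)) / s) +
        1.04 / 1.885 * (Real.exp (-(0.23987 * N) * s ^ 2) - Real.exp (-(N / 2) * s ^ 2)) +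
        1.182 / Real.pi * (if Real.pi - s ≤ Real.pi - 1.885 then
          (Real.pi - s) * Real.exp (-(N / 2) * (Real.pi - s) ^ 2) else 0) := by
  have hq := one_sub_div_pi_nonneg h2.le
  have hN0 : 0 ≤ N := by rw [hN]; positivity
  rw [show -(N / 2) * s ^ 2 = -(N * s ^ 2 / 2) by ring]
  set φ := Real.exp (-(N * s ^ 2 / 2)) with hφ
  have hφ0 : 0 < φ := Real.exp_pos _
  set K := (1 - s / Real.pi) * Real.cos y + prawitzG s * Real.sin y with hK
  have hsplit : g ^ n * K - φ * Real.sin y / s =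
      φ * ((1 - s / Real.pi) * Real.cos y + (prawitzG s - 1 / s) * Real.sin y) +
        (g ^ n - φ) * K := by
    rw [hK]
    field_simp
    ring
  have hmain := mul_le_mul_of_nonneg_left (gaussian_smoothing_le h0 h2 y) hφ0.le
  have hite : φ * (if s ≤ Real.pi / 2 then 0 else 1 / s) =
      if s ≤ Real.pi / 2 then 0 else φ / s := by
    split_ifs
    · simp
    · ring
  rw [mul_add _ (1 - s / Real.pi + 1 / 8 * s ^ 2), hite] at hmain
  have hKabs : ∀ R, (1 - s / Real.pi) ^ 2 + prawitzG s ^ 2 ≤ R ^ 2 → 0 ≤ R → |K| ≤ R := by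
    intro R hR hR0
    rw [abs_le']
    refine ⟨lin_trig_le y hR hR0, ?_⟩
    have := lin_trig_le (a := -(1 - s / Real.pi)) (b := -prawitzG s) y (by linarith) hR0
    rw [hK]
    linarith
  have hψ : φ ≤ Real.exp (-(0.23987 * N) * s ^ 2) := by
    refine Real.exp_le_exp.2 ?_
    have : 0 ≤ N * s ^ 2 := by positivity
    linarith
  have hnear0 : 0 ≤ 1.04 / 1.885 * (Real.exp (-(0.23987 * N) * s ^ 2) - φ) :=
    mul_nonneg (by norm_num) (sub_nonneg.2 hψ)
  have herr : (g ^ n - φ) * K ≤ 1.04 / 1.885 * (Real.exp (-(0.23987 * N) * s ^ 2) - φ) +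
      1.182 / Real.pi * (if Real.pi - s ≤ Real.pi - 1.885 then
          (Real.pi - s) * Real.exp (-(N / 2) * (Real.pi - s) ^ 2) else 0) := by
    refine (le_abs_self _).trans ?_
    rw [abs_mul]
    rcases le_or_gt 1.885 s with h | h
    · rw [if_pos (by linarith)]
      have hA := abs_pow_charfn_sub_exp_le_far (hnk ▸ even_two_mul k) h h2 hr hN hlo hup
      have hB := hKabs _ (sq_add_prawitzG_sq_le_far h h2) (by positivity)
      have := mul_le_mul hA hB (abs_nonneg _) (Real.exp_pos _).le
      refine this.trans ?_
      refine le_trans (le_of_eq ?_) (le_add_of_nonneg_left hnear0)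
      have := Real.pi_pos
      field_simp
    · rw [if_neg (by linarith), mul_zero, add_zero]
      have hA := abs_pow_charfn_sub_exp_le_near hnk hk h0 h.le hr hN hlo hup
      have hB := hKabs _ (sq_add_prawitzG_sq_le h0 h2) (by positivity)
      refine (mul_le_mul hA hB (abs_nonneg _) ((abs_nonneg _).trans hA)).trans_eq ?_
      rw [← hφ]
      field_simp
  rw [hsplit]
  linarith

lemma integralLe_mul_exp_neg_mul_sq {b a : ℝ} (hb : 0 < b) (ha : 0 ≤ a) :
    IntegralLe (Set.Ioc 0 a) (fun s => s * Real.exp (-b * s ^ 2))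
      ((1 - Real.exp (-b * a ^ 2)) / (2 * b)) := by
  have hd : ∀ x ∈ Set.uIcc 0 a, HasDerivAt
      (fun s => -(1 / (2 * b)) * Real.exp (-b * s ^ 2)) (x * Real.exp (-b * x ^ 2)) x := by
    intro x _
    refine ((hasDerivAt_exp_neg_mul_sq b x).const_mul _).congr_deriv ?_
    field_simp
  have hi : IntervalIntegrable (fun s => s * Real.exp (-b * s ^ 2)) volume 0 a :=
    Continuous.intervalIntegrable (by fun_prop) _ _
  refine ⟨(intervalIntegrable_iff_integrableOn_Ioc_of_le ha).1 hi, le_of_eq ?_⟩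
  rw [← intervalIntegral.integral_of_le ha, intervalIntegral.integral_eq_sub_of_hasDerivAt hd hi]
  simp
  field_simp
  ring

lemma integralLe_one_sub_mul_gaussian {b : ℝ} (hb : 0 < b) :
    IntegralLe (Set.Ioo 0 Real.pi) (fun s => (1 - s / Real.pi) * Real.exp (-b * s ^ 2))
      (√(Real.pi / b) / 2 - (1 - Real.exp (-b * Real.pi ^ 2)) / (2 * b * Real.pi)) := by
  have hpi := Real.pi_pos
  have hg : IntegrableOn (fun s : ℝ => Real.exp (-b * s ^ 2)) (Set.Ioi 0) :=
    (integrable_exp_neg_mul_sq hb).integrableOn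
  have h1 : IntegralLe (Set.Ioo 0 Real.pi) (fun s => Real.exp (-b * s ^ 2)) (√(Real.pi / b) / 2) :=
    IntegralLe.of_Ioi hg (fun s _ => (Real.exp_pos _).le) (integral_gaussian_Ioi b).le
      Set.Ioo_subset_Ioi_self
  have hd : ∀ x ∈ Set.uIcc 0 Real.pi, HasDerivAt
      (fun s => -(1 / (2 * b)) * Real.exp (-b * s ^ 2)) (x * Real.exp (-b * x ^ 2)) x := by
    intro x _
    refine ((hasDerivAt_exp_neg_mul_sq b x).const_mul _).congr_deriv ?_
    field_simp
  have hi : IntervalIntegrable (fun s => s * Real.exp (-b * s ^ 2)) volume 0 Real.pi :=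
    Continuous.intervalIntegrable (by fun_prop) _ _
  have hi2 : IntegrableOn (fun s => s * Real.exp (-b * s ^ 2)) (Set.Ioo 0 Real.pi) :=
    (intervalIntegrable_iff_integrableOn_Ioo_of_le hpi.le).1 hi
  have hv : ∫ s in Set.Ioo 0 Real.pi, s * Real.exp (-b * s ^ 2) =
      (1 - Real.exp (-b * Real.pi ^ 2)) / (2 * b) := by
    rw [← integral_Ioc_eq_integral_Ioo, ← intervalIntegral.integral_of_le hpi.le,
      intervalIntegral.integral_eq_sub_of_hasDerivAt hd hi]
    simp
    field_simp
    ring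
  have heq : (fun s => (1 - s / Real.pi) * Real.exp (-b * s ^ 2)) =
      fun s => Real.exp (-b * s ^ 2) - 1 / Real.pi * (s * Real.exp (-b * s ^ 2)) := by
    funext s
    ring
  rw [heq]
  refine ⟨h1.1.sub (hi2.const_mul _), ?_⟩
  rw [integral_sub h1.1 (hi2.const_mul _), integral_const_mul, hv]
  have h3 := h1.2
  have h4 : 1 / Real.pi * ((1 - Real.exp (-b * Real.pi ^ 2)) / (2 * b)) =
      (1 - Real.exp (-b * Real.pi ^ 2)) / (2 * b * Real.pi) := by field_simp
  rw [h4]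
  linarith

lemma integralLe_gaussian_sub {a b : ℝ} (ha : 0 < a) (hab : a ≤ b) :
    IntegralLe (Set.Ioo 0 Real.pi) (fun s => Real.exp (-a * s ^ 2) - Real.exp (-b * s ^ 2))
      (√(Real.pi / a) / 2 - √(Real.pi / b) / 2) := by
  have h1 := (integrable_exp_neg_mul_sq ha).integrableOn (s := Set.Ioi 0)
  have h2 := (integrable_exp_neg_mul_sq (ha.trans_le hab)).integrableOn (s := Set.Ioi 0)
  refine IntegralLe.of_Ioi (h1.sub h2) (fun s _ => ?_) ?_ Set.Ioo_subset_Ioi_self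
  · refine sub_nonneg.2 (Real.exp_le_exp.2 ?_)
    nlinarith [sq_nonneg s]
  · rw [integral_sub h1 h2, integral_gaussian_Ioi, integral_gaussian_Ioi]

lemma exp_neg_one_point_five_seven_le : Real.exp (-1.57) ≤ 0.2085 := by
  have h := exp_neg_upper_six (z := 0.785) (by norm_num)
  have h2 := pow_le_pow_left₀ (Real.exp_pos _).le h 2
  rw [← Real.exp_nat_mul] at h2
  norm_num at h2 ⊢
  linarith

lemma exp_neg_one_point_six_ge : 0.2 ≤ Real.exp (-1.6) := by
  have h := exp_neg_lower_two (z := 0.4) (by norm_num)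
  have h2 := pow_le_pow_left₀ (by norm_num) h 4
  rw [← Real.exp_nat_mul] at h2
  norm_num at h2 ⊢
  linarith

/-- The numerical inequality behind the bound for a large third absolute moment. -/
lemma smoothing_bound_large {N : ℝ} (hN : 1.274 ≤ N) :
    1 / Real.pi * (√(Real.pi / (N / 2)) / 2 -
        (1 - Real.exp (-(N / 2) * Real.pi ^ 2)) / (2 * (N / 2) * Real.pi) +
      1 / 8 * (√(Real.pi / (N / 2)) / (4 * (N / 2))) +
      Real.exp (-(N * (Real.pi / 2) ^ 2 / 2)) * (N * (Real.pi / 2) ^ 2 / 2 + 1) /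
        (2 * (N * (Real.pi / 2) ^ 2 / 2) * (N * (Real.pi / 2) ^ 2 / 2 + 2)) +
      1.04 / 1.885 * (√(Real.pi / (0.23987 * N)) / 2 - √(Real.pi / (N / 2)) / 2) +
      1.182 / Real.pi *
        ((1 - Real.exp (-(N / 2) * (Real.pi - 1.885) ^ 2)) / (2 * (N / 2)))) ≤
      0.56442 / √N := by
  have hpi := Real.pi_pos
  have hpl := Real.pi_gt_d6
  have hpu := Real.pi_lt_d6
  have hN0 : 0 < N := by linarith
  set q := √N with hq
  have hq0 : 0 < q := Real.sqrt_pos.2 hN0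
  have hqq : q ^ 2 = N := Real.sq_sqrt hN0.le
  have hq1 : 1.1287 ≤ q := Real.le_sqrt_of_sq_le (by linarith)
  have hp2l : 9.8696 ≤ Real.pi ^ 2 := by nlinarith
  have hA : √(Real.pi / (N / 2)) ≤ 2.50664 / q := by
    rw [show Real.pi / (N / 2) = 2 * Real.pi / N by field_simp]
    exact sqrt_const_div_le N (by norm_num) (by nlinarith) hN0.le
  have hB : √(Real.pi / (0.23987 * N)) ≤ 3.6191 / q := by
    rw [show Real.pi / (0.23987 * N) = Real.pi / 0.23987 / N by field_simp]
    exact sqrt_const_div_le N (by norm_num)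
      (by rw [div_le_iff₀ (by norm_num)]; nlinarith) hN0.le
  set A := √(Real.pi / (N / 2))
  set B := √(Real.pi / (0.23987 * N))
  set w := N * (Real.pi / 2) ^ 2 / 2 with hw
  have hw1 : 1.2337 * N ≤ w := by rw [hw]; nlinarith
  have hw0 : 0 < w := by linarith
  have hE : Real.exp (-w) ≤ 0.2085 :=
    (Real.exp_le_exp.2 (by linarith)).trans exp_neg_one_point_five_seven_le
  have hT : Real.exp (-w) * (w + 1) / (2 * w * (w + 2)) ≤ 0.0749 / q := by
    have h1 : (w + 1) / (2 * w * (w + 2)) ≤ 0.35909 / q := by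
      rw [div_le_div_iff₀ (by positivity) hq0]
      have h2 : q ≤ 0.71818 * w := by nlinarith
      nlinarith
    calc _ = Real.exp (-w) * ((w + 1) / (2 * w * (w + 2))) := by ring
      _ ≤ 0.2085 * (0.35909 / q) := by gcongr
      _ = (0.2085 * 0.35909) / q := by ring
      _ ≤ 0.0749 / q := by gcongr; norm_num
  set e := Real.exp (-(N / 2) * Real.pi ^ 2)
  set x := Real.exp (-(N / 2) * (Real.pi - 1.885) ^ 2)
  have hx0 : 0 < x := Real.exp_pos _
  have hZ : 1.182 / Real.pi * ((1 - x) / (2 * (N / 2))) - (1 - e) / (2 * (N / 2) * Real.pi) +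
      1 / 8 * (A / (4 * (N / 2))) ≤ 0.1231 / q := by
    have h8 : 1 / 8 * (A / (4 * (N / 2))) ≤ 0.15667 / N / q := by
      calc _ = 1 / 16 / N * A := by field_simp; ring
        _ ≤ 1 / 16 / N * (2.50664 / q) := by gcongr
        _ = (1 / 16 * 2.50664) / N / q := by ring
        _ ≤ 0.15667 / N / q := by gcongr; norm_num
    have hz : 1.182 / Real.pi * ((1 - x) / (2 * (N / 2))) - (1 - e) / (2 * (N / 2) * Real.pi) =
        (0.182 + e - 1.182 * x) / (Real.pi * q) / q := by
      rw [← hqq]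
      field_simp
      ring
    rw [hz]
    have hsum : (0.182 + e - 1.182 * x) / (Real.pi * q) + 0.15667 / N ≤ 0.1231 := by
      rcases le_or_gt N 2 with h | h
      · have he : e ≤ 0.01832 :=
          (Real.exp_le_exp.2 (by nlinarith)).trans exp_neg_four_le
        have hx : 0.2 ≤ x := by
          refine exp_neg_one_point_six_ge.trans (Real.exp_le_exp.2 ?_)
          have : (Real.pi - 1.885) ^ 2 ≤ 1.6 := by nlinarith
          nlinarith
        have h1 : (0.182 + e - 1.182 * x) / (Real.pi * q) ≤ 0 :=
          div_nonpos_of_nonpos_of_nonneg (by linarith) (by positivity)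
        have h2 : 0.15667 / N ≤ 0.123 := by
          rw [div_le_iff₀ hN0]
          linarith
        linarith
      · have he : e ≤ 0.01832 ^ 2 := by
          have h4 := pow_le_pow_left₀ (Real.exp_pos _).le exp_neg_four_le 2
          rw [← Real.exp_nat_mul] at h4
          refine le_trans (Real.exp_le_exp.2 ?_) h4
          push_cast
          nlinarith
        have hq2 : 1.414 ≤ q := Real.le_sqrt_of_sq_le (by linarith)
        have h1 : (0.182 + e - 1.182 * x) / (Real.pi * q) ≤ 0.0411 := by
          rw [div_le_iff₀ (by positivity)]
          have : 3.1415 * 1.414 ≤ Real.pi * q := by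
            apply mul_le_mul <;> linarith
          linarith
        have h2 : 0.15667 / N ≤ 0.0784 := by
          rw [div_le_iff₀ hN0]
          linarith
        linarith
    have := div_le_div_of_nonneg_right hsum hq0.le
    rw [add_div] at this
    linarith
  have hcA : A * (1 / 2 - 1.04 / 1.885 / 2) ≤ 2.50664 / q * (1 / 2 - 1.04 / 1.885 / 2) :=
    mul_le_mul_of_nonneg_right hA (by norm_num)
  have hcB : B * (1.04 / 1.885 / 2) ≤ 3.6191 / q * (1.04 / 1.885 / 2) :=
    mul_le_mul_of_nonneg_right hB (by norm_num)
  have hfin : A / 2 - (1 - e) / (2 * (N / 2) * Real.pi) + 1 / 8 * (A / (4 * (N / 2))) +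
      Real.exp (-w) * (w + 1) / (2 * w * (w + 2)) + 1.04 / 1.885 * (B / 2 - A / 2) +
      1.182 / Real.pi * ((1 - x) / (2 * (N / 2))) ≤ 1.773 / q := by
    have : 1.773 / q = 1.773 * (1 / q) := by ring
    have h1 : 0 < 1 / q := by positivity
    have e1 : 2.50664 / q = 2.50664 * (1 / q) := by ring
    have e2 : 3.6191 / q = 3.6191 * (1 / q) := by ring
    have e3 : 0.0749 / q = 0.0749 * (1 / q) := by ring
    have e4 : 0.1231 / q = 0.1231 * (1 / q) := by ring
    rw [e1] at hcA
    rw [e2] at hcB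
    rw [e3] at hT
    rw [e4] at hZ
    rw [this]
    linarith
  calc _ ≤ 1 / Real.pi * (1.773 / q) := by gcongr
    _ ≤ 0.31832 * (1.773 / q) := by gcongr; exact one_div_pi_le
    _ = 0.31832 * 1.773 / q := by ring
    _ ≤ 0.56442 / q := by gcongr; norm_num

/-- One-sided Berry–Esseen bound when the third absolute moment is large. -/
lemma cdf_sub_le_of_large (μ : Measure ℝ) [IsProbabilityMeasure μ]
    (hμ : Integrable (fun y => y) μ) (g : ℝ → ℝ) (hg : Continuous g) {n k : ℕ}
    (hnk : n = 2 * k) (hk : 1 ≤ k)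
    (hcos : ∀ t, ∫ y, Real.cos (t * y) ∂μ = g (t / √n) ^ n)
    (hsin : ∀ t, ∫ y, Real.sin (t * y) ∂μ = 0) {ρ : ℝ} (hρ : 1.38 ≤ ρ)
    (hlo : ∀ s, 0 < s → s ≤ Real.pi → Real.cos s ≤ g s)
    (hup : ∀ s, 0 < s → g s ≤ 1 - s ^ 2 / 2 + ρ / 10 * s ^ 3)
    (hN : 1.274 ≤ n / (ρ / 1.38) ^ 2) (x : ℝ) :
    μ.real (Set.Iic x) - stdNormalCDF x ≤ 0.409 * ρ / √n := by
  have hpi := Real.pi_pos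
  have hpl := Real.pi_gt_d4
  have hn1 : (0 : ℝ) < n := by exact_mod_cast (by omega : 0 < n)
  set r := ρ / 1.38 with hr
  have hr1 : 1 ≤ r := by rw [hr, le_div_iff₀ (by norm_num)]; linarith
  have hr0 : 0 < r := by linarith
  have hsn : 0 < √(n : ℝ) := Real.sqrt_pos.2 hn1
  set N := (n : ℝ) / r ^ 2 with hNdef
  have hN0 : 0 < N := by linarith
  have hc : 0 < √N := Real.sqrt_pos.2 hN0
  have hsq : √N ^ 2 = N := Real.sq_sqrt hN0.le
  have hcr : √N = √n / r := by
    rw [hNdef, Real.sqrt_div hn1.le, Real.sqrt_sq hr0.le]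
  have htail := integral_gaussian_tail_split hc (s₁ := Real.pi / 2) (by linarith) (by linarith)
  have hI1 := integralLe_one_sub_mul_gaussian (b := N / 2) (by linarith)
  have hI2 : IntegralLe (Set.Ioo 0 Real.pi) (fun s => s ^ 2 * Real.exp (-(N / 2) * s ^ 2))
      (√(Real.pi / (N / 2)) / (4 * (N / 2))) :=
    IntegralLe.of_Ioi (integrable_pow_mul_exp_neg_mul_sq (by positivity) 2).integrableOn
      (fun s hs => by positivity) (integral_sq_mul_exp_neg_mul_sq (by positivity)).le
      Set.Ioo_subset_Ioi_self
  have hI4 := integralLe_gaussian_sub (a := 0.23987 * N) (b := N / 2) (by linarith) (by linarith)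
  have hI5 := (integralLe_ite (s₁ := Real.pi - 1.885) (by linarith)
    (integralLe_mul_exp_neg_mul_sq (b := N / 2) (by linarith) (by linarith))).reflect
  have hW := (((hI1.add (hI2.const_mul (k := 1 / 8) (by positivity))).add htail).add
    (hI4.const_mul (k := 1.04 / 1.885) (by positivity))).add
    (hI5.const_mul (k := 1.182 / Real.pi) (by positivity))
  have hmain := cdf_sub_stdNormalCDF_le μ hμ (fun t => g (t / √n) ^ n)
    (by fun_prop) hcos hsin (√N) x hc _ hW.1 ?_
  · have htl := integral_Ioi_exp_neg_sq_div_le hc (a := Real.pi / 2) (by linarith)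
    have h2 := hW.2
    have h3 := mul_le_mul_of_nonneg_left (add_le_add_left h2
      (∫ s in Set.Ioi Real.pi, Real.exp (-(√N ^ 2 * s ^ 2 / 2)) / s))
      (by positivity : 0 ≤ 1 / Real.pi)
    rw [hsq] at htl h3 hmain
    have h4 := mul_le_mul_of_nonneg_left htl (by positivity : 0 ≤ 1 / Real.pi)
    have h5 := smoothing_bound_large hN
    have h6 : 0.56442 / √N = 0.409 * ρ / √n := by
      rw [hcr, hr]
      field_simp
      norm_num
    rw [h6] at h5
    refine (hmain.trans h3).trans (le_trans ?_ h5)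
    linarith
  · intro s hs y
    have hgs : √N * s / √n = s / r := by
      rw [hcr]
      field_simp
    simp only [hgs, hsq]
    have hs0 := hs.1
    have hsr : 0 < s / r := div_pos hs.1 hr0
    refine smoothing_integrand_le_of_large hnk hk hs.1 hs.2 hr1 hNdef
      (hlo _ hsr ((div_le_self hs.1.le hr1).trans hs.2.le)) ((hup _ hsr).trans_eq ?_) y
    rw [hr]
    ring

lemma stdNormalCDF_mono {x y : ℝ} (h : x ≤ y) : stdNormalCDF x ≤ stdNormalCDF y :=
  measureReal_mono (μ := gaussianReal 0 1) (Set.Iic_subset_Iic.2 h)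

lemma stdNormalCDF_nonneg (x : ℝ) : 0 ≤ stdNormalCDF x := ENNReal.toReal_nonneg

lemma stdNormalCDF_zero : stdNormalCDF 0 = 1 / 2 := by
  have := stdNormalCDF_neg 0
  rw [neg_zero] at this
  linarith

lemma one_div_sqrt_two_pi_bounds : 0.39 ≤ 1 / √(2 * Real.pi) ∧ 1 / √(2 * Real.pi) ≤ 0.39895 := by
  have hl := Real.pi_gt_d6
  have hu := Real.pi_lt_d6
  have h1 : 2.5066 ≤ √(2 * Real.pi) := Real.le_sqrt_of_sq_le (by linarith)
  have h2 : √(2 * Real.pi) ≤ 2.56 := (Real.sqrt_le_left (by norm_num)).2 (by linarith)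
  constructor
  · rw [le_div_iff₀ (by linarith)]
    linarith
  · rw [div_le_iff₀ (by linarith)]
    linarith

lemma stdNormalCDF_sub_half_le {z : ℝ} (hz : 0 ≤ z) : stdNormalCDF z - 1 / 2 ≤ 0.39895 * z := by
  rw [stdNormalCDF_sub_half]
  have h : ∫ y in (0 : ℝ)..z, Real.exp (-(y ^ 2 / 2)) ≤ ∫ _y in (0 : ℝ)..z, (1 : ℝ) := by
    refine intervalIntegral.integral_mono_on hz
      (Continuous.intervalIntegrable (by fun_prop) _ _) (by simp) fun y _ => ?_
    rw [Real.exp_le_one_iff]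
    nlinarith [sq_nonneg y]
  simp only [intervalIntegral.integral_const, sub_zero, smul_eq_mul, mul_one] at h
  calc _ ≤ 1 / √(2 * Real.pi) * z := by gcongr
    _ ≤ 0.39895 * z := by gcongr; exact one_div_sqrt_two_pi_bounds.2

lemma stdNormalCDF_half_ge : 0.1 ≤ stdNormalCDF (1 / 2) - 1 / 2 := by
  rw [stdNormalCDF_sub_half]
  have h : ∫ _y in (0 : ℝ)..(1 / 2), (0.875 : ℝ) ≤
      ∫ y in (0 : ℝ)..(1 / 2), Real.exp (-(y ^ 2 / 2)) := by
    refine intervalIntegral.integral_mono_on (by norm_num) (by simp)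
      (Continuous.intervalIntegrable (by fun_prop) _ _) fun y hy => ?_
    have := Real.add_one_le_exp (-(y ^ 2 / 2))
    have h2 : y ^ 2 ≤ (1 / 2) ^ 2 := pow_le_pow_left₀ hy.1 hy.2 2
    linarith
  simp only [intervalIntegral.integral_const, sub_zero, smul_eq_mul] at h
  have := mul_le_mul one_div_sqrt_two_pi_bounds.1 h (by norm_num) (by positivity)
  linarith

lemma real_neg_preimage {μ : Measure ℝ} (hsym : μ.map (fun y => -y) = μ) {s : Set ℝ} (hs : MeasurableSet s) :
    μ.real ((fun y => -y) ⁻¹' s) = μ.real s := by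
  conv_rhs => rw [← hsym]
  rw [map_measureReal_apply measurable_neg hs]

section Symmetric

variable {μ : Measure ℝ} [IsProbabilityMeasure μ]

lemma two_mul_real_Iic_neg (hsym : μ.map (fun y => -y) = μ) {z : ℝ} (hz : 0 < z) :
    2 * μ.real (Set.Iic (-z)) = μ.real {y | z ≤ |y|} := by
  have h1 := real_neg_preimage hsym (measurableSet_Iic (a := -z))
  have h2 : (fun y : ℝ => -y) ⁻¹' Set.Iic (-z) = Set.Ici z := by
    ext y
    simp
  have h3 : {y : ℝ | z ≤ |y|} = Set.Iic (-z) ∪ Set.Ici z := by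
    ext y
    simp only [Set.mem_ofPred_eq, le_abs, Set.mem_union, Set.mem_Iic, Set.mem_Ici]
    constructor <;> rintro (h | h)
    · exact Or.inr h
    · exact Or.inl (by linarith)
    · exact Or.inr (by linarith)
    · exact Or.inl h
  have hdis : Disjoint (Set.Iic (-z)) (Set.Ici z) := by
    rw [Set.Iic_disjoint_Ici]
    linarith
  rw [h3, measureReal_union hdis measurableSet_Ici, ← h2, h1]
  ring

lemma two_mul_real_Ioi (hsym : μ.map (fun y => -y) = μ) {x : ℝ} (hx : 0 ≤ x) :
    2 * μ.real (Set.Ioi x) = μ.real {y | x < |y|} := by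
  have h1 := real_neg_preimage hsym (measurableSet_Ioi (a := x))
  have h2 : (fun y : ℝ => -y) ⁻¹' Set.Ioi x = Set.Iio (-x) := by
    ext y
    simp only [Set.mem_preimage, Set.mem_Ioi, Set.mem_Iio]
    constructor <;> intro h <;> linarith
  have h3 : {y : ℝ | x < |y|} = Set.Iio (-x) ∪ Set.Ioi x := by
    ext y
    simp only [Set.mem_ofPred_eq, lt_abs, Set.mem_union, Set.mem_Iio, Set.mem_Ioi]
    constructor <;> rintro (h | h)
    · exact Or.inr h
    · exact Or.inl (by linarith)
    · exact Or.inr (by linarith)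
    · exact Or.inl h
  have hdis : Disjoint (Set.Iio (-x)) (Set.Ioi x) :=
    Set.disjoint_left.2 fun y h h' => by
      simp only [Set.mem_Iio, Set.mem_Ioi] at h h'
      linarith
  rw [h3, measureReal_union hdis measurableSet_Ioi, ← h2, h1]
  ring

lemma cdf_sub_stdNormalCDF_le_half (hsym : μ.map (fun y => -y) = μ) (x : ℝ) :
    μ.real (Set.Iic x) - stdNormalCDF x ≤ 1 / 2 := by
  rcases le_or_gt 0 x with hx | hx
  · have h1 := stdNormalCDF_mono hx
    rw [stdNormalCDF_zero] at h1
    have h2 : μ.real (Set.Iic x) ≤ 1 := measureReal_le_one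
    linarith
  · have h1 := two_mul_real_Iic_neg hsym (neg_pos.2 hx)
    rw [neg_neg] at h1
    have h2 : μ.real {y : ℝ | -x ≤ |y|} ≤ 1 := measureReal_le_one
    have h3 := stdNormalCDF_nonneg x
    linarith

/-- A one-sided bound yields the two-sided bound for a symmetric law. -/
lemma abs_cdf_sub_le (hsym : μ.map (fun y => -y) = μ) {B : ℝ}
    (h : ∀ x, μ.real (Set.Iic x) - stdNormalCDF x ≤ B) (x : ℝ) :
    |μ.real (Set.Iic x) - stdNormalCDF x| ≤ B := by
  rw [abs_le']
  refine ⟨h x, ?_⟩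
  have h1 := h (-x)
  have h2 := real_neg_preimage hsym (measurableSet_Iic (a := -x))
  have h3 : (fun y : ℝ => -y) ⁻¹' Set.Iic (-x) = Set.Ici x := by
    ext y
    simp
  have h4 : (1 : ℝ) ≤ μ.real (Set.Iic x) + μ.real (Set.Ici x) := by
    have := measureReal_union_le (μ := μ) (Set.Iic x) (Set.Ici x)
    rwa [Set.Iic_union_Ici, probReal_univ] at this
  rw [stdNormalCDF_neg] at h1
  rw [h3] at h2
  linarith

/-- Lower bound for the mass away from the origin in terms of the third absolute moment. -/
lemma one_sub_sq_cube_le {ρ : ℝ} (hi : Integrable (fun y => |y| ^ 3) μ)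
    (m2 : ∫ y, y ^ 2 ∂μ = 1) (m3 : ∫ y, |y| ^ 3 ∂μ = ρ) {x : ℝ} (hx : 0 ≤ x) (hx1 : x < 1) :
    (1 - x ^ 2) ^ 3 ≤ μ.real {y | x < |y|} * ρ ^ 2 := by
  have hρ := one_le_third_moment hi m2 m3
  set c := 1 - x ^ 2 with hc
  have hc0 : 0 < c := by nlinarith
  set k := c / ρ with hk
  have hk0 : 0 < k := by positivity
  have hms : MeasurableSet {y : ℝ | x < |y|} := measurableSet_lt (by fun_prop) (by fun_prop)
  have hind : Integrable ({y : ℝ | x < |y|}.indicator fun _ => 1 / (3 * k ^ 2)) μ :=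
    (integrable_const _).indicator hms
  have h := integral_mono (integrable_sq_of_cube hi)
    (((integrable_const (x ^ 2)).add (hi.const_mul (2 * k / 3))).add hind) fun y => ?_
  · have e : ∫ y, (((fun _ => x ^ 2) + (fun y => 2 * k / 3 * |y| ^ 3) +
        {y : ℝ | x < |y|}.indicator fun _ => 1 / (3 * k ^ 2) : ℝ → ℝ)) y ∂μ =
        x ^ 2 + 2 * k / 3 * ρ + μ.real {y : ℝ | x < |y|} * (1 / (3 * k ^ 2)) := by
      have h1 : Integrable ((fun _ : ℝ => x ^ 2) + fun y => 2 * k / 3 * |y| ^ 3) μ :=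
        (integrable_const _).add (hi.const_mul _)
      rw [integral_add' h1 hind, integral_add' (integrable_const _) (hi.const_mul _),
        integral_const_mul, m3, integral_indicator_const _ hms]
      simp
    rw [e, m2] at h
    have e2 : 2 * k / 3 * ρ = 2 * c / 3 := by
      rw [hk]
      field_simp
    have e3 : μ.real {y : ℝ | x < |y|} * (1 / (3 * k ^ 2)) =
        μ.real {y : ℝ | x < |y|} * ρ ^ 2 / (3 * c ^ 2) := by
      rw [hk]
      field_simp
    rw [e2, e3] at h
    have h5 : c / 3 ≤ μ.real {y : ℝ | x < |y|} * ρ ^ 2 / (3 * c ^ 2) := by linarith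
    rw [le_div_iff₀ (by positivity)] at h5
    nlinarith
  · simp only [Pi.add_apply]
    by_cases hy : x < |y|
    · rw [Set.indicator_of_mem (by exact hy)]
      have h1 : y ^ 2 ≤ 2 * k / 3 * |y| ^ 3 + 1 / (3 * k ^ 2) := by
        rw [← sq_abs]
        set a := |y|
        have ha : 0 ≤ a := abs_nonneg y
        have h2 : 0 ≤ (k * a - 1) ^ 2 * (2 * (k * a) + 1) / (3 * k ^ 2) := by positivity
        have h3 : (k * a - 1) ^ 2 * (2 * (k * a) + 1) / (3 * k ^ 2) =
            2 * k / 3 * a ^ 3 + 1 / (3 * k ^ 2) - a ^ 2 := by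
          field_simp
          ring
        linarith
      nlinarith [sq_nonneg x]
    · rw [Set.indicator_of_notMem (by exact hy), add_zero]
      have h1 : y ^ 2 ≤ x ^ 2 := by
        rw [← sq_abs]
        exact pow_le_pow_left₀ (abs_nonneg y) (not_lt.1 hy) 2
      have : 0 ≤ 2 * k / 3 * |y| ^ 3 := by positivity
      linarith

/-- The one-sided bound for a single symmetric variable. -/
lemma cdf_sub_le_of_single (hsym : μ.map (fun y => -y) = μ) {ρ : ℝ}
    (hi : Integrable (fun y => |y| ^ 3) μ)
    (m2 : ∫ y, y ^ 2 ∂μ = 1) (m3 : ∫ y, |y| ^ 3 ∂μ = ρ) (x : ℝ) :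
    μ.real (Set.Iic x) - stdNormalCDF x ≤ 0.409 * ρ := by
  have hρ := one_le_third_moment hi m2 m3
  rcases le_or_gt 0 x with hx | hx
  · have hF : μ.real (Set.Iic x) = 1 - μ.real (Set.Ioi x) := by
      rw [← Set.compl_Iic, probReal_compl_eq_one_sub measurableSet_Iic]
      ring
    have hP := two_mul_real_Ioi hsym hx
    rcases le_or_gt (1 / 2) x with h | h
    · have h1 := stdNormalCDF_mono h
      have h2 := stdNormalCDF_half_ge
      have h3 : μ.real (Set.Iic x) ≤ 1 := measureReal_le_one
      linarith
    · have h1 := stdNormalCDF_mono hx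
      rw [stdNormalCDF_zero] at h1
      have h2 := one_sub_sq_cube_le hi m2 m3 hx (by linarith)
      set P := μ.real {y : ℝ | x < |y|}
      have h3 : 0.42 ≤ (1 - x ^ 2) ^ 3 := by
        have : (0.75 : ℝ) ≤ 1 - x ^ 2 := by nlinarith
        have := pow_le_pow_left₀ (by norm_num) this 3
        norm_num at this ⊢
        linarith
      have h4 : (1 - P) / 2 ≤ 0.409 * ρ := by
        by_contra hcon
        push Not at hcon
        have h5 : (0.409 * ρ) * ρ ^ 2 < (1 - P) / 2 * ρ ^ 2 := by gcongr
        nlinarith [mul_nonneg (sq_nonneg ρ) (sub_nonneg.2 hρ), mul_nonneg (sub_nonneg.2 hρ) (sub_nonneg.2 hρ)]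
      linarith
  · have hP := two_mul_real_Iic_neg hsym (neg_pos.2 hx)
    rw [neg_neg] at hP
    have hΦ := stdNormalCDF_neg (-x)
    rw [neg_neg] at hΦ
    set z := -x with hz
    have hz0 : 0 < z := neg_pos.2 hx
    have hS := stdNormalCDF_sub_half_le hz0.le
    have hS1 := stdNormalCDF_nonneg x
    have hP1 : μ.real {y : ℝ | z ≤ |y|} ≤ 1 := measureReal_le_one
    have hcheb : z ^ 2 * μ.real {y : ℝ | z ≤ |y|} ≤ 1 := by
      have hms : MeasurableSet {y : ℝ | z ≤ |y|} := measurableSet_le (by fun_prop) (by fun_prop)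
      have h := integral_mono ((integrable_const (z ^ 2)).indicator hms)
        (integrable_sq_of_cube hi) fun y => ?_
      · rw [integral_indicator_const _ hms, m2, smul_eq_mul] at h
        linarith
      · refine Set.indicator_le' (fun y hy => ?_) (fun y _ => sq_nonneg y) y
        rw [← sq_abs y]
        exact pow_le_pow_left₀ hz0.le hy 2
    set P := μ.real {y : ℝ | z ≤ |y|}
    rcases le_or_gt z 1 with h | h
    · linarith
    rcases le_or_gt 1.11 z with h' | h'
    · have : 1.2225 * P ≤ 1 := by
        have hP0 : 0 ≤ P := measureReal_nonneg
        nlinarith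
      linarith
    · suffices P / 2 ≤ 0.909 - 0.39895 * z by linarith
      by_contra hcon
      push Not at hcon
      have : z ^ 2 * (0.909 - 0.39895 * z) < z ^ 2 * (P / 2) := by gcongr
      nlinarith [mul_nonneg (sub_nonneg.2 h.le) (sub_nonneg.2 h'.le),
        mul_nonneg (mul_nonneg (sub_nonneg.2 h.le) (sub_nonneg.2 h'.le)) hz0.le]

end Symmetric

/-- A Hadamard matrix of order greater than two has order divisible by four. -/
lemma hadamard_order {d : ℕ} (H : Matrix (Fin d) (Fin d) ℝ)
    (hent : ∀ i j, H i j = 1 ∨ H i j = -1) (hHHt : H * Hᵀ = (d : ℝ) • 1) (hd : 3 ≤ d) :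
    4 ∣ d := by
  have hrow : ∀ i j, ∑ k, H i k * H j k = if i = j then (d : ℝ) else 0 := by
    intro i j
    have h := congrFun (congrFun hHHt i) j
    simpa [Matrix.mul_apply, Matrix.one_apply] using h
  let a : Fin d := ⟨0, by omega⟩
  let b : Fin d := ⟨1, by omega⟩
  let c : Fin d := ⟨2, by omega⟩
  have hab : a ≠ b := by simp [a, b, Fin.ext_iff]
  have hac : a ≠ c := by simp [a, c, Fin.ext_iff]
  have hbc : b ≠ c := by simp [b, c, Fin.ext_iff]
  have hsum : ∑ k, (H a k + H b k) * (H a k + H c k) = d := by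
    have e : ∀ k, (H a k + H b k) * (H a k + H c k) =
        H a k * H a k + H a k * H c k + H a k * H b k + H b k * H c k := fun k => by ring
    simp only [e, Finset.sum_add_distrib, hrow]
    simp [hab, hac, hbc]
  have hterm : ∀ k, (H a k + H b k) * (H a k + H c k) =
      if H a k = H b k ∧ H a k = H c k then 4 else 0 := by
    intro k
    rcases hent a k with h1 | h1 <;> rcases hent b k with h2 | h2 <;>
      rcases hent c k with h3 | h3 <;> rw [h1, h2, h3] <;> norm_num
  simp only [hterm] at hsum
  rw [← Finset.sum_filter, Finset.sum_const, nsmul_eq_mul] at hsum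
  refine Dvd.intro_left _ (?_ : (Finset.univ.filter fun k =>
    H a k = H b k ∧ H a k = H c k).card * 4 = d)
  exact_mod_cast hsum

instance : IsProbabilityMeasure radMeasure := by
  constructor
  simp only [radMeasure, Measure.coe_add, Pi.add_apply, Measure.smul_apply, measure_univ,
    smul_eq_mul, mul_one, ENNReal.inv_two_add_inv_two]

instance (d : ℕ) (ν : Measure ℝ) [IsProbabilityMeasure ν] : IsProbabilityMeasure (pairPi d ν) := by
  unfold pairPi
  infer_instance

lemma integral_radMeasure (f : ℝ → ℂ) :
    ∫ b, f b ∂radMeasure = (f 1 + f (-1)) / 2 := by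
  have h1 : ∀ x : ℝ, Integrable f ((2 : ℝ≥0∞)⁻¹ • Measure.dirac x) := fun x =>
    (integrable_dirac (by simp)).smul_measure (by simp)
  rw [radMeasure, integral_add_measure (h1 _) (h1 _), integral_smul_measure,
    integral_smul_measure, integral_dirac, integral_dirac]
  simp
  ring

lemma ae_radMeasure : ∀ᵐ b ∂radMeasure, |b| = 1 := by
  rw [radMeasure, ae_add_measure_iff]
  constructor <;>
  · refine Measure.ae_smul_measure ?_ _
    rw [ae_dirac_iff (measurableSet_eq_fun (by fun_prop) (by fun_prop))]
    simp

lemma integrable_mul_prod_radMeasure {ν : Measure ℝ} [SFinite ν] (h1 : Integrable (fun a => a) ν) :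
    Integrable (fun p : ℝ × ℝ => p.1 * p.2) (ν.prod radMeasure) := by
  refine (h1.comp_fst radMeasure).mono (by fun_prop) ?_
  filter_upwards [Measure.quasiMeasurePreserving_snd.ae ae_radMeasure] with p hp
  rw [norm_mul, Real.norm_eq_abs p.2, hp, mul_one]

section CoordLaw

variable {ν : Measure ℝ} [IsProbabilityMeasure ν]

lemma integral_exp_prod_radMeasure (u : ℝ) :
    ∫ p : ℝ × ℝ, Complex.exp ((u * (p.1 * p.2) : ℝ) * Complex.I) ∂(ν.prod radMeasure) =
      ((∫ a, Real.cos (u * a) ∂ν : ℝ) : ℂ) := by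
  rw [integral_prod, ← integral_complex_ofReal]
  · refine integral_congr_ae (ae_of_all _ fun a => ?_)
    simp only [integral_radMeasure]
    rw [Complex.ofReal_cos, Complex.cos]
    push_cast
    ring_nf
  · refine Integrable.of_bound (by fun_prop) 1 (ae_of_all _ fun p => ?_)
    rw [Complex.norm_exp_ofReal_mul_I]

lemma integral_exp_rhCoord {d : ℕ} (H : Matrix (Fin d) (Fin d) ℝ)
    (hent : ∀ i j, H i j = 1 ∨ H i j = -1) (i : Fin d) (u : ℝ) :
    ∫ w, Complex.exp ((u * rhCoord H i w : ℝ) * Complex.I) ∂(pairPi d ν) =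
      ((∫ a, Real.cos (u / √d * a) ∂ν : ℝ) : ℂ) ^ d := by
  have h1 : ∀ w : Fin d → ℝ × ℝ, Complex.exp ((u * rhCoord H i w : ℝ) * Complex.I) =
      ∏ j, Complex.exp ((u / √d * H i j * ((w j).1 * (w j).2) : ℝ) * Complex.I) := by
    intro w
    rw [← Complex.exp_sum, ← Finset.sum_mul, ← Complex.ofReal_sum, rhCoord]
    congr 3
    rw [← mul_assoc, Finset.mul_sum]
    refine Finset.sum_congr rfl fun j _ => ?_
    ring
  have h2 : ∀ j, ∫ p : ℝ × ℝ, Complex.exp ((u / √d * H i j * (p.1 * p.2) : ℝ) * Complex.I)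
      ∂(ν.prod radMeasure) = ((∫ a, Real.cos (u / √d * a) ∂ν : ℝ) : ℂ) := by
    intro j
    rw [integral_exp_prod_radMeasure]
    rcases hent i j with h | h <;> simp [h]
  simp only [h1]
  rw [pairPi, integral_fintype_prod_eq_prod
    (f := fun j (p : ℝ × ℝ) => Complex.exp ((u / √d * H i j * (p.1 * p.2) : ℝ) * Complex.I))]
  simp only [h2, Finset.prod_const, Finset.card_univ, Fintype.card_fin]

@[fun_prop]
lemma measurable_rhCoord {d : ℕ} (H : Matrix (Fin d) (Fin d) ℝ) (i : Fin d) :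
    Measurable (rhCoord H i) := by
  unfold rhCoord
  fun_prop

/-- The law of the normalized coordinate. -/
noncomputable def coordLaw {d : ℕ} (H : Matrix (Fin d) (Fin d) ℝ) (i : Fin d) (ν : Measure ℝ)
    (σ : ℝ) : Measure ℝ :=
  (pairPi d ν).map fun w => 1 / σ * rhCoord H i w

instance {d : ℕ} (H : Matrix (Fin d) (Fin d) ℝ) (i : Fin d) (σ : ℝ) :
    IsProbabilityMeasure (coordLaw H i ν σ) :=
  Measure.isProbabilityMeasure_map (by fun_prop)

lemma integral_exp_coordLaw {d : ℕ} (H : Matrix (Fin d) (Fin d) ℝ)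
    (hent : ∀ i j, H i j = 1 ∨ H i j = -1) (i : Fin d) (σ t : ℝ) :
    ∫ y, Complex.exp ((t * y : ℝ) * Complex.I) ∂(coordLaw H i ν σ) =
      (((∫ a, Real.cos (t / √d * (a / σ)) ∂ν) ^ d : ℝ) : ℂ) := by
  rw [coordLaw, integral_map (by fun_prop) (by fun_prop)]
  have h := integral_exp_rhCoord (ν := ν) H hent i (t / σ)
  rw [Complex.ofReal_pow]
  convert h using 6
  · ring
  · ring_nf

lemma integrable_exp_mul_I (μ : Measure ℝ) [IsProbabilityMeasure μ] (t : ℝ) :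
    Integrable (fun y : ℝ => Complex.exp ((t * y : ℝ) * Complex.I)) μ := by
  refine Integrable.of_bound (by fun_prop) 1 (ae_of_all _ fun p => ?_)
  rw [Complex.norm_exp_ofReal_mul_I]

lemma integral_cos_coordLaw {d : ℕ} (H : Matrix (Fin d) (Fin d) ℝ)
    (hent : ∀ i j, H i j = 1 ∨ H i j = -1) (i : Fin d) (σ t : ℝ) :
    ∫ y, Real.cos (t * y) ∂(coordLaw H i ν σ) = (∫ a, Real.cos (t / √d * (a / σ)) ∂ν) ^ d := by
  have h := congrArg Complex.re (integral_exp_coordLaw (ν := ν) H hent i σ t)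
  rw [← RCLike.re_eq_complex_re, ← integral_re (integrable_exp_mul_I _ t)] at h
  simpa only [RCLike.re_eq_complex_re, Complex.exp_ofReal_mul_I_re, Complex.ofReal_re] using h

lemma integral_sin_coordLaw {d : ℕ} (H : Matrix (Fin d) (Fin d) ℝ)
    (hent : ∀ i j, H i j = 1 ∨ H i j = -1) (i : Fin d) (σ t : ℝ) :
    ∫ y, Real.sin (t * y) ∂(coordLaw H i ν σ) = 0 := by
  have h := congrArg Complex.im (integral_exp_coordLaw (ν := ν) H hent i σ t)
  rw [← RCLike.im_eq_complex_im, ← integral_im (integrable_exp_mul_I _ t)] at h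
  simpa only [RCLike.im_eq_complex_im, Complex.exp_ofReal_mul_I_im, Complex.ofReal_im] using h

lemma map_neg_coordLaw {d : ℕ} (H : Matrix (Fin d) (Fin d) ℝ)
    (hent : ∀ i j, H i j = 1 ∨ H i j = -1) (i : Fin d) (σ : ℝ) :
    (coordLaw H i ν σ).map (fun y => -y) = coordLaw H i ν σ := by
  have : IsProbabilityMeasure ((coordLaw H i ν σ).map fun y => -y) :=
    Measure.isProbabilityMeasure_map (by fun_prop)
  refine Measure.ext_of_charFun (funext fun t => ?_)
  rw [charFun_apply_real, charFun_apply_real, integral_map (by fun_prop) (by fun_prop)]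
  have h1 := integral_exp_coordLaw (ν := ν) H hent i σ t
  have h2 := integral_exp_coordLaw (ν := ν) H hent i σ (-t)
  push_cast at h1 h2 ⊢
  simp only [mul_neg, neg_mul] at h1 h2 ⊢
  rw [h1, h2]
  simp only [neg_div, neg_mul, Real.cos_neg]

lemma integrable_coordLaw {d : ℕ} (H : Matrix (Fin d) (Fin d) ℝ) (i : Fin d) (σ : ℝ)
    (h1 : Integrable (fun a => a) ν) : Integrable (fun y => y) (coordLaw H i ν σ) := by
  rw [coordLaw, integrable_map_measure (by fun_prop) (by fun_prop)]
  unfold rhCoord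
  refine ((integrable_finsetSum _ fun j _ => ?_).const_mul (1 / √d)).const_mul (1 / σ)
  have := ((measurePreserving_eval (fun _ : Fin d => ν.prod radMeasure) j).integrable_comp
    (by fun_prop)).2 ((integrable_mul_prod_radMeasure h1).const_mul (H i j))
  refine this.congr (ae_of_all _ fun w => ?_)
  simp only [Function.comp]
  ring

/-- In dimension one the absolute value of the coordinate has the law of `|x| / σ`. -/
lemma map_abs_coordLaw_one (H : Matrix (Fin 1) (Fin 1) ℝ)
    (hent : ∀ i j, H i j = 1 ∨ H i j = -1) (i : Fin 1) (σ : ℝ) :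
    (coordLaw H i ν σ).map (fun y => |y|) = (ν.map fun a => a / σ).map fun y => |y| := by
  have hev := measurePreserving_eval (fun _ : Fin 1 => ν.prod radMeasure) i
  have hfst : (ν.prod radMeasure).map Prod.fst = ν := by simp
  rw [coordLaw, Measure.map_map (by fun_prop) (by fun_prop),
    Measure.map_map (by fun_prop) (by fun_prop), pairPi]
  conv_rhs => rw [← hfst, ← hev.map_eq]
  rw [Measure.map_map (by fun_prop) (by fun_prop), Measure.map_map (by fun_prop) (by fun_prop)]
  refine Measure.map_congr ?_
  filter_upwards [hev.quasiMeasurePreserving.ae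
    (Measure.quasiMeasurePreserving_snd.ae ae_radMeasure)] with w hw
  have hH : |H i i| = 1 := by rcases hent i i with h | h <;> simp [h]
  have hi : ∀ f : Fin 1 → ℝ, ∑ j, f j = f i := fun f => by
    rw [Fin.sum_univ_one, Subsingleton.elim i 0]
  simp only [Function.comp, rhCoord, hi, abs_mul, hH, hw]
  simp [div_eq_inv_mul]

end CoordLaw

lemma integrable_id_of_cube {κ : Measure ℝ} [IsProbabilityMeasure κ]
    (h3 : Integrable (fun x => |x| ^ 3) κ) : Integrable (fun x => x) κ := by
  refine ((integrable_const (1 : ℝ)).add h3).mono' (by fun_prop) (ae_of_all _ fun x => ?_)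
  rw [Real.norm_eq_abs, Pi.add_apply]
  nlinarith [abs_nonneg x, sq_nonneg (|x| - 1), mul_nonneg (abs_nonneg x) (sq_nonneg (|x| - 1))]

lemma continuous_integral_cos_mul {κ : Measure ℝ} [IsProbabilityMeasure κ] :
    Continuous fun s => ∫ x, Real.cos (s * x) ∂κ := by
  refine continuous_of_dominated (bound := fun _ => 1) (fun s => by fun_prop)
    (fun s => ae_of_all _ fun x => Real.abs_cos_le_one _) (integrable_const _)
    (ae_of_all _ fun x => by fun_prop)

/-- The one-sided bound for even orders other than six. -/
lemma cdf_sub_le_of_even {μ κ : Measure ℝ} [IsProbabilityMeasure μ] [IsProbabilityMeasure κ]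
    (hsym : μ.map (fun y => -y) = μ) (hμ : Integrable (fun y => y) μ) {n : ℕ}
    (hn : n = 2 ∨ n = 4 ∨ ∃ m, n = 2 * m ∧ 8 ≤ n)
    (hcos : ∀ t, ∫ y, Real.cos (t * y) ∂μ = (∫ a, Real.cos (t / √n * a) ∂κ) ^ n)
    (hsin : ∀ t, ∫ y, Real.sin (t * y) ∂μ = 0) {ρ : ℝ}
    (h3 : Integrable (fun x => |x| ^ 3) κ) (m2 : ∫ x, x ^ 2 ∂κ = 1)
    (m3 : ∫ x, |x| ^ 3 ∂κ = ρ) (x : ℝ) :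
    μ.real (Set.Iic x) - stdNormalCDF x ≤ 0.409 * ρ / √n := by
  have hg : Continuous fun s => ∫ x, Real.cos (s * x) ∂κ := continuous_integral_cos_mul
  have hρ := one_le_third_moment h3 m2 m3
  rcases le_or_gt ρ 1.38 with h | h
  · have hup : ∀ s, 0 < s → ∫ x, Real.cos (s * x) ∂κ ≤ Real.cos s + (ρ - 1) / 6 * s ^ 3 :=
      fun s hs => charfn_le_cos_add h3 m2 m3 hs
    rw [show 0.409 * ρ / √n = 0.409 * (1 + (ρ - 1)) / √n by ring]
    have hlo : ∀ s, 0 < s → s ≤ Real.pi → Real.cos s ≤ ∫ x, Real.cos (s * x) ∂κ :=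
      fun s hs hsp => cos_le_charfn h3 m2 hs hsp
    rcases hn with hn | hn | ⟨m, hnm, hn⟩
    · exact cdf_sub_le_of_eq_two μ hμ _ hg hn hcos hsin (by linarith) (by linarith) hlo hup x
    · exact cdf_sub_le_of_eq_four μ hμ _ hg hn hcos hsin (by linarith) (by linarith) hlo hup x
    · exact cdf_sub_le_of_eight_le μ hμ _ hg hnm hn hcos hsin (by linarith) (by linarith) hlo hup x
  · obtain ⟨k, hnk, hk⟩ : ∃ k, n = 2 * k ∧ 1 ≤ k := by
      rcases hn with hn | hn | ⟨m, hnm, hn⟩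
      · exact ⟨1, by omega, le_rfl⟩
      · exact ⟨2, by omega, by omega⟩
      · exact ⟨m, hnm, by omega⟩
    rcases le_or_gt 1.274 ((n : ℝ) / (ρ / 1.38) ^ 2) with hN | hN
    · exact cdf_sub_le_of_large μ hμ _ hg hnk hk hcos hsin h.le
        (fun s hs hsp => cos_le_charfn h3 m2 hs hsp) (fun s hs => charfn_le_cubic h3 m2 m3 hs) hN x
    · refine (cdf_sub_stdNormalCDF_le_half hsym x).trans ?_
      have hn0 : (0 : ℝ) < n := by exact_mod_cast (by omega : 0 < n)
      rw [le_div_iff₀ (Real.sqrt_pos.2 hn0)]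
      have h1 : √(n : ℝ) ≤ 0.818 * ρ := by
        rw [Real.sqrt_le_left (by positivity)]
        rw [div_lt_iff₀ (by positivity), div_pow] at hN
        have h2 : 1.274 * (ρ ^ 2 / 1.38 ^ 2) ≤ (0.818 * ρ) ^ 2 := by
          rw [mul_pow, ← mul_comm_div]
          gcongr
          norm_num
        exact hN.le.trans h2
      linarith

/-- The one-sided bound for every Hadamard order. -/
lemma coordLaw_sub_le {d : ℕ} (hd : 1 ≤ d) (H : Matrix (Fin d) (Fin d) ℝ)
    (hent : ∀ i j, H i j = 1 ∨ H i j = -1) (hHHt : H * Hᵀ = (d : ℝ) • 1)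
    (ν : Measure ℝ) [IsProbabilityMeasure ν] (σ : ℝ) {r : ℝ}
    (h3 : Integrable (fun x => |x| ^ 3) (ν.map fun a => a / σ))
    (m2 : ∫ x, x ^ 2 ∂(ν.map fun a => a / σ) = 1)
    (m3 : ∫ x, |x| ^ 3 ∂(ν.map fun a => a / σ) = r) (h1 : Integrable (fun a => a) ν)
    (i : Fin d) (x : ℝ) :
    (coordLaw H i ν σ).real (Set.Iic x) - stdNormalCDF x ≤ 0.409 * r / √d := by
  have : IsProbabilityMeasure (ν.map fun a => a / σ) :=
    Measure.isProbabilityMeasure_map (by fun_prop)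
  have hsym := map_neg_coordLaw (ν := ν) H hent i σ
  by_cases hd1 : d = 1
  · subst hd1
    have habs := map_abs_coordLaw_one (ν := ν) H hent i σ
    have hint : ∀ k : ℕ, ∫ y, |y| ^ k ∂(coordLaw H i ν σ) =
        ∫ y, |y| ^ k ∂(ν.map fun a => a / σ) := by
      intro k
      have := congrArg (fun m => ∫ y : ℝ, y ^ k ∂m) habs
      simpa only [integral_map (measurable_abs (α := ℝ)).aemeasurable
        (continuous_pow k).aestronglyMeasurable] using this
    have hi : Integrable (fun y => |y| ^ 3) (coordLaw H i ν σ) := by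
      have e : ∀ m : Measure ℝ, Integrable (fun y => |y| ^ 3) m ↔
          Integrable (fun y => y ^ 3) (m.map fun y => |y|) := fun m =>
        (integrable_map_measure (f := fun y : ℝ => |y|) (g := fun y : ℝ => y ^ 3)
          (by fun_prop) (by fun_prop)).symm
      rw [e, habs, ← e]
      exact h3
    have h2 := hint 2
    simp only [sq_abs] at h2
    have := cdf_sub_le_of_single hsym hi (h2.trans m2) ((hint 3).trans m3) x
    simpa using this
  · refine cdf_sub_le_of_even (κ := ν.map fun a => a / σ) hsym (integrable_coordLaw H i σ h1)
      ?_ ?_ (integral_sin_coordLaw H hent i σ) h3 m2 m3 x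
    · by_cases hd2 : d = 2
      · exact Or.inl hd2
      · obtain ⟨m, hm⟩ := hadamard_order H hent hHHt (by omega)
        by_cases hd4 : d = 4
        · exact Or.inr (Or.inl hd4)
        · exact Or.inr (Or.inr ⟨2 * m, by omega, by omega⟩)
    · intro t
      rw [integral_cos_coordLaw H hent i σ t, integral_map (by fun_prop) (by fun_prop)]

theorem hadamard_coordinate_berry_esseen (d : ℕ) (hd : 1 ≤ d)
    (H : Matrix (Fin d) (Fin d) ℝ)
    (hent : ∀ i j, H i j = 1 ∨ H i j = -1)
    (hHHt : H * Hᵀ = (d : ℝ) • 1)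
    (ν : Measure ℝ) [IsProbabilityMeasure ν]
    (σ ρ : ℝ) (hσ : 0 < σ)
    (h3int : Integrable (fun t => |t| ^ 3) ν)
    (h2 : (∫ t, t ^ 2 ∂ν) = σ ^ 2)
    (h3 : (∫ t, |t| ^ 3 ∂ν) = ρ)
    (i : Fin d) (t : ℝ) :
    |((pairPi d ν) {w | (1 / σ) * rhCoord H i w ≤ t}).toReal - stdNormalCDF t|
      ≤ 0.409 * ρ / (σ ^ 3 * Real.sqrt d) := by
  have hcube : ∀ a : ℝ, |a / σ| ^ 3 = (σ ^ 3)⁻¹ * |a| ^ 3 := fun a => by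
    rw [abs_div, abs_of_pos hσ]
    field_simp
  have k3 : Integrable (fun x => |x| ^ 3) (ν.map fun a => a / σ) := by
    rw [integrable_map_measure (by fun_prop) (by fun_prop)]
    simp only [Function.comp_def, hcube]
    exact h3int.const_mul _
  have m2 : ∫ x, x ^ 2 ∂(ν.map fun a => a / σ) = 1 := by
    rw [integral_map (by fun_prop) (by fun_prop)]
    simp only [div_pow]
    rw [integral_div, h2, div_self (by positivity)]
  have m3 : ∫ x, |x| ^ 3 ∂(ν.map fun a => a / σ) = ρ / σ ^ 3 := by
    rw [integral_map (by fun_prop) (by fun_prop)]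
    simp only [hcube]
    rw [integral_const_mul, h3]
    ring
  have hone := coordLaw_sub_le hd H hent hHHt ν σ k3 m2 m3 (integrable_id_of_cube h3int) i
  have hmain := abs_cdf_sub_le (map_neg_coordLaw (ν := ν) H hent i σ) hone t
  have e1 : (coordLaw H i ν σ).real (Set.Iic t) =
      ((pairPi d ν) {w | (1 / σ) * rhCoord H i w ≤ t}).toReal := by
    rw [coordLaw, map_measureReal_apply (by fun_prop) measurableSet_Iic]
    rfl
  have e2 : 0.409 * (ρ / σ ^ 3) / √(d : ℝ) = 0.409 * ρ / (σ ^ 3 * √d) := by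
    ring
  rw [e1, e2] at hmain
  exact hmain
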